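/- A tree T with at least three vertices is the graph of an outer global flat folding on a square if and only if the spine of T has at most four leaves. -/

import Mathlib

noncomputable section

open Set

/-- The closed half-plane bounded by the line through `p` with direction `d`,
lying on the counterclockwise side of that line. -/
def closedHalfPlane (p d : ℂ) : Set ℂ := {z : ℂ | 0 ≤ ((z - p) * starRingEnd ℂ d).im}

/-- The closed wedge with apex `p` spanned by the directions with angles in `[α, β]`. -/
def wedge (p : ℂ) (α β : ℝ) : Set ℂ :=
  {z : ℂ | ∃ r : ℝ, 0 ≤ r ∧ ∃ t : ℝ, α ≤ t ∧ t ≤ β ∧ z = p + r * Complex.exp (t * Complex.I)}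

/-- Euclidean three-dimensional space. -/
abbrev Space3 := EuclideanSpace ℝ (Fin 3)

/-- Vertical projection from three-dimensional space to the plane. -/
def proj2 (q : Space3) : ℂ := ⟨q 0, q 1⟩


/-- `p` is an *unfolded point* of the folding `φ` of the sheet `K`: `φ` agrees with a Euclidean
isometry on the intersection of `K` with some neighborhood of `p`. -/
def UnfoldedPtOn (K : Set ℂ) (φ : ℂ → ℂ) (p : ℂ) : Prop :=
  ∃ U ∈ nhds p, ∃ f : ℂ ≃ᵢ ℂ, Set.EqOn φ ⇑f (U ∩ K)

/-- `p` is a *crease point* of the folding `φ` of the sheet `K`: near `p`, the sheet is covered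
by the two closed half-planes bounded by a line through `p`, with `φ` agreeing with two
distinct isometries on the two halves. -/
def CreasePtOn (K : Set ℂ) (φ : ℂ → ℂ) (p : ℂ) : Prop :=
  ∃ U ∈ nhds p, ∃ d : ℂ, d ≠ 0 ∧ ∃ f₁ f₂ : ℂ ≃ᵢ ℂ, f₁ ≠ f₂ ∧
    Set.EqOn φ ⇑f₁ (U ∩ K ∩ closedHalfPlane p d) ∧
    Set.EqOn φ ⇑f₂ (U ∩ K ∩ closedHalfPlane p (-d))

/-- `p` is a *vertex point* of the folding `φ` of the sheet `K`: near `p`, the sheet is covered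
by finitely many (at least three) closed wedges with apex `p`, with `φ` agreeing with an
isometry on each wedge and at least three distinct isometries occurring. -/
def VertexPtOn (K : Set ℂ) (φ : ℂ → ℂ) (p : ℂ) : Prop :=
  ∃ U ∈ nhds p, ∃ n : ℕ, 3 ≤ n ∧ ∃ (α β : Fin n → ℝ) (f : Fin n → ℂ ≃ᵢ ℂ),
    (∀ i, α i < β i) ∧ (U ∩ K) ⊆ ⋃ i, wedge p (α i) (β i) ∧
    (∀ i, Set.EqOn φ ⇑(f i) (U ∩ K ∩ wedge p (α i) (β i))) ∧
    3 ≤ (Set.range f).ncard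

/-- An *outer local flat folding* of a compact convex region `K`: every point of `K` is an
unfolded point, a crease point, or a vertex point, and all vertex points lie on the boundary
of `K`. -/
structure IsOuterLocalFlatFolding (K : Set ℂ) (φ : ℂ → ℂ) : Prop where
  compact : IsCompact K
  convex : Convex ℝ K
  interior_nonempty : (interior K).Nonempty
  continuousOn : ContinuousOn φ K
  classify : ∀ p ∈ K, UnfoldedPtOn K φ p ∨ CreasePtOn K φ p ∨ VertexPtOn K φ p
  vertex_boundary : ∀ p ∈ K, VertexPtOn K φ p → p ∈ frontier K

/-- The creases of an outer folding are chords of `K`: `u` and `v` are boundary points, the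
open segment between them passes through the interior of `K`, and consists of crease points. -/
def IsCreaseOf (K : Set ℂ) (φ : ℂ → ℂ) (u v : ℂ) : Prop :=
  u ∈ frontier K ∧ v ∈ frontier K ∧ u ≠ v ∧
  openSegment ℝ u v ⊆ interior K ∧
  ∀ z ∈ openSegment ℝ u v, CreasePtOn K φ z

/-- An *outer global flat folding*: an outer local flat folding that, for every `ε > 0`, is
`ε`-close to the vertical projection of a topological embedding of `K` into space. -/
def IsOuterGlobalFlatFolding (K : Set ℂ) (φ : ℂ → ℂ) : Prop :=
  IsOuterLocalFlatFolding K φ ∧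
  ∀ ε : ℝ, 0 < ε → ∃ ψ : ℂ → Space3,
    Topology.IsEmbedding (fun p : K => ψ ↑p) ∧ ∀ p ∈ K, dist (φ p) (proj2 (ψ p)) ≤ ε

/-- `C` is one of the two regions into which the segment `uv` divides `K`. -/
def SideRegion (K : Set ℂ) (u v : ℂ) (C : Set ℂ) : Prop :=
  C = K ∩ {z : ℂ | 0 ≤ ((z - u) * starRingEnd ℂ (v - u)).im} ∨
  C = K ∩ {z : ℂ | ((z - u) * starRingEnd ℂ (v - u)).im ≤ 0}

/-- Along the boundary curve of `C` from `u` to `v` (the part of the boundary of `K` on `C`'s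
side), distances from `u` are monotonically increasing and distances from `v` are
monotonically decreasing. -/
def MonotoneBoundaryArc (K : Set ℂ) (u v : ℂ) (C : Set ℂ) : Prop :=
  ∃ γ : ℝ → ℂ, ContinuousOn γ (Set.Icc 0 1) ∧ γ 0 = u ∧ γ 1 = v ∧
    γ '' Set.Icc 0 1 = frontier K ∩ C ∧
    MonotoneOn (fun t => dist u (γ t)) (Set.Icc 0 1) ∧
    AntitoneOn (fun t => dist v (γ t)) (Set.Icc 0 1)

/-- Reflection of the plane across the line through `u` and `v`. -/
def lineReflect (u v z : ℂ) : ℂ := u + (v - u) * starRingEnd ℂ ((z - u) / (v - u))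

/-- A crease `uv` of `φ`, splitting off the region `C` of `K` with monotone boundary arc, is
*safe* when the reflection across the line `uv` of the boundary arc of `C` does not cross any
crease of `φ`. -/
def SafeCrease (K : Set ℂ) (φ : ℂ → ℂ) (u v : ℂ) (C : Set ℂ) : Prop :=
  IsCreaseOf K φ u v ∧ SideRegion K u v C ∧ MonotoneBoundaryArc K u v C ∧
  ∀ p ∈ lineReflect u v '' (frontier K ∩ C), p ∉ segment ℝ u v → ¬ CreasePtOn K φ p

/-- The vertices of the graph of an outer folding: boundary points of `K` lying on creases. -/
def OuterVertex (K : Set ℂ) (φ : ℂ → ℂ) : Type := {p : ℂ // ∃ q : ℂ, IsCreaseOf K φ p q}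

/-- The graph of an outer folding: vertices are boundary points of `K` on creases, and edges
join the two endpoints of each crease. -/
def outerGraph (K : Set ℂ) (φ : ℂ → ℂ) : SimpleGraph (OuterVertex K φ) :=
  SimpleGraph.fromRel fun a b => IsCreaseOf K φ a.1 b.1

/-- `K` is a (closed, solid) square in the plane. -/
def IsSquareRegion (K : Set ℂ) : Prop :=
  ∃ c w : ℂ, w ≠ 0 ∧
    K = (fun z : ℂ => c + w * z) '' {z : ℂ | z.re ∈ Set.Icc 0 1 ∧ z.im ∈ Set.Icc 0 1}


/-- The leaves of the spine of a tree `T`: the spine consists of the non-leaf vertices of `T`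
(vertices of degree different from one), and its leaves are the spine vertices having exactly
one neighbor in the spine. -/
def spineLeaves {V : Type} (T : SimpleGraph V) : Set V :=
  {v : V | (T.neighborSet v).ncard ≠ 1 ∧
    (T.neighborSet v ∩ {w : V | (T.neighborSet w).ncard ≠ 1}).ncard = 1}

/-- The signed area of the parallelogram spanned by `z - u` and `v - u`. -/
def sideOf (u v z : ℂ) : ℝ := ((z - u) * starRingEnd ℂ (v - u)).im

theorem sideOf_eq (u v z : ℂ) :
    sideOf u v z = (z.im - u.im) * (v.re - u.re) - (z.re - u.re) * (v.im - u.im) := by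
  simp [sideOf]; ring

theorem sideOf_combo (u v a b : ℂ) {s t : ℝ} (h : s + t = 1) :
    sideOf u v (s • a + t • b) = s * sideOf u v a + t * sideOf u v b := by
  obtain rfl : s = 1 - t := by linarith
  simp [sideOf_eq]; ring

@[simp] theorem sideOf_left (u v : ℂ) : sideOf u v u = 0 := by simp [sideOf]

theorem isometryEquiv_eq_of_eqOn_open {f g : ℂ ≃ᵢ ℂ} {s : Set ℂ} (hs : IsOpen s)
    (hne : s.Nonempty) (h : EqOn f g s) : f = g := by
  obtain ⟨p, hp⟩ := hne
  ext z
  have hc : Filter.Tendsto (fun t : ℝ => AffineMap.lineMap p z t) (nhds 0) (nhds p) := by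
    have : Continuous (fun t : ℝ => (AffineMap.lineMap p z t : ℂ)) :=
      AffineMap.lineMap_continuous
    simpa using this.tendsto 0
  have hev : ∀ᶠ t : ℝ in nhds 0, (AffineMap.lineMap p z t : ℂ) ∈ s :=
    hc.eventually (hs.mem_nhds hp)
  obtain ⟨ε, hε, hball⟩ := Metric.eventually_nhds_iff.1 hev
  have h2 := h (hball (y := ε / 2) (by
    rw [Real.dist_eq, sub_zero, abs_of_pos (by linarith)]; linarith))
  have h1 := h hp
  have ef : ∀ w, f w = f.toRealAffineIsometryEquiv w := fun w => by simp
  have eg : ∀ w, g w = g.toRealAffineIsometryEquiv w := fun w => by simp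
  have af : ∀ t : ℝ, f (AffineMap.lineMap p z t) = AffineMap.lineMap (f p) (f z) t := by
    intro t
    rw [ef, ef, ef]
    exact f.toRealAffineIsometryEquiv.toAffineEquiv.apply_lineMap p z t
  have ag : ∀ t : ℝ, g (AffineMap.lineMap p z t) = AffineMap.lineMap (g p) (g z) t := by
    intro t
    rw [eg, eg, eg]
    exact g.toRealAffineIsometryEquiv.toAffineEquiv.apply_lineMap p z t
  rw [af, ag, h1] at h2
  have h3 : (ε / 2 : ℝ) • (f z - g p) = (ε / 2 : ℝ) • (g z - g p) := by
    simpa [AffineMap.lineMap_apply] using h2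
  have h4 := (smul_right_injective ℂ (by positivity : (ε / 2 : ℝ) ≠ 0)) h3
  exact sub_left_injective h4

theorem mem_closedHalfPlane_of_pos {p d z : ℂ} (h : 0 < ((z - p) * starRingEnd ℂ d).im) :
    z ∈ closedHalfPlane p d := h.le

theorem closedHalfPlane_open_nonempty {N : Set ℂ} {p d : ℂ} (hN : N ∈ nhds p) (hd : d ≠ 0) :
    (interior N ∩ {z | 0 < ((z - p) * starRingEnd ℂ d).im}).Nonempty := by
  have hc : Filter.Tendsto (fun t : ℝ => p + t * (Complex.I * d)) (nhds 0) (nhds p) := by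
    have : Continuous (fun t : ℝ => p + t * (Complex.I * d)) := by fun_prop
    simpa using this.tendsto 0
  have hev := hc.eventually (isOpen_interior.mem_nhds (mem_interior_iff_mem_nhds.2 hN))
  obtain ⟨ε, hε, hball⟩ := Metric.eventually_nhds_iff.1 hev
  refine ⟨_, hball (y := ε / 2) (by
    rw [Real.dist_eq, sub_zero, abs_of_pos (by linarith)]; linarith), ?_⟩
  have : 0 < Complex.normSq d := Complex.normSq_pos.2 hd
  have e : ((p + (ε / 2 : ℝ) * (Complex.I * d) - p) * starRingEnd ℂ d).im
      = ε / 2 * Complex.normSq d := by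
    simp [Complex.normSq_apply]; ring
  rw [mem_ofPred_eq, e]; positivity

theorem isOpen_openHalfPlane (p d : ℂ) : IsOpen {z : ℂ | 0 < ((z - p) * starRingEnd ℂ d).im} :=
  isOpen_lt continuous_const
    (Complex.continuous_im.comp ((continuous_id.sub continuous_const).mul continuous_const))

theorem not_creasePtOn_of_unfolded {K : Set ℂ} {φ : ℂ → ℂ} {p : ℂ} (hp : p ∈ interior K)
    (hu : UnfoldedPtOn K φ p) : ¬ CreasePtOn K φ p := by
  rintro ⟨U, hU, d, hd, f₁, f₂, hne, h₁, h₂⟩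
  obtain ⟨W, hW, f, hf⟩ := hu
  have key : ∀ (e : ℂ) (g : ℂ ≃ᵢ ℂ), e ≠ 0 → EqOn φ g (U ∩ K ∩ closedHalfPlane p e) → f = g := by
    intro e g he hg
    have hN : U ∩ W ∩ K ∈ nhds p :=
      Filter.inter_mem (Filter.inter_mem hU hW) (mem_interior_iff_mem_nhds.1 hp)
    refine isometryEquiv_eq_of_eqOn_open (isOpen_interior.inter (isOpen_openHalfPlane p e))
      (closedHalfPlane_open_nonempty hN he) ?_
    rintro z ⟨hz, hz'⟩
    have := interior_subset hz
    rw [← hf ⟨this.1.2, this.2⟩, hg ⟨⟨this.1.1, this.2⟩, mem_closedHalfPlane_of_pos hz'⟩]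
  exact hne ((key d f₁ hd h₁).symm.trans (key (-d) f₂ (neg_ne_zero.2 hd) h₂))

theorem CreasePtOn.eventually_mem_line {K : Set ℂ} {φ : ℂ → ℂ} {p : ℂ} (hp : p ∈ interior K)
    (hc : CreasePtOn K φ p) :
    ∃ d : ℂ, d ≠ 0 ∧ ∀ᶠ z in nhds p, CreasePtOn K φ z → ((z - p) * starRingEnd ℂ d).im = 0 := by
  obtain ⟨U, hU, d, hd, f₁, f₂, hne, h₁, h₂⟩ := hc
  refine ⟨d, hd, ?_⟩
  have hN : U ∩ K ∈ nhds p := Filter.inter_mem hU (mem_interior_iff_mem_nhds.1 hp)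
  have key : ∀ (e : ℂ) (g : ℂ ≃ᵢ ℂ), EqOn φ g (U ∩ K ∩ closedHalfPlane p e) →
      ∀ z ∈ interior (U ∩ K), 0 < ((z - p) * starRingEnd ℂ e).im → ¬ CreasePtOn K φ z := by
    intro e g hg z hz hz'
    refine not_creasePtOn_of_unfolded (interior_mono inter_subset_right hz)
      ⟨interior (U ∩ K) ∩ {z | 0 < ((z - p) * starRingEnd ℂ e).im},
        (isOpen_interior.inter (isOpen_openHalfPlane p e)).mem_nhds ⟨hz, hz'⟩, g, ?_⟩
    rintro x ⟨⟨hx, hx'⟩, -⟩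
    exact hg ⟨interior_subset hx, mem_closedHalfPlane_of_pos hx'⟩
  filter_upwards [isOpen_interior.mem_nhds (mem_interior_iff_mem_nhds.2 hN)] with z hz hcz
  by_contra h0
  rcases lt_or_gt_of_ne h0 with h | h
  · refine key (-d) f₂ h₂ z hz ?_ hcz
    simpa using h
  · exact key d f₁ h₁ z hz h hcz

theorem openSegment_eventually {u v p : ℂ} (hp : p ∈ openSegment ℝ u v) :
    ∀ᶠ t : ℝ in nhds 0, p + t * (v - u) ∈ openSegment ℝ u v := by
  obtain ⟨a, b, ha, hb, hab, rfl⟩ := hp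
  filter_upwards [eventually_lt_nhds ha, eventually_gt_nhds (show -b < 0 by linarith)] with t h1 h2
  refine ⟨a - t, b + t, by linarith, by linarith, by linarith, ?_⟩
  simp only [Complex.real_smul]; push_cast; ring

theorem IsCreaseOf.dir_parallel {K : Set ℂ} {φ : ℂ → ℂ} {u v p d : ℂ} (h : IsCreaseOf K φ u v)
    (hp : p ∈ openSegment ℝ u v)
    (hd : ∀ᶠ z in nhds p, CreasePtOn K φ z → ((z - p) * starRingEnd ℂ d).im = 0) :
    ((v - u) * starRingEnd ℂ d).im = 0 := by
  have hc : Filter.Tendsto (fun t : ℝ => p + t * (v - u)) (nhds 0) (nhds p) := by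
    have : Continuous (fun t : ℝ => p + t * (v - u)) := by fun_prop
    simpa using this.tendsto 0
  obtain ⟨ε, hε, hball⟩ := Metric.eventually_nhds_iff.1
    ((hc.eventually hd).and (openSegment_eventually hp))
  have h2 := hball (y := ε / 2) (by
    rw [Real.dist_eq, sub_zero, abs_of_pos (by linarith)]; linarith)
  have h3 := h2.1 (h.2.2.2.2 _ h2.2)
  have e : ((p + (ε / 2 : ℝ) * (v - u) - p) * starRingEnd ℂ d).im
      = ε / 2 * ((v - u) * starRingEnd ℂ d).im := by
    simp [Complex.mul_im]; ring
  rw [e] at h3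
  exact (mul_eq_zero.1 h3).resolve_left (by positivity)

/-- Two creases that meet at interior points of both of them are collinear. -/
theorem IsCreaseOf.collinear_of_cross {K : Set ℂ} {φ : ℂ → ℂ} {u v u' v' p : ℂ}
    (h : IsCreaseOf K φ u v) (h' : IsCreaseOf K φ u' v') (hp : p ∈ openSegment ℝ u v)
    (hp' : p ∈ openSegment ℝ u' v') : sideOf u v u' = 0 ∧ sideOf u v v' = 0 := by
  obtain ⟨d, hd, hev⟩ := (h.2.2.2.2 p hp).eventually_mem_line (h.2.2.2.1 hp)
  have e1 := h.dir_parallel hp hev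
  have e2 := h'.dir_parallel hp' hev
  simp only [Complex.mul_im, Complex.conj_re, Complex.conj_im, Complex.sub_re, Complex.sub_im]
    at e1 e2
  have e3 : (v'.im - u'.im) * (v.re - u.re) = (v'.re - u'.re) * (v.im - u.im) := by
    have hn : 0 < d.re ^ 2 + d.im ^ 2 := by
      rw [← sq_abs d.re]
      have := Complex.normSq_pos.2 hd
      rw [Complex.normSq_apply] at this
      nlinarith [sq_abs d.re]
    have : (d.re ^ 2 + d.im ^ 2) * ((v'.im - u'.im) * (v.re - u.re)
      - (v'.re - u'.re) * (v.im - u.im)) = 0 := by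
      linear_combination
        ((v.re - u.re) * d.re + (v.im - u.im) * d.im) * e2
          - ((v'.re - u'.re) * d.re + (v'.im - u'.im) * d.im) * e1
    rcases mul_eq_zero.1 this with h | h
    · exact absurd h hn.ne'
    · linarith
  obtain ⟨a, b, ha, hb, hab, rfl⟩ := hp
  obtain ⟨a', b', ha', hb', hab', e⟩ := hp'
  obtain rfl : a = 1 - b := by linarith
  obtain rfl : a' = 1 - b' := by linarith
  have er := congrArg Complex.re e
  have ei := congrArg Complex.im e
  simp at er ei
  constructor <;> rw [sideOf_eq]
  · linear_combination (v.re - u.re) * ei - (v.im - u.im) * er - b' * e3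
  · linear_combination (1 - b') * e3 + (v.re - u.re) * ei - (v.im - u.im) * er

/-- A point of a convex set on the line of a chord lies on the chord. -/
theorem mem_segment_of_sideOf_eq_zero {K : Set ℂ} (hK : Convex ℝ K) {u v z : ℂ} (huv : u ≠ v)
    (hu : u ∈ frontier K) (hv : v ∈ frontier K)
    (hseg : openSegment ℝ u v ⊆ interior K) (hz : z ∈ K)
    (h0 : sideOf u v z = 0) : z ∈ segment ℝ u v := by
  have hm : (1 / 2 : ℝ) • u + (1 / 2 : ℝ) • v ∈ interior K :=
    hseg ⟨1 / 2, 1 / 2, by norm_num, by norm_num, by norm_num, rfl⟩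
  have hn : 0 < (v.re - u.re) ^ 2 + (v.im - u.im) ^ 2 := by
    have := Complex.normSq_pos.2 (sub_ne_zero.2 huv.symm)
    rw [Complex.normSq_apply] at this
    simp only [Complex.sub_re, Complex.sub_im] at this
    nlinarith
  rw [sideOf_eq] at h0
  obtain ⟨t, ht⟩ : ∃ t : ℝ, z = u + t * (v - u) := by
    obtain ⟨t, ht⟩ : ∃ t : ℝ, t * ((v.re - u.re) ^ 2 + (v.im - u.im) ^ 2) =
        (z.re - u.re) * (v.re - u.re) + (z.im - u.im) * (v.im - u.im) :=
      ⟨_, div_mul_cancel₀ _ hn.ne'⟩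
    refine ⟨t, Complex.ext ?_ ?_⟩
    · refine mul_left_cancel₀ hn.ne' ?_
      simp only [Complex.add_re, Complex.mul_re, Complex.sub_re, Complex.ofReal_re,
        Complex.ofReal_im]
      linear_combination (-(v.im - u.im)) * h0 - (v.re - u.re) * ht
    · refine mul_left_cancel₀ hn.ne' ?_
      simp only [Complex.add_im, Complex.mul_im, Complex.sub_im, Complex.ofReal_re,
        Complex.ofReal_im]
      linear_combination (v.re - u.re) * h0 - (v.im - u.im) * ht
  have hsub := hK.openSegment_interior_self_subset_interior hm hz
  rcases lt_or_ge t 0 with h | h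
  · exfalso
    obtain ⟨b, hb⟩ : ∃ b : ℝ, b * (1 / 2 - t) = 1 / 2 := ⟨_, div_mul_cancel₀ _ (by linarith)⟩
    have hb0 : 0 < b := by by_contra! hn; nlinarith
    have hb1 : b < 1 := by nlinarith
    refine hu.2 (hsub ⟨1 - b, b, by linarith, hb0, by ring, ?_⟩)
    subst ht
    apply Complex.ext
    · simp
      linear_combination (u.re - v.re) * hb
    · simp
      linear_combination (u.im - v.im) * hb
  rcases lt_or_ge 1 t with h' | h'
  · exfalso
    obtain ⟨b, hb⟩ : ∃ b : ℝ, b * (t - 1 / 2) = 1 / 2 := ⟨_, div_mul_cancel₀ _ (by linarith)⟩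
    have hb0 : 0 < b := by by_contra! hn; nlinarith
    have hb1 : b < 1 := by nlinarith
    refine hv.2 (hsub ⟨1 - b, b, by linarith, hb0, by ring, ?_⟩)
    subst ht
    apply Complex.ext
    · simp
      linear_combination (v.re - u.re) * hb
    · simp
      linear_combination (v.im - u.im) * hb
  · refine ⟨1 - t, t, by linarith, h, by ring, ?_⟩
    rw [ht]; simp only [Complex.real_smul]; push_cast; ring

theorem eq_or_eq_of_sideOf_eq_zero {K : Set ℂ} (hK : Convex ℝ K) {u v z : ℂ} (huv : u ≠ v)
    (hu : u ∈ frontier K) (hv : v ∈ frontier K)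
    (hseg : openSegment ℝ u v ⊆ interior K) (hz : z ∈ K) (hzf : z ∈ frontier K)
    (h0 : sideOf u v z = 0) : z = u ∨ z = v := by
  have := mem_segment_of_sideOf_eq_zero hK huv hu hv hseg hz h0
  by_contra hne
  push Not at hne
  exact hzf.2 (hseg (mem_openSegment_of_ne_left_right hne.1.symm hne.2.symm this))

section Forward

variable {V : Type} {T : SimpleGraph V}

theorem exists_leaf_of_mem_spineLeaves {v : V} (hv : v ∈ spineLeaves T) :
    ∃ w l, (∀ y, T.Adj v y → (T.neighborSet y).ncard ≠ 1 → y = w) ∧ T.Adj v w ∧ T.Adj v l ∧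
      (T.neighborSet l).ncard = 1 ∧ (T.neighborSet w).ncard ≠ 1 := by
  obtain ⟨hv1, hv2⟩ := hv
  obtain ⟨w, hw⟩ := ncard_eq_one.1 hv2
  have hw' : w ∈ T.neighborSet v ∩ {w : V | (T.neighborSet w).ncard ≠ 1} := by rw [hw]; simp
  have huniq : ∀ y, T.Adj v y → (T.neighborSet y).ncard ≠ 1 → y = w := by
    intro y h1 h2
    have : y ∈ T.neighborSet v ∩ {w : V | (T.neighborSet w).ncard ≠ 1} := ⟨h1, h2⟩
    rw [hw] at this; exact this
  have hne : T.neighborSet v ≠ {w} := fun h => hv1 (by rw [h, ncard_singleton])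
  obtain ⟨l, hl, hlw⟩ : ∃ l ∈ T.neighborSet v, l ≠ w := by
    by_contra! hcon
    exact hne (Subset.antisymm hcon (singleton_subset_iff.2 hw'.1))
  refine ⟨w, l, huniq, hw'.1, hl, ?_, hw'.2⟩
  by_contra h
  exact hlw (huniq l hl h)

theorem neighbor_unique_of_ncard_eq_one {l v x : V} (h1 : (T.neighborSet l).ncard = 1)
    (hv : T.Adj l v) (hx : T.Adj l x) : x = v := by
  obtain ⟨a, ha⟩ := ncard_eq_one.1 h1
  have h1 : v ∈ T.neighborSet l := hv
  have h2 : x ∈ T.neighborSet l := hx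
  rw [ha] at h1 h2
  rw [h1, h2]

variable {K : Set ℂ} {φ : ℂ → ℂ} {f : V → ℂ}

/-- A chord from a spine leaf to an adjacent leaf has all vertices but the spine leaf and its
adjacent leaves strictly on one side. -/
theorem exists_separating_chord [Fintype V] (hT : T.IsTree) (h3 : 3 ≤ Fintype.card V) (hK : Convex ℝ K)
    (hfK : ∀ v, f v ∈ K) (hf : Function.Injective f)
    (hcr : ∀ v w, T.Adj v w → IsCreaseOf K φ (f v) (f w)) {v : V} (hv : v ∈ spineLeaves T) :
    ∃ (l : V) (σ : ℝ), σ ≠ 0 ∧ T.Adj v l ∧ (T.neighborSet l).ncard = 1 ∧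
      ∀ x, x = v ∨ (T.Adj v x ∧ (T.neighborSet x).ncard = 1) ∨
        σ * sideOf (f v) (f l) (f x) < 0 := by
  obtain ⟨w, l, huniq, hvw, hvl, hl, hw⟩ := exists_leaf_of_mem_spineLeaves hv
  have C := hcr v l hvl
  have hne0 : ∀ y, y ≠ v → y ≠ l → sideOf (f v) (f l) (f y) ≠ 0 := by
    intro y h1 h2 h0
    obtain ⟨z, hyz⟩ : ∃ z, T.Adj y z := by
      have : Nontrivial V := Fintype.one_lt_card_iff_nontrivial.1 (by omega)
      exact hT.connected.preconnected.exists_adj_of_nontrivial y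
    rcases eq_or_eq_of_sideOf_eq_zero hK C.2.2.1 C.1 C.2.1 C.2.2.2.1 (hfK y)
      (hcr y z hyz).1 h0 with h | h
    · exact h1 (hf h)
    · exact h2 (hf h)
  have hwl : w ≠ l := by rintro rfl; exact hw hl
  have hw0 := hne0 w hvw.ne' hwl
  refine ⟨l, -sideOf (f v) (f l) (f w), neg_ne_zero.2 hw0, hvl, hl, fun x => ?_⟩
  set σ := -sideOf (f v) (f l) (f w) with hσ
  have hσ0 : σ ≠ 0 := neg_ne_zero.2 hw0
  have hσw : σ * sideOf (f v) (f l) (f w) < 0 := by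
    rw [hσ, neg_mul, neg_lt_zero]; exact mul_self_pos.2 hw0
  have hstep : ∀ x y, T.Adj x y →
      (x = v ∨ (T.Adj v x ∧ (T.neighborSet x).ncard = 1) ∨ σ * sideOf (f v) (f l) (f x) < 0) →
      (y = v ∨ (T.Adj v y ∧ (T.neighborSet y).ncard = 1) ∨
        σ * sideOf (f v) (f l) (f y) < 0) := by
    rintro x y hxy (rfl | ⟨h1, h2⟩ | h)
    · by_cases hy : (T.neighborSet y).ncard = 1
      · exact Or.inr (Or.inl ⟨hxy, hy⟩)
      · rw [huniq y hxy hy]; exact Or.inr (Or.inr hσw)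
    · exact Or.inl (neighbor_unique_of_ncard_eq_one h2 h1.symm hxy)
    · by_cases hyv : y = v
      · exact Or.inl hyv
      have hyl : y ≠ l := by
        rintro rfl
        have := neighbor_unique_of_ncard_eq_one hl hvl.symm hxy.symm
        subst this
        simp at h
      by_contra! hcon
      have hy0 : 0 < σ * sideOf (f v) (f l) (f y) :=
        lt_of_le_of_ne hcon.2.2 (mul_ne_zero hσ0 (hne0 y hyv hyl)).symm
      set A := σ * sideOf (f v) (f l) (f x)
      set B := σ * sideOf (f v) (f l) (f y)
      have hAB : 0 < B - A := by linarith
      set p := (B / (B - A)) • f x + (-A / (B - A)) • f y with hp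
      have hsum : B / (B - A) + -A / (B - A) = 1 := by field_simp; ring
      have hp1 : p ∈ openSegment ℝ (f x) (f y) :=
        ⟨_, _, div_pos hy0 hAB, div_pos (by linarith) hAB, hsum, rfl⟩
      have hp0 : sideOf (f v) (f l) p = 0 := by
        have : σ * sideOf (f v) (f l) p = B / (B - A) * A + -A / (B - A) * B := by
          rw [hp, sideOf_combo _ _ _ _ hsum]; ring
        have h2 : σ * sideOf (f v) (f l) p = 0 := by rw [this]; field_simp; ring
        exact (mul_eq_zero.1 h2).resolve_left hσ0
      have C' := hcr x y hxy
      have hpi := C'.2.2.2.1 hp1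
      have hp2 := mem_segment_of_sideOf_eq_zero hK C.2.2.1 C.1 C.2.1 C.2.2.2.1
        (interior_subset hpi) hp0
      have hp3 : p ∈ openSegment ℝ (f v) (f l) := by
        refine mem_openSegment_of_ne_left_right ?_ ?_ hp2
        · intro h; exact C.1.2 (h ▸ hpi)
        · intro h; exact C.2.1.2 (h ▸ hpi)
      have := (C.collinear_of_cross C' hp3 hp1).1
      simp only [A, this, mul_zero, lt_irrefl] at h
  obtain ⟨q⟩ := hT.connected.preconnected v x
  have hwalk : ∀ {a b : V} (q : T.Walk a b),
      (a = v ∨ (T.Adj v a ∧ (T.neighborSet a).ncard = 1) ∨ σ * sideOf (f v) (f l) (f a) < 0) →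
      (b = v ∨ (T.Adj v b ∧ (T.neighborSet b).ncard = 1) ∨
        σ * sideOf (f v) (f l) (f b) < 0) := by
    intro a b q
    induction q with
    | nil => exact id
    | cons h _ ih => exact fun h' => ih (hstep _ _ h h')
  exact hwalk q (Or.inl rfl)

/-- The corners of the square with vertex `c` and side vector `w`. -/
def squareCorner (c w : ℂ) (k : Bool × Bool) : ℂ :=
  c + w * ⟨if k.1 then 1 else 0, if k.2 then 1 else 0⟩

theorem exists_corner_pos {c w u v z : ℂ} {σ : ℝ}
    (hz : z ∈ (fun z : ℂ => c + w * z) '' {z : ℂ | z.re ∈ Set.Icc 0 1 ∧ z.im ∈ Set.Icc 0 1})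
    (h : 0 < σ * sideOf u v z) : ∃ k, 0 < σ * sideOf u v (squareCorner c w k) := by
  obtain ⟨x, ⟨⟨h1, h2⟩, h3, h4⟩, rfl⟩ := hz
  by_contra! hcon
  have e : σ * sideOf u v (c + w * x) =
      (1 - x.re) * (1 - x.im) * (σ * sideOf u v (squareCorner c w (false, false)))
      + (1 - x.re) * x.im * (σ * sideOf u v (squareCorner c w (false, true)))
      + x.re * (1 - x.im) * (σ * sideOf u v (squareCorner c w (true, false)))
      + x.re * x.im * (σ * sideOf u v (squareCorner c w (true, true))) := by
    simp [sideOf_eq, squareCorner]; ring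
  have e1 := mul_nonneg (sub_nonneg.2 h2) (sub_nonneg.2 h4)
  have e2 := mul_nonneg (sub_nonneg.2 h2) h3
  have e3 := mul_nonneg h1 (sub_nonneg.2 h4)
  have e4 := mul_nonneg h1 h3
  have f1 := mul_nonpos_of_nonneg_of_nonpos e1 (hcon (false, false))
  have f2 := mul_nonpos_of_nonneg_of_nonpos e2 (hcon (false, true))
  have f3 := mul_nonpos_of_nonneg_of_nonpos e3 (hcon (true, false))
  have f4 := mul_nonpos_of_nonneg_of_nonpos e4 (hcon (true, true))
  simp only [e] at h
  linarith

theorem exists_mem_side_pos {u v : ℂ} {σ : ℝ} (hσ : σ ≠ 0) (huv : u ≠ v)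
    (hseg : openSegment ℝ u v ⊆ interior K) : ∃ z ∈ K, 0 < σ * sideOf u v z := by
  have hp : (1 / 2 : ℝ) • u + (1 / 2 : ℝ) • v ∈ openSegment ℝ u v :=
    ⟨1 / 2, 1 / 2, by norm_num, by norm_num, by norm_num, rfl⟩
  set p := (1 / 2 : ℝ) • u + (1 / 2 : ℝ) • v with hpdef
  have hd : (σ : ℂ) * (v - u) ≠ 0 :=
    mul_ne_zero (Complex.ofReal_ne_zero.2 hσ) (sub_ne_zero.2 huv.symm)
  obtain ⟨z, hz, hz'⟩ := closedHalfPlane_open_nonempty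
    (mem_interior_iff_mem_nhds.1 (hseg hp)) hd
  refine ⟨z, interior_subset hz, ?_⟩
  have e : ((z - p) * starRingEnd ℂ ((σ : ℂ) * (v - u))).im = σ * sideOf u v z := by
    simp [sideOf_eq, hpdef]; ring
  rw [← e]; exact hz'

theorem spineLeaves_ncard_le_four [Fintype V] (hT : T.IsTree) (h3 : 3 ≤ Fintype.card V)
    (hsq : IsSquareRegion K) (hK : Convex ℝ K) (hfK : ∀ v, f v ∈ K) (hf : Function.Injective f)
    (hcr : ∀ v w, T.Adj v w → IsCreaseOf K φ (f v) (f w)) : (spineLeaves T).ncard ≤ 4 := by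
  obtain ⟨c, w, -, rfl⟩ := hsq
  set K := (fun z : ℂ => c + w * z) '' {z : ℂ | z.re ∈ Set.Icc 0 1 ∧ z.im ∈ Set.Icc 0 1}
  choose! l σ hσ hvl hl hsep using
    fun (v : V) (hv : v ∈ spineLeaves T) => exists_separating_chord hT h3 hK hfK hf hcr hv
  have hcorner : ∀ v ∈ spineLeaves T,
      ∃ k, 0 < σ v * sideOf (f v) (f (l v)) (squareCorner c w k) := by
    intro v hv
    have C := hcr v (l v) (hvl v hv)
    obtain ⟨z, hz, hz'⟩ := exists_mem_side_pos (hσ v hv) C.2.2.1 C.2.2.2.1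
    exact exists_corner_pos hz hz'
  choose! κ hκ using hcorner
  have hcK : ∀ k, squareCorner c w k ∈ K := by
    rintro ⟨a, b⟩
    refine ⟨_, ?_, rfl⟩
    cases a <;> cases b <;> simp
  have hinj : InjOn κ (spineLeaves T) := by
    intro v hv v' hv' hk
    by_contra hne
    have h1 : σ v * sideOf (f v) (f (l v)) (f v') < 0 := by
      rcases hsep v hv v' with h | h | h
      · exact absurd h.symm hne
      · exact absurd h.2 hv'.1
      · exact h
    have h2 : σ v * sideOf (f v) (f (l v)) (f (l v')) < 0 := by
      rcases hsep v hv (l v') with h | h | h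
      · exact absurd (h ▸ hl v' hv') hv.1
      · exact absurd (neighbor_unique_of_ncard_eq_one h.2 (hvl v' hv').symm h.1.symm) hne
      · exact h
    have h3 : σ v' * sideOf (f v') (f (l v')) (f v) < 0 := by
      rcases hsep v' hv' v with h | h | h
      · exact absurd h hne
      · exact absurd h.2 hv.1
      · exact h
    have h4 := hκ v hv
    have h5 := hκ v' hv'
    rw [← hk] at h5
    set A := σ v' * sideOf (f v') (f (l v')) (squareCorner c w (κ v))
    set B := σ v' * sideOf (f v') (f (l v')) (f v)
    have hAB : 0 < A - B := by linarith
    set p := (-B / (A - B)) • squareCorner c w (κ v) + (A / (A - B)) • f v with hp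
    have ha : 0 < -B / (A - B) := div_pos (by linarith) hAB
    have hb : 0 < A / (A - B) := div_pos h5 hAB
    have hsum : -B / (A - B) + A / (A - B) = 1 := by field_simp; ring
    have hpK : p ∈ K := hK (hcK _) (hfK v) ha.le hb.le hsum
    have hp0 : sideOf (f v') (f (l v')) p = 0 := by
      have : σ v' * sideOf (f v') (f (l v')) p = -B / (A - B) * A + A / (A - B) * B := by
        rw [hp, sideOf_combo _ _ _ _ hsum]; ring
      have h2 : σ v' * sideOf (f v') (f (l v')) p = 0 := by rw [this]; field_simp; ring
      exact (mul_eq_zero.1 h2).resolve_left (hσ v' hv')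
    have hpos : 0 < σ v * sideOf (f v) (f (l v)) p := by
      rw [hp, sideOf_combo _ _ _ _ hsum, sideOf_left]
      have := mul_pos ha h4
      linarith
    have C := hcr v' (l v') (hvl v' hv')
    obtain ⟨a, b, ha, hb, hab, e⟩ :=
      mem_segment_of_sideOf_eq_zero hK C.2.2.1 C.1 C.2.1 C.2.2.2.1 hpK hp0
    rw [← e, sideOf_combo _ _ _ _ hab] at hpos
    nlinarith
  calc (spineLeaves T).ncard = (κ '' spineLeaves T).ncard := hinj.ncard_image.symm
    _ ≤ (univ : Set (Bool × Bool)).ncard := ncard_le_ncard (subset_univ _)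
    _ = 4 := by simp [ncard_univ]

end Forward

/-- An oriented line `{z | ⟪z, n⟫ = b}` of the plane. -/
structure FoldLine where
  n : ℂ
  b : ℝ
  n_ne : n ≠ 0

namespace FoldLine

/-- The affine functional vanishing on the line. -/
def ev (c : FoldLine) (z : ℂ) : ℝ := z.re * c.n.re + z.im * c.n.im - c.b

/-- The reflection across the line. -/
def refl (c : FoldLine) (z : ℂ) : ℂ := z - ((2 * c.ev z / Complex.normSq c.n : ℝ) : ℂ) * c.n

variable (c : FoldLine)

theorem normSq_pos : 0 < Complex.normSq c.n := Complex.normSq_pos.2 c.n_ne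

theorem continuous_ev : Continuous c.ev := by
  unfold ev
  exact ((Complex.continuous_re.mul continuous_const).add
    (Complex.continuous_im.mul continuous_const)).sub continuous_const

theorem ev_combo (a b : ℂ) {s t : ℝ} (h : s + t = 1) :
    c.ev (s • a + t • b) = s * c.ev a + t * c.ev b := by
  obtain rfl : s = 1 - t := by linarith
  simp [ev]; ring

theorem ev_sub_eq (z p : ℂ) : c.ev z - c.ev p =
    ((z - p) * starRingEnd ℂ (-Complex.I * c.n)).im := by
  simp [ev]; ring

theorem ev_refl (z : ℂ) : c.ev (c.refl z) = -c.ev z := by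
  rw [refl]
  have h : 2 * c.ev z / Complex.normSq c.n * Complex.normSq c.n = 2 * c.ev z :=
    div_mul_cancel₀ _ c.normSq_pos.ne'
  generalize 2 * c.ev z / Complex.normSq c.n = s at h ⊢
  simp only [Complex.normSq_apply, ev] at h ⊢
  simp
  linear_combination -h

theorem refl_eq_self {z : ℂ} (h : c.ev z = 0) : c.refl z = z := by simp [refl, h]

theorem refl_ne_self {z : ℂ} (h : c.ev z ≠ 0) : c.refl z ≠ z := by
  intro e
  have := c.ev_refl z
  rw [e] at this
  exact h (by linarith)

theorem refl_refl (z : ℂ) : c.refl (c.refl z) = z := by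
  conv_lhs => rw [refl, c.ev_refl]
  rw [refl]; push_cast; ring

theorem isometry_refl : Isometry c.refl := by
  refine Isometry.of_dist_eq fun z w => ?_
  rw [Complex.dist_eq, Complex.dist_eq, Complex.norm_def, Complex.norm_def]
  congr 1
  obtain ⟨s, hs⟩ : ∃ s : ℝ, s * Complex.normSq c.n = 2 * (c.ev z - c.ev w) :=
    ⟨_, div_mul_cancel₀ _ c.normSq_pos.ne'⟩
  have e : c.refl z - c.refl w = z - w - (s : ℂ) * c.n := by
    have : s = 2 * c.ev z / Complex.normSq c.n - 2 * c.ev w / Complex.normSq c.n := by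
      have := c.normSq_pos.ne'
      field_simp; linarith
    rw [refl, refl, this]; push_cast; ring
  rw [e]
  simp only [Complex.normSq_apply, ev] at hs ⊢
  simp
  linear_combination s * hs

theorem continuous_refl : Continuous c.refl := c.isometry_refl.continuous

/-- The reflection across the line, as an isometry of the plane. -/
def reflEquiv : ℂ ≃ᵢ ℂ := IsometryEquiv.mk' c.refl c.refl c.refl_refl c.isometry_refl

open Classical in
/-- The composition of the reflections in the lines of `l` selected by `b`, the last line of the
list being applied first. -/
def act (l : List FoldLine) (b : FoldLine → Prop) (z : ℂ) : ℂ :=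
  l.foldr (fun c w => if b c then c.refl w else w) z

/-- The folding along the lines of `l`, each applied to its positive side. -/
def foldMap (l : List FoldLine) (z : ℂ) : ℂ := act l (fun c => 0 < c.ev z) z

@[simp] theorem act_nil (b : FoldLine → Prop) (z : ℂ) : act [] b z = z := rfl

theorem act_cons_pos {c : FoldLine} {l : List FoldLine} {b : FoldLine → Prop} {z : ℂ} (h : b c) :
    act (c :: l) b z = c.refl (act l b z) := by simp [act, h]

theorem act_cons_neg {c : FoldLine} {l : List FoldLine} {b : FoldLine → Prop} {z : ℂ}
    (h : ¬ b c) : act (c :: l) b z = act l b z := by simp [act, h]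

theorem act_append (l l' : List FoldLine) (b : FoldLine → Prop) (z : ℂ) :
    act (l ++ l') b z = act l b (act l' b z) := by simp [act]

theorem act_congr {l : List FoldLine} {b b' : FoldLine → Prop} (h : ∀ c ∈ l, (b c ↔ b' c))
    (z : ℂ) : act l b z = act l b' z := by
  induction l with
  | nil => rfl
  | cons c l ih =>
    have ih := ih fun x hx => h x (List.mem_cons_of_mem _ hx)
    have hc := h c List.mem_cons_self
    by_cases hb : b c
    · rw [act_cons_pos hb, act_cons_pos (hc.1 hb), ih]
    · rw [act_cons_neg hb, act_cons_neg (fun h => hb (hc.2 h)), ih]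

/-- The isometry underlying `FoldLine.act`. -/
theorem exists_actEquiv (l : List FoldLine) (b : FoldLine → Prop) :
    ∃ f : ℂ ≃ᵢ ℂ, ∀ z, f z = act l b z := by
  induction l with
  | nil => exact ⟨IsometryEquiv.refl ℂ, fun z => rfl⟩
  | cons c l ih =>
    obtain ⟨f, hf⟩ := ih
    by_cases hb : b c
    · exact ⟨f.trans c.reflEquiv, fun z => by rw [act_cons_pos hb, ← hf]; rfl⟩
    · exact ⟨f, fun z => by rw [act_cons_neg hb, ← hf]⟩

/-- `FoldLine.act` as an isometry of the plane. -/
def actEquiv (l : List FoldLine) (b : FoldLine → Prop) : ℂ ≃ᵢ ℂ := (exists_actEquiv l b).choose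

@[simp] theorem actEquiv_apply (l : List FoldLine) (b : FoldLine → Prop) (z : ℂ) :
    actEquiv l b z = act l b z := (exists_actEquiv l b).choose_spec z

theorem act_eq_self {l : List FoldLine} {b : FoldLine → Prop} {z : ℂ}
    (h : ∀ c ∈ l, b c → c.ev z = 0) : act l b z = z := by
  induction l with
  | nil => rfl
  | cons c l ih =>
    have ih := ih fun x hx => h x (List.mem_cons_of_mem _ hx)
    by_cases hb : b c
    · rw [act_cons_pos hb, ih, refl_eq_self _ (h c List.mem_cons_self hb)]
    · rw [act_cons_neg hb, ih]

/-- The chords cut out of `K` by the lines of the list do not enter the positive sides of later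
lines of the list. -/
def Nested (K : Set ℂ) (l : List FoldLine) : Prop :=
  l.Pairwise fun i j => (∀ z ∈ K, i.ev z = 0 → j.ev z ≤ 0) ∧
    ∀ z ∈ interior K, i.ev z = 0 → j.ev z < 0

/-- `b` is a possible choice of sides for the point `z`. -/
def Compat (l : List FoldLine) (b : FoldLine → Prop) (z : ℂ) : Prop :=
  ∀ c ∈ l, (b c → 0 ≤ c.ev z) ∧ (¬ b c → c.ev z ≤ 0)

theorem Compat.act_eq {K : Set ℂ} {l : List FoldLine} (hl : Nested K l) {b b' : FoldLine → Prop}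
    {z : ℂ} (hz : z ∈ K) (h : Compat l b z) (h' : Compat l b' z) : act l b z = act l b' z := by
  induction l with
  | nil => rfl
  | cons c l ih =>
    have hl' := List.pairwise_cons.1 hl
    have ih := ih hl'.2 (fun x hx => h x (List.mem_cons_of_mem _ hx))
      (fun x hx => h' x (List.mem_cons_of_mem _ hx))
    have hc := h c List.mem_cons_self
    have hc' := h' c List.mem_cons_self
    have key : c.ev z = 0 → act l b z = z := fun h0 => act_eq_self fun x hx hb =>
      le_antisymm ((hl'.1 x hx).1 z hz h0) ((h x (List.mem_cons_of_mem _ hx)).1 hb)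
    by_cases hb : b c <;> by_cases hb' : b' c
    · rw [act_cons_pos hb, act_cons_pos hb', ih]
    · have h0 : c.ev z = 0 := le_antisymm (hc'.2 hb') (hc.1 hb)
      rw [act_cons_pos hb, act_cons_neg hb', ← ih, key h0, refl_eq_self _ h0]
    · have h0 : c.ev z = 0 := le_antisymm (hc.2 hb) (hc'.1 hb')
      rw [act_cons_neg hb, act_cons_pos hb', ← ih, key h0, refl_eq_self _ h0]
    · rw [act_cons_neg hb, act_cons_neg hb', ih]

theorem Compat.foldMap_eq {K : Set ℂ} {l : List FoldLine} (hl : Nested K l)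
    {b : FoldLine → Prop} {z : ℂ} (hz : z ∈ K) (h : Compat l b z) : foldMap l z = act l b z :=
  Compat.act_eq hl hz (fun _ _ => ⟨le_of_lt, le_of_not_gt⟩) h

theorem continuousOn_foldMap {K : Set ℂ} {l : List FoldLine} (hl : Nested K l) :
    ContinuousOn (foldMap l) K := by
  induction l with
  | nil => exact continuousOn_id
  | cons c l ih =>
    have hl' := List.pairwise_cons.1 hl
    have ih := ih hl'.2
    have e : foldMap (c :: l) = fun z => if 0 < c.ev z then c.refl (foldMap l z)
        else foldMap l z := by
      funext z
      by_cases h : 0 < c.ev z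
      · rw [if_pos h]; exact act_cons_pos h
      · rw [if_neg h]; exact act_cons_neg h
    rw [e]
    refine ContinuousOn.if ?_ ?_ ?_
    · rintro z ⟨hz, hzf⟩
      have h0 : 0 = c.ev z := frontier_lt_subset_eq continuous_const c.continuous_ev hzf
      have : foldMap l z = z := act_eq_self fun x hx hb =>
        absurd ((hl'.1 x hx).1 z hz h0.symm) (not_le.2 hb)
      rw [this, refl_eq_self _ h0.symm]
    · exact c.continuous_refl.comp_continuousOn (ih.mono inter_subset_left)
    · exact ih.mono inter_subset_left

theorem eventually_sign (l : List FoldLine) (p : ℂ) :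
    ∀ᶠ z in nhds p, ∀ c ∈ l, c.ev p ≠ 0 → ((0 < c.ev p → 0 < c.ev z) ∧
      (c.ev p < 0 → c.ev z < 0)) := by
  refine (Filter.eventually_all_finite l.finite_toSet).2 fun c _ => ?_
  rcases lt_trichotomy (c.ev p) 0 with h | h | h
  · filter_upwards [c.continuous_ev.continuousAt.eventually_lt_const h] with z hz _
    exact ⟨fun h' => absurd h' h.not_gt, fun _ => hz⟩
  · exact Filter.Eventually.of_forall fun z h' => absurd h h'
  · filter_upwards [c.continuous_ev.continuousAt.eventually_const_lt h] with z hz _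
    exact ⟨fun _ => hz, fun h' => absurd h' h.not_gt⟩

theorem unfoldedPtOn_foldMap {K : Set ℂ} {l : List FoldLine} (hl : Nested K l) {p : ℂ}
    (h : ∀ c ∈ l, c.ev p ≠ 0) : UnfoldedPtOn K (foldMap l) p := by
  refine ⟨_, eventually_sign l p, actEquiv l fun c => 0 < c.ev p, ?_⟩
  rintro z ⟨hz, hzK⟩
  rw [actEquiv_apply]
  refine Compat.foldMap_eq hl hzK fun c hc => ⟨fun hb => ((hz c hc (h c hc)).1 hb).le,
    fun hb => ((hz c hc (h c hc)).2 (lt_of_le_of_ne (le_of_not_gt hb) (h c hc))).le⟩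

theorem Nested.exists_split {K : Set ℂ} {l : List FoldLine} (hl : Nested K l) {p : ℂ}
    (hp : p ∈ interior K) {c : FoldLine} (hc : c ∈ l) (h0 : c.ev p = 0) :
    ∃ l₁ l₂, l = l₁ ++ c :: l₂ ∧ (∀ x ∈ l₁, x.ev p ≠ 0) ∧ ∀ x ∈ l₂, x.ev p ≠ 0 := by
  obtain ⟨l₁, l₂, rfl⟩ := List.append_of_mem hc
  refine ⟨l₁, l₂, rfl, fun x hx hx0 => ?_, fun x hx hx0 => ?_⟩
  · have := ((List.pairwise_append.1 hl).2.2 x hx c List.mem_cons_self).2 p hp hx0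
    exact this.ne h0
  · have := ((List.pairwise_cons.1 (List.pairwise_append.1 hl).2.1).1 x hx).2 p hp h0
    exact this.ne hx0

theorem Nested.eq_of_ev_eq_zero {K : Set ℂ} {l : List FoldLine} (hl : Nested K l) {p : ℂ}
    (hp : p ∈ interior K) {c x : FoldLine} (hc : c ∈ l) (h0 : c.ev p = 0) (hx : x ∈ l)
    (hx0 : x.ev p = 0) : x = c := by
  obtain ⟨l₁, l₂, rfl, h1, h2⟩ := hl.exists_split hp hc h0
  rcases List.mem_append.1 hx with h | h
  · exact absurd hx0 (h1 x h)
  · rcases List.mem_cons.1 h with h | h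
    · exact h
    · exact absurd hx0 (h2 x h)

theorem Nested.crease_isometries {K : Set ℂ} {l : List FoldLine} (hl : Nested K l) {p : ℂ}
    (hp : p ∈ interior K) {c : FoldLine} (hc : c ∈ l) (h0 : c.ev p = 0) :
    ∃ U ∈ nhds p, ∃ f₁ f₂ : ℂ ≃ᵢ ℂ, f₁ ≠ f₂ ∧
      (∀ z ∈ U ∩ K, 0 ≤ c.ev z → foldMap l z = f₁ z) ∧
      (∀ z ∈ U ∩ K, c.ev z ≤ 0 → foldMap l z = f₂ z) := by
  have hnz : ∀ x ∈ l, x ≠ c → x.ev p ≠ 0 := fun x hx hxc h =>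
    hxc (hl.eq_of_ev_eq_zero hp hc h0 hx h)
  refine ⟨_, eventually_sign l p, actEquiv l fun x => x = c ∨ 0 < x.ev p,
    actEquiv l fun x => 0 < x.ev p, ?_, ?_, ?_⟩
  · intro he
    obtain ⟨l₁, l₂, rfl, h1, h2⟩ := hl.exists_split hp hc h0
    obtain ⟨w, hw⟩ : ∃ w, c.ev w ≠ 0 := by
      by_contra! h
      have e := c.ev_sub_eq (p + c.n) p
      rw [h, h] at e
      simp at e
      have := c.normSq_pos
      rw [Complex.normSq_apply] at this
      linarith
    obtain ⟨z, hz⟩ := (actEquiv l₂ fun x => 0 < x.ev p).surjective w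
    rw [actEquiv_apply] at hz
    have e := DFunLike.congr_fun he z
    rw [actEquiv_apply, actEquiv_apply, act_append, act_append, act_cons_pos (Or.inl rfl),
      act_cons_neg (by rw [h0]; exact lt_irrefl 0)] at e
    have e1 : ∀ x, x.ev p ≠ 0 → (x = c ∨ 0 < x.ev p ↔ 0 < x.ev p) := by
      intro x hx
      have : x ≠ c := by rintro rfl; exact hx h0
      simp [this]
    rw [act_congr (fun x hx => e1 x (h1 x hx)), act_congr (fun x hx => e1 x (h2 x hx)), hz,
      ← actEquiv_apply, ← actEquiv_apply] at e
    exact c.refl_ne_self hw ((actEquiv l₁ _).injective e)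
  · rintro z ⟨hz, hzK⟩ hcz
    rw [actEquiv_apply]
    refine Compat.foldMap_eq hl hzK fun x hx => ?_
    by_cases hxc : x = c
    · subst hxc; exact ⟨fun _ => hcz, fun h => absurd (Or.inl rfl) h⟩
    · have := hz x hx (hnz x hx hxc)
      refine ⟨fun hb => (this.1 (hb.resolve_left hxc)).le, fun hb => (this.2 ?_).le⟩
      exact lt_of_le_of_ne (le_of_not_gt fun h => hb (Or.inr h)) (hnz x hx hxc)
  · rintro z ⟨hz, hzK⟩ hcz
    rw [actEquiv_apply]
    refine Compat.foldMap_eq hl hzK fun x hx => ?_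
    by_cases hxc : x = c
    · subst hxc; exact ⟨fun h => absurd h (by rw [h0]; exact lt_irrefl 0), fun _ => hcz⟩
    · have := hz x hx (hnz x hx hxc)
      refine ⟨fun hb => (this.1 hb).le, fun hb => (this.2 ?_).le⟩
      exact lt_of_le_of_ne (le_of_not_gt hb) (hnz x hx hxc)

theorem Nested.creasePtOn {K : Set ℂ} {l : List FoldLine} (hl : Nested K l) {p : ℂ}
    (hp : p ∈ interior K) {c : FoldLine} (hc : c ∈ l) (h0 : c.ev p = 0) :
    CreasePtOn K (foldMap l) p := by
  obtain ⟨U, hU, f₁, f₂, hne, h1, h2⟩ := hl.crease_isometries hp hc h0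
  have e : ∀ z, c.ev z = ((z - p) * starRingEnd ℂ (-Complex.I * c.n)).im := fun z => by
    rw [← c.ev_sub_eq, h0, sub_zero]
  refine ⟨U, hU, -Complex.I * c.n, mul_ne_zero (by simp) c.n_ne, f₁, f₂, hne, ?_, ?_⟩
  · rintro z ⟨hz, hzp⟩
    refine h1 z hz ?_
    rw [e]; exact hzp
  · rintro z ⟨hz, hzp⟩
    refine h2 z hz ?_
    have : 0 ≤ ((z - p) * starRingEnd ℂ (-(-Complex.I * c.n))).im := hzp
    rw [map_neg, mul_neg, Complex.neg_im] at this
    rw [e]; linarith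

theorem creasePtOn_iff {K : Set ℂ} {l : List FoldLine} (hl : Nested K l) {p : ℂ}
    (hp : p ∈ interior K) : CreasePtOn K (foldMap l) p ↔ ∃ c ∈ l, c.ev p = 0 := by
  refine ⟨fun h => ?_, fun ⟨c, hc, h0⟩ => hl.creasePtOn hp hc h0⟩
  by_contra! hcon
  exact not_creasePtOn_of_unfolded hp (unfoldedPtOn_foldMap hl hcon) h

end FoldLine

theorem exists_mem_interior_wedge {p : ℂ} {N : Set ℂ} (hN : N ∈ nhds p) {α β : ℝ} (h : α < β) :
    (interior (N ∩ wedge p α β)).Nonempty := by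
  set θ := (α + β) / 2 with hθ
  have hc : Filter.Tendsto (fun t : ℝ => p + t * Complex.exp (θ * Complex.I)) (nhds 0)
      (nhds p) := by
    have : Continuous (fun t : ℝ => p + t * Complex.exp (θ * Complex.I)) := by fun_prop
    simpa using this.tendsto 0
  obtain ⟨ε, hε, hball⟩ := Metric.eventually_nhds_iff.1
    (hc.eventually (isOpen_interior.mem_nhds (mem_interior_iff_mem_nhds.2 hN)))
  have hz := hball (y := ε / 2) (by
    rw [Real.dist_eq, sub_zero, abs_of_pos (by linarith)]; linarith)
  set z₀ := p + ((ε / 2 : ℝ) : ℂ) * Complex.exp (θ * Complex.I) with hz₀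
  refine ⟨z₀, mem_interior_iff_mem_nhds.2 (Filter.inter_mem (mem_interior_iff_mem_nhds.1 hz) ?_)⟩
  have e0 : (z₀ - p) * Complex.exp (-(θ * Complex.I)) = ((ε / 2 : ℝ) : ℂ) := by
    rw [hz₀, add_sub_cancel_left, mul_assoc, ← Complex.exp_add]; simp
  have hca : ContinuousAt (fun z => Complex.arg ((z - p) * Complex.exp (-(θ * Complex.I)))) z₀ := by
    refine ContinuousAt.comp (g := Complex.arg)
      (f := fun z => (z - p) * Complex.exp (-(θ * Complex.I))) ?_ (by fun_prop)
    rw [e0]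
    exact Complex.continuousAt_arg (Complex.ofReal_mem_slitPlane.2 (by positivity))
  have h0 : Complex.arg ((z₀ - p) * Complex.exp (-(θ * Complex.I))) = 0 := by
    rw [e0]; exact Complex.arg_ofReal_of_nonneg (by positivity)
  have hlt := hca.eventually (eventually_lt_nhds (b := (β - α) / 2) (by beta_reduce; rw [h0]; linarith))
  have hgt := hca.eventually (eventually_gt_nhds (b := -(β - α) / 2) (by beta_reduce; rw [h0]; linarith))
  filter_upwards [hlt, hgt] with z h1 h2
  set ζ := (z - p) * Complex.exp (-(θ * Complex.I)) with hζ
  refine ⟨‖ζ‖, norm_nonneg _, θ + Complex.arg ζ, by linarith, by linarith, ?_⟩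
  push_cast
  rw [add_mul, Complex.exp_add, mul_left_comm, Complex.norm_mul_exp_arg_mul_I, hζ, mul_left_comm,
    ← Complex.exp_add]
  simp

namespace FoldLine

theorem exists_open_signed {W : Set ℂ} (c : FoldLine) (hW : (interior W).Nonempty) :
    ∃ s ⊆ W, IsOpen s ∧ s.Nonempty ∧ ((∀ z ∈ s, 0 ≤ c.ev z) ∨ ∀ z ∈ s, c.ev z ≤ 0) := by
  obtain ⟨x, hx⟩ := hW
  rcases lt_or_ge (c.ev x) 0 with h | h
  · exact ⟨interior W ∩ {z | c.ev z < 0}, inter_subset_left.trans interior_subset,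
      isOpen_interior.inter (isOpen_lt c.continuous_ev continuous_const), ⟨x, hx, h⟩,
      Or.inr fun z hz => le_of_lt hz.2⟩
  · obtain ⟨z, hz, hz'⟩ := closedHalfPlane_open_nonempty (mem_interior_iff_mem_nhds.1 hx)
      (mul_ne_zero (neg_ne_zero.2 Complex.I_ne_zero) c.n_ne)
    have hz' : 0 < ((z - x) * starRingEnd ℂ (-Complex.I * c.n)).im := hz'
    rw [← c.ev_sub_eq] at hz'
    exact ⟨interior W ∩ {z | 0 < c.ev z}, inter_subset_left.trans interior_subset,
      isOpen_interior.inter (isOpen_lt continuous_const c.continuous_ev), ⟨z, hz, by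
        show 0 < c.ev z
        linarith⟩, Or.inl fun z hz => le_of_lt hz.2⟩

theorem Nested.not_vertexPtOn {K : Set ℂ} {l : List FoldLine} (hl : Nested K l) {p : ℂ}
    (hp : p ∈ interior K) : ¬ VertexPtOn K (foldMap l) p := by
  rintro ⟨U, hU, n, -, α, β, f, hαβ, -, hf, h3⟩
  obtain ⟨f₁, f₂, hr⟩ : ∃ f₁ f₂, ∀ i, f i = f₁ ∨ f i = f₂ := by
    by_cases hc : ∃ c ∈ l, c.ev p = 0
    · obtain ⟨c, hc, h0⟩ := hc
      obtain ⟨W, hW, f₁, f₂, -, h1, h2⟩ := hl.crease_isometries hp hc h0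
      refine ⟨f₁, f₂, fun i => ?_⟩
      have hN : U ∩ W ∩ K ∈ nhds p :=
        Filter.inter_mem (Filter.inter_mem hU hW) (mem_interior_iff_mem_nhds.1 hp)
      obtain ⟨s, hsub, hso, hsn, h | h⟩ := exists_open_signed c
        (exists_mem_interior_wedge hN (hαβ i))
      · left
        refine isometryEquiv_eq_of_eqOn_open hso hsn fun z hz => ?_
        have hz' := hsub hz
        rw [← hf i ⟨⟨hz'.1.1.1, hz'.1.2⟩, hz'.2⟩, h1 z ⟨hz'.1.1.2, hz'.1.2⟩ (h z hz)]
      · right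
        refine isometryEquiv_eq_of_eqOn_open hso hsn fun z hz => ?_
        have hz' := hsub hz
        rw [← hf i ⟨⟨hz'.1.1.1, hz'.1.2⟩, hz'.2⟩, h2 z ⟨hz'.1.1.2, hz'.1.2⟩ (h z hz)]
    · push Not at hc
      obtain ⟨W, hW, g, hg⟩ := unfoldedPtOn_foldMap hl hc
      refine ⟨g, g, fun i => Or.inl ?_⟩
      have hN : U ∩ W ∩ K ∈ nhds p :=
        Filter.inter_mem (Filter.inter_mem hU hW) (mem_interior_iff_mem_nhds.1 hp)
      refine isometryEquiv_eq_of_eqOn_open isOpen_interior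
        (exists_mem_interior_wedge hN (hαβ i)) fun z hz => ?_
      have hz' := interior_subset hz
      rw [← hf i ⟨⟨hz'.1.1.1, hz'.1.2⟩, hz'.2⟩, hg ⟨hz'.1.1.2, hz'.1.2⟩]
  have : (range f).ncard ≤ ({f₁, f₂} : Set (ℂ ≃ᵢ ℂ)).ncard := by
    refine ncard_le_ncard ?_ (by simp)
    rintro _ ⟨i, rfl⟩
    simpa using hr i
  have := ncard_insert_le f₁ {f₂}
  rw [ncard_singleton] at this
  omega

/-- The derivative of `FoldLine.ev` in the direction of angle `t`. -/
def slope (c : FoldLine) (t : ℝ) : ℝ := Real.cos t * c.n.re + Real.sin t * c.n.im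

theorem ev_polar (c : FoldLine) (p : ℂ) (r t : ℝ) :
    c.ev (p + r * Complex.exp (t * Complex.I)) = c.ev p + r * c.slope t := by
  rw [Complex.exp_mul_I, ← Complex.ofReal_cos, ← Complex.ofReal_sin]
  simp [ev, slope, Complex.cos_ofReal_re, Complex.sin_ofReal_re]; ring

theorem continuous_slope (c : FoldLine) : Continuous c.slope := by
  unfold slope; fun_prop

theorem eventually_slope_sign (c : FoldLine) (t : ℝ) :
    ∀ᶠ δ in nhdsWithin (0 : ℝ) (Ioi 0),
      ((∀ s ∈ Icc t (t + δ), 0 ≤ c.slope s) ∨ ∀ s ∈ Icc t (t + δ), c.slope s ≤ 0) ∧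
      ((∀ s ∈ Icc (t - δ) t, 0 ≤ c.slope s) ∨ ∀ s ∈ Icc (t - δ) t, c.slope s ≤ 0) := by
  have hpi : ∀ᶠ δ : ℝ in nhdsWithin (0 : ℝ) (Ioi 0), δ < Real.pi :=
    Filter.Eventually.filter_mono nhdsWithin_le_nhds (eventually_lt_nhds Real.pi_pos)
  have aux : ∀ P : ℝ → Prop, (∀ᶠ s in nhds t, P s) →
      ∀ᶠ δ in nhdsWithin (0 : ℝ) (Ioi 0), ∀ s, |s - t| ≤ δ → P s := by
    intro P hP
    obtain ⟨ε, hε, hball⟩ := Metric.eventually_nhds_iff.1 hP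
    filter_upwards [Filter.Eventually.filter_mono nhdsWithin_le_nhds (eventually_lt_nhds hε)]
      with δ hδ s hs
    exact hball (lt_of_le_of_lt hs hδ)
  rcases lt_trichotomy (c.slope t) 0 with h | h | h
  · filter_upwards [aux _ (c.continuous_slope.continuousAt.eventually_lt_const h)] with δ hδ
    refine ⟨Or.inr fun s hs => (hδ s ?_).le, Or.inr fun s hs => (hδ s ?_).le⟩ <;>
    · rw [abs_le]; constructor <;> linarith [hs.1, hs.2]
  · set d := -Real.sin t * c.n.re + Real.cos t * c.n.im
    have e : ∀ s, c.slope s = d * Real.sin (s - t) := by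
      intro s
      have : s = t + (s - t) := by ring
      conv_lhs => rw [slope, this, Real.cos_add, Real.sin_add]
      rw [slope] at h
      simp only [d]
      linear_combination Real.cos (s - t) * h
    filter_upwards [hpi, self_mem_nhdsWithin] with δ hδ hδ0
    have s1 : ∀ s ∈ Icc t (t + δ), 0 ≤ Real.sin (s - t) := fun s hs =>
      Real.sin_nonneg_of_nonneg_of_le_pi (by linarith [hs.1]) (by linarith [hs.2])
    have s2 : ∀ s ∈ Icc (t - δ) t, Real.sin (s - t) ≤ 0 := fun s hs =>
      Real.sin_nonpos_of_nonpos_of_neg_pi_le (by linarith [hs.2]) (by linarith [hs.1])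
    rcases le_total 0 d with hd | hd
    · exact ⟨Or.inl fun s hs => by rw [e]; exact mul_nonneg hd (s1 s hs),
        Or.inr fun s hs => by rw [e]; exact mul_nonpos_of_nonneg_of_nonpos hd (s2 s hs)⟩
    · exact ⟨Or.inr fun s hs => by rw [e]; exact mul_nonpos_of_nonpos_of_nonneg hd (s1 s hs),
        Or.inl fun s hs => by rw [e]; exact mul_nonneg_of_nonpos_of_nonpos hd (s2 s hs)⟩
  · filter_upwards [aux _ (c.continuous_slope.continuousAt.eventually_const_lt h)] with δ hδ
    refine ⟨Or.inl fun s hs => (hδ s ?_).le, Or.inl fun s hs => (hδ s ?_).le⟩ <;>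
    · rw [abs_le]; constructor <;> linarith [hs.1, hs.2]

theorem exists_slope_interval (l : List FoldLine) (t : ℝ) :
    ∃ δ : ℝ, 0 < δ ∧ (∃ b : FoldLine → Prop, ∀ s ∈ Icc t (t + δ), ∀ c ∈ l,
        (b c → 0 ≤ c.slope s) ∧ (¬ b c → c.slope s ≤ 0)) ∧
      (∃ b : FoldLine → Prop, ∀ s ∈ Icc (t - δ) t, ∀ c ∈ l,
        (b c → 0 ≤ c.slope s) ∧ (¬ b c → c.slope s ≤ 0)) := by
  have h := (Filter.eventually_all_finite l.finite_toSet).2 fun c _ => c.eventually_slope_sign t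
  obtain ⟨δ, hδ, hδ0⟩ := (h.and self_mem_nhdsWithin).exists
  exact ⟨δ, hδ0, ⟨fun c => ∀ s ∈ Icc t (t + δ), 0 ≤ c.slope s, fun s hs c hc =>
      ⟨fun hb => hb s hs, fun hb => ((hδ c hc).1.resolve_left hb) s hs⟩⟩,
    ⟨fun c => ∀ s ∈ Icc (t - δ) t, 0 ≤ c.slope s, fun s hs c hc =>
      ⟨fun hb => hb s hs, fun hb => ((hδ c hc).2.resolve_left hb) s hs⟩⟩⟩

/-- The rotation-and-translation isometry sending `p` to `q` with linear part `ω`. -/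
theorem exists_isometryEquiv (p q : ℂ) {ω : ℂ} (hω : ‖ω‖ = 1) :
    ∃ f : ℂ ≃ᵢ ℂ, ∀ z, f z = q + ω * (z - p) := by
  have h0 : ω ≠ 0 := by rintro rfl; simp at hω
  refine ⟨IsometryEquiv.mk' (fun z => q + ω * (z - p)) (fun z => p + ω⁻¹ * (z - q)) ?_ ?_,
    fun z => rfl⟩
  · intro z; field_simp; ring
  · refine Isometry.of_dist_eq fun z w => ?_
    rw [Complex.dist_eq, Complex.dist_eq]
    have : q + ω * (z - p) - (q + ω * (w - p)) = ω * (z - w) := by ring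
    rw [this, norm_mul, hω, one_mul]

theorem vertexPtOn_of_fintype {K : Set ℂ} {φ : ℂ → ℂ} {p : ℂ} {U : Set ℂ} (hU : U ∈ nhds p)
    {J : Type} [Finite J] (α β : J → ℝ) (f : J → ℂ ≃ᵢ ℂ) (hαβ : ∀ i, α i < β i)
    (hcov : U ∩ K ⊆ ⋃ i, wedge p (α i) (β i))
    (hf : ∀ i, EqOn φ (f i) (U ∩ K ∩ wedge p (α i) (β i)))
    (h3 : 3 ≤ (range f).ncard) : VertexPtOn K φ p := by
  have : Fintype J := Fintype.ofFinite J
  let e := (Fintype.equivFin J).symm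
  refine ⟨U, hU, Fintype.card J, ?_, α ∘ e, β ∘ e, f ∘ e, fun i => hαβ _, ?_, fun i => hf _, ?_⟩
  · refine h3.trans ?_
    rw [← image_univ]
    refine (ncard_image_le finite_univ).trans ?_
    simp [ncard_univ, Nat.card_eq_fintype_card]
  · intro z hz
    obtain ⟨i, hi⟩ := mem_iUnion.1 (hcov hz)
    exact mem_iUnion.2 ⟨e.symm i, by simpa using hi⟩
  · rwa [range_comp, e.range_eq_univ, image_univ]

theorem Nested.vertexPtOn {K : Set ℂ} {l : List FoldLine} (hl : Nested K l) {p : ℂ}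
    {θ : ℝ} (hθ : ∀ z ∈ K, (z.re - p.re) * Real.cos θ + (z.im - p.im) * Real.sin θ ≤ 0) :
    VertexPtOn K (foldMap l) p := by
  choose δ hδ h1 h2 using exists_slope_interval l
  choose b₁ hb₁ using h1
  choose b₂ hb₂ using h2
  obtain ⟨F, -, hF⟩ := (isCompact_Icc (a := -Real.pi) (b := Real.pi)).elim_nhds_subcover
    (fun t => Ioo (t - δ t) (t + δ t))
    (fun t _ => Ioo_mem_nhds (by linarith [hδ t]) (by linarith [hδ t]))
  set U := {z | ∀ c ∈ l, c.ev p ≠ 0 → ((0 < c.ev p → 0 < c.ev z) ∧ (c.ev p < 0 → c.ev z < 0))}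
  have hU : U ∈ nhds p := eventually_sign l p
  let side (b : FoldLine → Prop) : FoldLine → Prop :=
    fun c => (c.ev p = 0 ∧ b c) ∨ 0 < c.ev p
  have hside : ∀ (b : FoldLine → Prop) (a₁ a₂ : ℝ), (∀ s ∈ Icc a₁ a₂, ∀ c ∈ l,
      (b c → 0 ≤ c.slope s) ∧ (¬ b c → c.slope s ≤ 0)) →
      EqOn (foldMap l) (actEquiv l (side b)) (U ∩ K ∩ wedge p a₁ a₂) := by
    rintro b a₁ a₂ hb z ⟨⟨hzU, hzK⟩, r, hr, t, ht1, ht2, rfl⟩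
    rw [actEquiv_apply]
    refine Compat.foldMap_eq hl hzK fun c hc => ?_
    by_cases h0 : c.ev p = 0
    · rw [ev_polar, h0, zero_add]
      have := hb t ⟨ht1, ht2⟩ c hc
      simp only [side, h0, true_and, lt_irrefl, or_false]
      exact ⟨fun h => mul_nonneg hr (this.1 h),
        fun h => mul_nonpos_of_nonneg_of_nonpos hr (this.2 h)⟩
    · have := hzU c hc h0
      simp only [side, h0, false_and, false_or]
      exact ⟨fun h => (this.1 h).le,
        fun h => (this.2 (lt_of_le_of_ne (le_of_not_gt h) h0)).le⟩
  choose g hg using fun (ω : ℂ) (hω : ‖ω‖ = 1) => exists_isometryEquiv p (foldMap l p) hω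
  let ω : Fin 3 → ℂ := ![1, -1, Complex.I]
  have hω : ∀ i, ‖ω i‖ = 1 := by intro i; fin_cases i <;> simp [ω]
  have hωi : Function.Injective ω := by
    intro i j h
    have h1 := congrArg Complex.re h
    have h2 := congrArg Complex.im h
    fin_cases i <;> fin_cases j <;> simp [ω] at h1 h2 ⊢ <;> norm_num at h1
  let α : Fin 3 ⊕ (F × Bool) → ℝ := Sum.elim (fun _ => θ - 1)
    fun x => if x.2 then x.1.1 else x.1.1 - δ x.1.1
  let β : Fin 3 ⊕ (F × Bool) → ℝ := Sum.elim (fun _ => θ + 1)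
    fun x => if x.2 then x.1.1 + δ x.1.1 else x.1.1
  let f : Fin 3 ⊕ (F × Bool) → ℂ ≃ᵢ ℂ := Sum.elim (fun i => g (ω i) (hω i))
    fun x => actEquiv l (side (if x.2 then b₁ x.1.1 else b₂ x.1.1))
  refine vertexPtOn_of_fintype hU α β f ?_ ?_ ?_ ?_
  · rintro (i | ⟨t, _ | _⟩)
    · simp only [α, β, Sum.elim_inl]; linarith
    · simpa [α, β] using hδ t
    · simpa [α, β] using hδ t
  · rintro z ⟨hzU, hzK⟩
    have hz : z = p + ‖z - p‖ * Complex.exp (Complex.arg (z - p) * Complex.I) := by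
      rw [Complex.norm_mul_exp_arg_mul_I]; ring
    obtain ⟨t, ht, hta⟩ := mem_iUnion₂.1
      (hF ⟨(Complex.neg_pi_lt_arg (z - p)).le, Complex.arg_le_pi (z - p)⟩)
    rcases le_total t (Complex.arg (z - p)) with h | h
    · refine mem_iUnion.2 ⟨Sum.inr (⟨t, ht⟩, true), ‖z - p‖, norm_nonneg _, _, ?_, ?_, hz⟩
      · simpa [α] using h
      · simpa [β] using hta.2.le
    · refine mem_iUnion.2 ⟨Sum.inr (⟨t, ht⟩, false), ‖z - p‖, norm_nonneg _, _, ?_, ?_, hz⟩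
      · have := hta.1.le; simpa [α] using this
      · simpa [β] using h
  · rintro (i | ⟨t, _ | _⟩)
    · rintro z ⟨⟨-, hzK⟩, r, hr, t, ht1, ht2, rfl⟩
      simp only [α, β, Sum.elim_inl] at ht1 ht2
      have h := hθ _ hzK
      have hcos : 0 < Real.cos (t - θ) :=
        Real.cos_pos_of_mem_Ioo ⟨by linarith [Real.pi_gt_three], by linarith [Real.pi_gt_three]⟩
      rw [Complex.exp_mul_I, ← Complex.ofReal_cos, ← Complex.ofReal_sin] at h
      simp [Complex.cos_ofReal_re, Complex.sin_ofReal_re] at h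
      rw [Real.cos_sub] at hcos
      have hr0 : r = 0 := by
        by_contra hne
        have : 0 < r := lt_of_le_of_ne hr (Ne.symm hne)
        have := mul_pos this hcos
        linarith
      subst hr0
      simp [f, hg]
    · simpa [f, α, β] using hside (b₂ t) _ _ (hb₂ t)
    · simpa [f, α, β] using hside (b₁ t) _ _ (hb₁ t)
  · have hfi : Function.Injective (f ∘ Sum.inl) := by
      intro i j h
      have := DFunLike.congr_fun h (p + 1)
      simp only [f, Function.comp, Sum.elim_inl, hg] at this
      exact hωi (by simpa using this)
    have hsub : range (f ∘ Sum.inl) ⊆ range f := range_comp_subset_range _ _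
    have h := ncard_le_ncard hsub (finite_range f)
    have e : (range (f ∘ Sum.inl)).ncard = 3 := by
      rw [← image_univ, ncard_image_of_injective _ hfi]; simp [ncard_univ]
    omega

/-- A chord of `K` carried by the line `c`. -/
structure IsChord (K : Set ℂ) (c : FoldLine) (p q : ℂ) : Prop where
  left_mem : p ∈ frontier K
  right_mem : q ∈ frontier K
  ne : p ≠ q
  subset : openSegment ℝ p q ⊆ interior K
  ev_left : c.ev p = 0
  ev_right : c.ev q = 0

theorem sideOf_eq_zero_of_ev {c : FoldLine} {p q z : ℂ} (hp : c.ev p = 0) (hq : c.ev q = 0)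
    (hz : c.ev z = 0) : sideOf p q z = 0 := by
  have hn := c.normSq_pos
  rw [Complex.normSq_apply] at hn
  rw [sideOf_eq]
  simp only [ev] at hp hq hz
  refine (mul_eq_zero.1 ?_).resolve_left hn.ne'
  linear_combination (c.n.im * (q.re - p.re) - c.n.re * (q.im - p.im)) * (hz - hp) -
    (c.n.im * (z.re - p.re) - c.n.re * (z.im - p.im)) * (hq - hp)

theorem IsChord.eq_or_eq {K : Set ℂ} (hK : Convex ℝ K) (hKc : IsClosed K) {c : FoldLine}
    {p q z : ℂ} (h : IsChord K c p q) (hz : z ∈ frontier K) (h0 : c.ev z = 0) :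
    z = p ∨ z = q :=
  eq_or_eq_of_sideOf_eq_zero hK h.ne h.left_mem h.right_mem h.subset (hKc.frontier_subset hz) hz
    (sideOf_eq_zero_of_ev h.ev_left h.ev_right h0)

theorem Nested.isCreaseOf_iff {K : Set ℂ} (hK : Convex ℝ K) (hKc : IsClosed K)
    {l : List FoldLine} (hl : Nested K l) (P Q : FoldLine → ℂ)
    (hch : ∀ c ∈ l, IsChord K c (P c) (Q c)) {u v : ℂ} :
    IsCreaseOf K (foldMap l) u v ↔ ∃ c ∈ l, (u = P c ∧ v = Q c) ∨ (u = Q c ∧ v = P c) := by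
  constructor
  · rintro ⟨hu, hv, hne, hsub, hcr⟩
    have hmem : ∀ t : Ioo (0 : ℝ) 1, (1 - t.1) • u + t.1 • v ∈ openSegment ℝ u v := fun t =>
      ⟨1 - t.1, t.1, by linarith [t.2.2], t.2.1, by ring, rfl⟩
    have hex : ∀ t : Ioo (0 : ℝ) 1, ∃ c : {c // c ∈ l}, c.1.ev ((1 - t.1) • u + t.1 • v) = 0 := by
      intro t
      obtain ⟨c, hc, h⟩ := (creasePtOn_iff hl (hsub (hmem t))).1 (hcr _ (hmem t))
      exact ⟨⟨c, hc⟩, h⟩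
    choose c hc using hex
    have : Finite {c // c ∈ l} := l.finite_toSet
    have : Infinite (Ioo (0 : ℝ) 1) := (Ioo_infinite one_pos).to_subtype
    obtain ⟨s, t, hst, he⟩ := Finite.exists_ne_map_eq_of_infinite c
    have h1 := hc s
    have h2 := hc t
    rw [← he] at h2
    rw [ev_combo _ _ _ (by ring)] at h1 h2
    have hst' : (s : ℝ) - t ≠ 0 := sub_ne_zero.2 (Subtype.coe_ne_coe.2 hst)
    have hu0 : (c s).1.ev u = 0 := by
      refine (mul_eq_zero.1 ?_).resolve_left hst'
      linear_combination (-t.1) * h1 + s.1 * h2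
    have hv0 : (c s).1.ev v = 0 := by
      refine (mul_eq_zero.1 ?_).resolve_left hst'
      linear_combination (1 - t.1) * h1 - (1 - s.1) * h2
    have C := hch _ (c s).2
    refine ⟨(c s).1, (c s).2, ?_⟩
    rcases C.eq_or_eq hK hKc hu hu0 with h | h <;> rcases C.eq_or_eq hK hKc hv hv0 with h' | h'
    · exact absurd (h.trans h'.symm) hne
    · exact Or.inl ⟨h, h'⟩
    · exact Or.inr ⟨h, h'⟩
    · exact absurd (h.trans h'.symm) hne
  · have key : ∀ c ∈ l, IsCreaseOf K (foldMap l) (P c) (Q c) := by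
      intro c hc
      have C := hch c hc
      refine ⟨C.left_mem, C.right_mem, C.ne, C.subset, fun z hz => ?_⟩
      refine hl.creasePtOn (C.subset hz) hc ?_
      obtain ⟨a, b, -, -, hab, rfl⟩ := hz
      rw [ev_combo _ _ _ hab, C.ev_left, C.ev_right]; simp
    rintro ⟨c, hc, ⟨rfl, rfl⟩ | ⟨rfl, rfl⟩⟩
    · exact key c hc
    · obtain ⟨h1, h2, h3, h4, h5⟩ := key c hc
      rw [openSegment_symm] at h4 h5
      exact ⟨h2, h1, h3.symm, h4, h5⟩

theorem Nested.isOuterLocalFlatFolding {K : Set ℂ} (hK : Convex ℝ K) (hKc : IsCompact K)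
    (hKi : (interior K).Nonempty) {l : List FoldLine} (hl : Nested K l)
    (hsupp : ∀ p ∈ frontier K, ∃ θ : ℝ, ∀ z ∈ K,
      (z.re - p.re) * Real.cos θ + (z.im - p.im) * Real.sin θ ≤ 0) :
    IsOuterLocalFlatFolding K (foldMap l) where
  compact := hKc
  convex := hK
  interior_nonempty := hKi
  continuousOn := continuousOn_foldMap hl
  classify p hp := by
    by_cases hpi : p ∈ interior K
    · by_cases hc : ∃ c ∈ l, c.ev p = 0
      · exact Or.inr (Or.inl ((creasePtOn_iff hl hpi).2 hc))
      · push Not at hc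
        exact Or.inl (unfoldedPtOn_foldMap hl hc)
    · obtain ⟨θ, hθ⟩ := hsupp p ⟨subset_closure hp, hpi⟩
      exact Or.inr (Or.inr (hl.vertexPtOn hθ))
  vertex_boundary p hp hv :=
    ⟨subset_closure hp, fun hpi => hl.not_vertexPtOn hpi hv⟩

end FoldLine

/-- `φ` is the vertical projection of an embedding of `K` into space. -/
def HasLift (K : Set ℂ) (φ : ℂ → ℂ) : Prop :=
  ∃ h : ℂ → ℝ, ContinuousOn h K ∧ InjOn (fun z => (φ z, h z)) K

theorem HasLift.exists_embedding {K : Set ℂ} {φ : ℂ → ℂ} (hK : IsCompact K)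
    (hφ : ContinuousOn φ K) (h : HasLift K φ) :
    ∃ ψ : ℂ → Space3, Topology.IsEmbedding (fun p : K => ψ ↑p) ∧ ∀ p ∈ K, proj2 (ψ p) = φ p := by
  obtain ⟨h, hc, hinj⟩ := h
  have : CompactSpace K := isCompact_iff_compactSpace.1 hK
  refine ⟨fun z => !₂[(φ z).re, (φ z).im, h z], ?_, fun p _ => by
    apply Complex.ext <;> simp [proj2]⟩
  refine (Continuous.isClosedEmbedding ?_ ?_).isEmbedding
  · have h1 : Continuous fun p : K => φ p := continuousOn_iff_continuous_domRestrict.1 hφ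
    have h2 : Continuous fun p : K => h p := continuousOn_iff_continuous_domRestrict.1 hc
    refine (PiLp.continuous_toLp 2 _).comp (continuous_pi fun i => ?_)
    fin_cases i
    · exact Complex.continuous_re.comp h1
    · exact Complex.continuous_im.comp h1
    · exact h2
  · intro p q hpq
    have e0 := congrArg (fun v : Space3 => v 0) hpq
    have e1 := congrArg (fun v : Space3 => v 1) hpq
    have e2 := congrArg (fun v : Space3 => v 2) hpq
    simp at e0 e1 e2
    exact Subtype.ext (hinj p.2 q.2 (Prod.ext (Complex.ext e0 e1) e2))

namespace FoldLine

theorem foldMap_append_singleton (l : List FoldLine) (c : FoldLine) (z : ℂ) :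
    foldMap (l ++ [c]) z = act l (fun x => 0 < x.ev z) (if 0 < c.ev z then c.refl z else z) := by
  rw [foldMap, act_append]
  congr 1

/-- The condition under which the new crease `c` can be folded on top of the creases of `l`. -/
def Safe (K : Set ℂ) (l : List FoldLine) (c : FoldLine) : Prop :=
  ∃ P : ℂ → ℝ, Continuous P ∧ (∃ z ∈ K, P z ≤ 0) ∧
    (∀ z ∈ K, 0 < c.ev z → 0 < P z ∧ c.refl z ∈ K ∧ 0 < P (c.refl z)) ∧
    ∀ x ∈ l, ∀ z ∈ K, ∀ w ∈ K, 0 < P z → 0 < P w → (0 < x.ev z ↔ 0 < x.ev w)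

theorem Safe.hasLift {K : Set ℂ} (hK : IsCompact K) {l : List FoldLine} {c : FoldLine}
    (hφ : ContinuousOn (foldMap l) K) (hl : HasLift K (foldMap l)) (hs : Safe K l c) :
    HasLift K (foldMap (l ++ [c])) := by
  obtain ⟨h, hc, hinj⟩ := hl
  obtain ⟨P, hP, ⟨z₀, hz₀, hz₀'⟩, ha, hb⟩ := hs
  set F : ℂ → ℂ := fun z => z - ((2 * max (c.ev z) 0 / Complex.normSq c.n : ℝ) : ℂ) * c.n with hF
  have hFpos : ∀ z, 0 < c.ev z → F z = c.refl z := fun z h => by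
    simp only [F, max_eq_left h.le, refl]
  have hFneg : ∀ z, c.ev z ≤ 0 → F z = z := fun z h => by simp [F, max_eq_right h]
  have hFc : Continuous F := by
    refine continuous_id.sub (Continuous.mul (Complex.continuous_ofReal.comp ?_) continuous_const)
    exact (continuous_const.mul (c.continuous_ev.max continuous_const)).div_const _
  have hFK : MapsTo F K K := by
    intro z hz
    rcases le_or_gt (c.ev z) 0 with h | h
    · rwa [hFneg z h]
    · rw [hFpos z h]; exact (ha z hz h).2.1
  have hcomp : ∀ z ∈ K, foldMap (l ++ [c]) z = foldMap l (F z) := by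
    intro z hz
    rw [foldMap_append_singleton]
    rcases le_or_gt (c.ev z) 0 with h | h
    · rw [if_neg (not_lt.2 h), hFneg z h]; rfl
    · rw [if_pos h, hFpos z h]
      have := ha z hz h
      exact act_congr (fun x hx => hb x hx z hz _ this.2.1 this.1 this.2.2) _
  set G : ℂ → ℂ × ℝ := fun z => (foldMap l z, h z) with hG
  have hGc : ContinuousOn G K := hφ.prodMk hc
  set S : Set ℂ := K ∩ {z | P z ≤ 0} with hS
  have hSc : IsCompact S := hK.inter_right (isClosed_le hP continuous_const)
  have hGS : IsClosed (G '' S) := (hSc.image_of_continuousOn (hGc.mono inter_subset_left)).isClosed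
  have hGSn : (G '' S).Nonempty := ⟨_, z₀, ⟨hz₀, hz₀'⟩, rfl⟩
  set g : ℂ → ℝ := fun z => Metric.infDist (G z) (G '' S) with hg
  have hgc : ContinuousOn g K := (Metric.continuous_infDist_pt _).comp_continuousOn hGc
  have hgpos : ∀ z ∈ K, 0 < P z → 0 < g z := by
    intro z hz hPz
    refine (hGS.notMem_iff_infDist_pos hGSn).1 ?_
    rintro ⟨s, hs, he⟩
    have := hinj hs.1 hz he
    subst this
    exact absurd hs.2 (not_le.2 hPz)
  have hg0 : ∀ z, 0 ≤ g z := fun z => Metric.infDist_nonneg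
  set u : ℂ → ℝ := fun z => min (max (c.ev z) 0) (g (F z) / 2) with hu
  have hu0 : ∀ z, 0 ≤ u z := fun z => le_min (le_max_right _ _) (by linarith [hg0 (F z)])
  have hupos : ∀ z, 0 < u z → 0 < c.ev z := by
    intro z hz
    by_contra! hcon
    have : u z ≤ max (c.ev z) 0 := min_le_left _ _
    rw [max_eq_right hcon] at this
    linarith
  have huz : ∀ z, c.ev z ≤ 0 → u z = 0 := by
    intro z hz
    refine le_antisymm ?_ (hu0 z)
    by_contra! hcon
    exact absurd (hupos z hcon) (not_lt.2 hz)
  have hupos' : ∀ z ∈ K, 0 < c.ev z → 0 < u z := by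
    intro z hz hez
    refine lt_min (lt_max_of_lt_left hez) (half_pos ?_)
    have := ha z hz hez
    rw [hFpos z hez]
    exact hgpos _ this.2.1 this.2.2
  refine ⟨fun z => h (F z) + u z, ?_, ?_⟩
  · refine (hc.comp hFc.continuousOn hFK).add (ContinuousOn.inf ?_ ?_)
    · exact (c.continuous_ev.max continuous_const).continuousOn
    · exact (hgc.comp hFc.continuousOn hFK).div_const 2
  · have hlt : ∀ z ∈ K, ∀ w ∈ K, foldMap l (F z) = foldMap l (F w) →
        h (F z) + u z = h (F w) + u w → ¬ h (F z) < h (F w) := by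
      intro z hz w hw e1 e2 hlt
      have huz : 0 < u z := by linarith [hu0 w]
      have hez := hupos z huz
      have hPz : 0 < P (F z) := by rw [hFpos z hez]; exact (ha z hz hez).2.2
      rcases le_or_gt (P (F w)) 0 with hPw | hPw
      · have h1 : g (F z) ≤ dist (G (F z)) (G (F w)) :=
          Metric.infDist_le_dist_of_mem ⟨F w, ⟨hFK hw, hPw⟩, rfl⟩
        have h2 : dist (G (F z)) (G (F w)) = h (F w) - h (F z) := by
          rw [Prod.dist_eq]
          simp only [hG, e1, dist_self]
          rw [Real.dist_eq, abs_of_neg (by linarith), max_eq_right (by linarith)]; ring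
        have h3 : u z ≤ g (F z) / 2 := min_le_right _ _
        linarith [hu0 w]
      · have e3 : foldMap l (F z) = act l (fun x => 0 < x.ev (F w)) (F z) :=
          act_congr (fun x hx => hb x hx _ (hFK hz) _ (hFK hw) hPz hPw) _
        rw [e3, foldMap, ← actEquiv_apply, ← actEquiv_apply] at e1
        rw [(actEquiv l _).injective e1] at hlt
        exact lt_irrefl _ hlt
    intro z hz w hw hzw
    have e1 := congrArg Prod.fst hzw
    have e2 := congrArg Prod.snd hzw
    simp only [hcomp z hz, hcomp w hw] at e1 e2
    have e3 : h (F z) = h (F w) :=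
      le_antisymm (not_lt.1 (hlt w hw z hz e1.symm e2.symm)) (not_lt.1 (hlt z hz w hw e1 e2))
    have e4 : F z = F w := hinj (hFK hz) (hFK hw) (Prod.ext e1 e3)
    rcases le_or_gt (c.ev z) 0 with h1 | h1 <;> rcases le_or_gt (c.ev w) 0 with h2 | h2
    · rwa [hFneg z h1, hFneg w h2] at e4
    · have := hupos' w hw h2
      rw [e3, huz z h1] at e2
      linarith
    · have := hupos' z hz h1
      rw [e3, huz w h2] at e2
      linarith
    · rw [hFpos z h1, hFpos w h2] at e4
      rw [← c.refl_refl z, e4, c.refl_refl]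

theorem hasLift_append {K : Set ℂ} (hK : IsCompact K) {l l' : List FoldLine}
    (hn : Nested K (l ++ l')) (hl : HasLift K (foldMap l))
    (hs : ∀ l₁ c l₂, l' = l₁ ++ c :: l₂ → Safe K (l ++ l₁) c) :
    HasLift K (foldMap (l ++ l')) := by
  induction l' generalizing l with
  | nil => simpa using hl
  | cons c l' ih =>
    have e : l ++ c :: l' = (l ++ [c]) ++ l' := by simp
    rw [e] at hn ⊢
    refine ih hn ?_ fun l₁ d l₂ h => ?_
    · have hn' := (List.pairwise_append.1 (List.pairwise_append.1 hn).1).1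
      have := hs [] c l' rfl
      rw [List.append_nil] at this
      exact this.hasLift hK (continuousOn_foldMap hn') hl
    · have := hs (c :: l₁) d l₂ (by rw [h]; rfl)
      rwa [show l ++ c :: l₁ = l ++ [c] ++ l₁ by simp] at this

theorem norm_refl_sub_refl_sub_le (c : FoldLine) (hre : c.n.re = 1) (x y w : ℂ) (t : ℝ)
    (ht : ‖x - y‖ = t) (hw : ‖x - y - t * Complex.I‖ ≤ w.re) :
    ‖c.refl x - c.refl y - t * Complex.I‖ ≤ w.re + 2 * |c.n.im| * t := by
  have hcn : starRingEnd ℂ c.n ≠ 0 := (map_ne_zero _).2 c.n_ne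
  have e : c.refl x - c.refl y = -(c.n / starRingEnd ℂ c.n) * starRingEnd ℂ (x - y) := by
    have h1 : c.refl x - c.refl y =
        x - y - ((2 * (c.ev x - c.ev y) / Complex.normSq c.n : ℝ) : ℂ) * c.n := by
      rw [refl, refl]; push_cast; ring
    have h2 : ((2 * (c.ev x - c.ev y) : ℝ) : ℂ) =
        (x - y) * starRingEnd ℂ c.n + starRingEnd ℂ (x - y) * c.n := by
      apply Complex.ext
      · simp [ev]; ring
      · simp; ring
    rw [h1, Complex.ofReal_div, h2, ← Complex.mul_conj]
    have := c.n_ne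
    field_simp
    ring
  have h1 : c.refl x - c.refl y - t * Complex.I =
      -starRingEnd ℂ (x - y - t * Complex.I) +
        (1 - c.n / starRingEnd ℂ c.n) * starRingEnd ℂ (x - y) := by
    rw [e]; simp; ring
  have h2 : ‖1 - c.n / starRingEnd ℂ c.n‖ ≤ 2 * |c.n.im| := by
    have h3 : 1 - c.n / starRingEnd ℂ c.n = -(2 * c.n.im * Complex.I) / starRingEnd ℂ c.n := by
      rw [eq_div_iff hcn, sub_mul, div_mul_cancel₀ _ hcn, one_mul]
      apply Complex.ext <;> simp; ring
    rw [h3, norm_div, norm_neg, norm_mul, norm_mul, Complex.norm_I, mul_one, Complex.norm_real,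
      Complex.norm_ofNat, Real.norm_eq_abs, Complex.norm_conj]
    refine div_le_self (by positivity) ?_
    calc (1 : ℝ) = |c.n.re| := by rw [hre, abs_one]
      _ ≤ ‖c.n‖ := Complex.abs_re_le_norm _
  rw [h1]
  refine (norm_add_le _ _).trans (add_le_add ?_ ?_)
  · rwa [norm_neg, Complex.norm_conj]
  · rw [norm_mul, Complex.norm_conj, ht]
    exact mul_le_mul_of_nonneg_right h2 (ht ▸ norm_nonneg _)

theorem norm_act_sub_act_sub_le {κ : ℝ} {l : List FoldLine}
    (hl : ∀ c ∈ l, c.n.re = 1 ∧ |c.n.im| ≤ κ) (x y : ℂ) {t : ℝ} (ht : 0 ≤ t)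
    (hxy : x - y = t * Complex.I) :
    ‖act l (fun _ => True) x - act l (fun _ => True) y - t * Complex.I‖ ≤
      2 * κ * l.length * t := by
  induction l with
  | nil => simp [hxy]
  | cons c l ih =>
    have ih := ih fun x hx => hl x (List.mem_cons_of_mem _ hx)
    have hc := hl c List.mem_cons_self
    rw [act_cons_pos trivial, act_cons_pos trivial]
    have hn : ‖act l (fun _ => True) x - act l (fun _ => True) y‖ = t := by
      rw [← dist_eq_norm, ← actEquiv_apply, ← actEquiv_apply, (actEquiv l _).dist_eq,
        dist_eq_norm, hxy, norm_mul, Complex.norm_I, Complex.norm_real, Real.norm_eq_abs,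
        abs_of_nonneg ht, mul_one]
    refine (c.norm_refl_sub_refl_sub_le hc.1 _ _ ((2 * κ * l.length * t : ℝ) : ℂ) t hn
      (by simpa using ih)).trans ?_
    rw [Complex.ofReal_re, List.length_cons]
    push_cast
    nlinarith [mul_le_mul_of_nonneg_right hc.2 ht]

theorem foldMap_vertical_mono {K : Set ℂ} (hK : Convex ℝ K) {l : List FoldLine}
    (hl : Nested K l)
    (hcap : l.Pairwise fun i j => ∀ z ∈ K, 0 ≤ j.ev z → 0 ≤ i.ev z) {κ : ℝ}
    (hκ : ∀ c ∈ l, c.n.re = 1 ∧ |c.n.im| ≤ κ) (hκ0 : 0 ≤ κ) (hlen : 2 * κ * l.length < 1)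
    {z w : ℂ} (hz : z ∈ K) (hw : w ∈ K) (hre : z.re = w.re) (him : z.im < w.im) :
    (foldMap l z).im < (foldMap l w).im := by
  induction l using List.reverseRecOn generalizing z w with
  | nil => exact him
  | append_singleton l c ih =>
    have hl' := List.pairwise_append.1 hl
    have hcap' := List.pairwise_append.1 hcap
    have ih := fun {z w : ℂ} => @ih hl'.1 hcap'.1 (fun x hx => hκ x (List.mem_append_left _ hx)) (by
      rw [List.length_append] at hlen
      push_cast at hlen
      have : (0 : ℝ) ≤ κ * ([c].length : ℝ) := by positivity
      linarith) z w
    have hneg : ∀ z, c.ev z ≤ 0 → foldMap (l ++ [c]) z = foldMap l z := by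
      intro z h
      rw [foldMap_append_singleton, if_neg (not_lt.2 h)]; rfl
    have h1 : ∀ {z w : ℂ}, z ∈ K → w ∈ K → z.re = w.re → z.im < w.im → c.ev z ≤ 0 → c.ev w ≤ 0 →
        (foldMap (l ++ [c]) z).im < (foldMap (l ++ [c]) w).im := by
      intro z w hz hw hre him h1 h2
      rw [hneg z h1, hneg w h2]
      exact ih hz hw hre him
    have hpos : ∀ z ∈ K, 0 ≤ c.ev z → foldMap (l ++ [c]) z = act (l ++ [c]) (fun _ => True) z := by
      intro z hz h
      refine Compat.foldMap_eq hl hz fun x hx => ⟨fun _ => ?_, fun h => absurd trivial h⟩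
      rcases List.mem_append.1 hx with h' | h'
      · exact hcap'.2.2 x h' c (by simp) z hz h
      · rw [List.mem_singleton.1 h']; exact h
    have h2 : ∀ {z w : ℂ}, z ∈ K → w ∈ K → z.re = w.re → z.im < w.im → 0 ≤ c.ev z → 0 ≤ c.ev w →
        (foldMap (l ++ [c]) z).im < (foldMap (l ++ [c]) w).im := by
      intro z w hz hw hre him h1 h2
      rw [hpos z hz h1, hpos w hw h2]
      have e := norm_act_sub_act_sub_le hκ w z (t := w.im - z.im) (by linarith)
        (by apply Complex.ext <;> simp [hre])
      have e2 := (abs_le.1 ((Complex.abs_im_le_norm _).trans e)).1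
      simp at e2
      have : 2 * κ * ((l ++ [c]).length : ℝ) * (w.im - z.im) < 1 * (w.im - z.im) :=
        mul_lt_mul_of_pos_right hlen (by linarith)
      simp at this
      linarith
    have hmid : c.ev z * c.ev w < 0 → ∃ x ∈ K, x.re = z.re ∧ z.im < x.im ∧ x.im < w.im ∧
        c.ev x = 0 := by
      intro h
      have hne : c.ev z - c.ev w ≠ 0 := by
        intro h0
        rw [sub_eq_zero.1 h0] at h
        exact absurd h (not_lt.2 (mul_self_nonneg _))
      set s := c.ev z / (c.ev z - c.ev w) with hs
      have hs0 : 0 < s ∧ s < 1 := by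
        rcases lt_or_gt_of_ne hne with h' | h'
        · have : c.ev z < 0 := by by_contra! hcon; nlinarith
          have : 0 < c.ev w := by by_contra! hcon; nlinarith
          exact ⟨div_pos_of_neg_of_neg (by linarith) h', by rw [hs, div_lt_one_of_neg h']; linarith⟩
        · have : 0 < c.ev z := by by_contra! hcon; nlinarith
          have : c.ev w < 0 := by by_contra! hcon; nlinarith
          exact ⟨div_pos (by linarith) h', by rw [hs, div_lt_one h']; linarith⟩
      refine ⟨(1 - s) • z + s • w, hK hz hw (by linarith) hs0.1.le (by ring), ?_, ?_, ?_, ?_⟩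
      · simp [hre]; ring
      · simp; nlinarith
      · simp; nlinarith
      · rw [ev_combo _ _ _ (by ring), hs]; field_simp; ring
    rcases le_total (c.ev z) 0 with a | a <;> rcases le_total (c.ev w) 0 with b | b
    · exact h1 hz hw hre him a b
    · rcases eq_or_lt_of_le a with a' | a'
      · exact h2 hz hw hre him a'.ge b
      rcases eq_or_lt_of_le b with b' | b'
      · exact h1 hz hw hre him a b'.ge
      obtain ⟨x, hx, hxr, hx1, hx2, hx0⟩ := hmid (mul_neg_of_neg_of_pos a' b')
      exact (h1 hz hx hxr.symm hx1 a hx0.le).trans (h2 hx hw (hxr.trans hre) hx2 hx0.ge b)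
    · rcases eq_or_lt_of_le a with a' | a'
      · exact h1 hz hw hre him a'.ge b
      rcases eq_or_lt_of_le b with b' | b'
      · exact h2 hz hw hre him a b'.ge
      obtain ⟨x, hx, hxr, hx1, hx2, hx0⟩ := hmid (mul_neg_of_pos_of_neg a' b')
      exact (h2 hz hx hxr.symm hx1 a hx0.ge).trans (h1 hx hw (hxr.trans hre) hx2 hx0.le b)
    · exact h2 hz hw hre him a b

theorem hasLift_strip {K : Set ℂ} (hK : Convex ℝ K) {l : List FoldLine} (hl : Nested K l)
    (hcap : l.Pairwise fun i j => ∀ z ∈ K, 0 ≤ j.ev z → 0 ≤ i.ev z) {κ : ℝ}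
    (hκ : ∀ c ∈ l, c.n.re = 1 ∧ |c.n.im| ≤ κ) (hκ0 : 0 ≤ κ) (hlen : 2 * κ * l.length < 1) :
    HasLift K (foldMap l) := by
  refine ⟨Complex.re, Complex.continuous_re.continuousOn, fun z hz w hw h => ?_⟩
  have h1 := congrArg Prod.fst h
  have h2 : z.re = w.re := congrArg Prod.snd h
  have h1 : foldMap l z = foldMap l w := h1
  rcases lt_trichotomy z.im w.im with h' | h' | h'
  · have := foldMap_vertical_mono hK hl hcap hκ hκ0 hlen hz hw h2 h'
    rw [h1] at this
    exact absurd this (lt_irrefl _)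
  · exact Complex.ext h2 h'
  · have := foldMap_vertical_mono hK hl hcap hκ hκ0 hlen hw hz h2.symm h'
    rw [h1] at this
    exact absurd this (lt_irrefl _)

end FoldLine

/-- The unit square. -/
def unitSq : Set ℂ := {z : ℂ | z.re ∈ Icc 0 1 ∧ z.im ∈ Icc 0 1}

theorem unitSq_eq : unitSq = Icc 0 1 ×ℂ Icc 0 1 := rfl

theorem isSquareRegion_unitSq : IsSquareRegion unitSq :=
  ⟨0, 1, one_ne_zero, by simp [unitSq]⟩

theorem convex_unitSq : Convex ℝ unitSq := by
  have : unitSq = Complex.reCLM ⁻¹' Icc 0 1 ∩ Complex.imCLM ⁻¹' Icc 0 1 := rfl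
  rw [this]
  exact ((convex_Icc 0 1).linear_preimage Complex.reLm).inter
    ((convex_Icc 0 1).linear_preimage Complex.imLm)

theorem isCompact_unitSq : IsCompact unitSq := isCompact_Icc.reProdIm isCompact_Icc

theorem interior_unitSq : interior unitSq = Ioo 0 1 ×ℂ Ioo 0 1 := by
  rw [unitSq_eq, Complex.interior_reProdIm, interior_Icc]

theorem mem_frontier_unitSq {z : ℂ} : z ∈ frontier unitSq ↔
    z ∈ unitSq ∧ (z.re = 0 ∨ z.re = 1 ∨ z.im = 0 ∨ z.im = 1) := by
  rw [isCompact_unitSq.isClosed.frontier_eq, interior_unitSq]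
  simp only [unitSq, mem_sdiff, mem_ofPred_eq, Complex.mem_reProdIm, mem_Icc, mem_Ioo]
  constructor
  · rintro ⟨⟨⟨a, b⟩, c, d⟩, h⟩
    refine ⟨⟨⟨a, b⟩, c, d⟩, ?_⟩
    by_contra! hcon
    exact h ⟨⟨a.lt_of_ne hcon.1.symm, b.lt_of_ne hcon.2.1⟩, c.lt_of_ne hcon.2.2.1.symm,
      d.lt_of_ne hcon.2.2.2⟩
  · rintro ⟨h, h'⟩
    refine ⟨h, fun h'' => ?_⟩
    rcases h' with h' | h' | h' | h' <;> rw [h'] at h'' <;>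
      simp at h''

theorem supporting_unitSq {p : ℂ} (hp : p ∈ frontier unitSq) : ∃ θ : ℝ, ∀ z ∈ unitSq,
    (z.re - p.re) * Real.cos θ + (z.im - p.im) * Real.sin θ ≤ 0 := by
  obtain ⟨-, h | h | h | h⟩ := mem_frontier_unitSq.1 hp
  · exact ⟨Real.pi, fun z hz => by simpa [h] using hz.1.1⟩
  · exact ⟨0, fun z hz => by simpa [h] using hz.1.2⟩
  · exact ⟨-(Real.pi / 2), fun z hz => by simpa [h] using hz.2.1⟩
  · exact ⟨Real.pi / 2, fun z hz => by simpa [h] using hz.2.2⟩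

/-- The distance to `0` or to `1` in the unit interval. -/
def loc (r : Bool) (x : ℝ) : ℝ := if r then 1 - x else x

@[simp] theorem loc_loc (r : Bool) (x : ℝ) : loc r (loc r x) = x := by cases r <;> simp [loc]

theorem loc_inj {r : Bool} {x y : ℝ} (h : loc r x = loc r y) : x = y := by
  rw [← loc_loc r x, h, loc_loc]

theorem loc_add_loc_not (r : Bool) (x : ℝ) : loc r x + loc (!r) x = 1 := by
  cases r <;> simp [loc]

theorem loc_combo (r : Bool) (a b x y : ℝ) (h : a + b = 1) :
    loc r (a * x + b * y) = a * loc r x + b * loc r y := by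
  obtain rfl : a = 1 - b := by linarith
  cases r <;> simp [loc]; ring

theorem loc_mem_Icc {r : Bool} {x : ℝ} : loc r x ∈ Icc (0 : ℝ) 1 ↔ x ∈ Icc (0 : ℝ) 1 := by
  cases r <;> simp [loc, and_comm]

theorem loc_mem_Ioo {r : Bool} {x : ℝ} : loc r x ∈ Ioo (0 : ℝ) 1 ↔ x ∈ Ioo (0 : ℝ) 1 := by
  cases r <;> simp [loc, and_comm]

/-- The point at horizontal distance `p` and vertical distance `q` from the corner `c`. -/
def cornerPt (c : Bool × Bool) (p q : ℝ) : ℂ := ⟨loc c.1 p, loc c.2 q⟩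

namespace FoldLine

/-- The line joining the points `(t, 1)` and `(b, 0)`, oriented to the right. -/
def rail (t b : ℝ) : FoldLine :=
  ⟨⟨1, -(t - b)⟩, b, fun h => by simpa using congrArg Complex.re h⟩

theorem ev_rail (t b : ℝ) (z : ℂ) : (rail t b).ev z = z.re - (b * (1 - z.im) + t * z.im) := by
  simp [ev, rail]; ring

/-- The line cutting off a triangle with legs `X` and `Y` at the corner `c`, oriented towards the
corner. -/
def corner (c : Bool × Bool) (X Y : ℝ) (hX : 0 < X) : FoldLine :=
  ⟨⟨if c.1 then Y else -Y, if c.2 then X else -X⟩,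
    -(X * Y - (if c.1 then Y else 0) - (if c.2 then X else 0)), fun h => by
      have := congrArg Complex.im h
      obtain ⟨c₁, c₂⟩ := c
      cases c₂ <;> simp [hX.ne'] at this⟩

theorem ev_corner (c : Bool × Bool) (X Y : ℝ) (hX : 0 < X) (z : ℂ) :
    (corner c X Y hX).ev z = X * Y - loc c.1 z.re * Y - loc c.2 z.im * X := by
  obtain ⟨c₁, c₂⟩ := c
  cases c₁ <;> cases c₂ <;> simp [ev, corner, loc] <;> ring

theorem normSq_corner (c : Bool × Bool) (X Y : ℝ) (hX : 0 < X) :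
    Complex.normSq (corner c X Y hX).n = X ^ 2 + Y ^ 2 := by
  obtain ⟨c₁, c₂⟩ := c
  cases c₁ <;> cases c₂ <;> simp [corner, Complex.normSq_apply] <;> ring

theorem loc_re_refl_corner (c : Bool × Bool) (X Y : ℝ) (hX : 0 < X) (z : ℂ) :
    loc c.1 ((corner c X Y hX).refl z).re =
      loc c.1 z.re + 2 * (corner c X Y hX).ev z / (X ^ 2 + Y ^ 2) * Y := by
  rw [refl, normSq_corner]
  obtain ⟨c₁, c₂⟩ := c
  cases c₁ <;> simp [corner, loc, -Complex.ofReal_div, -Complex.ofReal_add]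
  all_goals ring

theorem loc_im_refl_corner (c : Bool × Bool) (X Y : ℝ) (hX : 0 < X) (z : ℂ) :
    loc c.2 ((corner c X Y hX).refl z).im =
      loc c.2 z.im + 2 * (corner c X Y hX).ev z / (X ^ 2 + Y ^ 2) * X := by
  rw [refl, normSq_corner]
  obtain ⟨c₁, c₂⟩ := c
  cases c₂ <;> simp [corner, loc, -Complex.ofReal_div, -Complex.ofReal_add]
  all_goals ring

end FoldLine

theorem reflect_triangle {X Y ξ υ l : ℝ} (hX1 : X ≤ 1) (hY : 0 < Y) (hYX : 4 * Y ≤ X)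
    (hξ : 0 ≤ ξ) (hυ : 0 ≤ υ) (hl : l = X * Y - ξ * Y - υ * X) (hl0 : 0 < l) :
    ξ + 2 * l / (X ^ 2 + Y ^ 2) * Y ∈ Icc (0 : ℝ) 1 ∧
    υ + 2 * l / (X ^ 2 + Y ^ 2) * X ∈ Icc (0 : ℝ) 1 ∧
    0 < X * (4 * Y) - (ξ + 2 * l / (X ^ 2 + Y ^ 2) * Y) * (4 * Y) -
      (υ + 2 * l / (X ^ 2 + Y ^ 2) * X) * X := by
  have hX : 0 < X := by linarith
  have hN : 0 < X ^ 2 + Y ^ 2 := by positivity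
  set q := 2 * l / (X ^ 2 + Y ^ 2) with hq
  have hq0 : 0 < q := by positivity
  have hqN : q * (X ^ 2 + Y ^ 2) = 2 * l := by rw [hq]; field_simp
  have h1 : 0 < X * (4 * Y) - (ξ + q * Y) * (4 * Y) - (υ + q * X) * X := by
    have h2 : q * (X ^ 2 + 4 * Y ^ 2) < 4 * l := by
      have : 0 < q * (X ^ 2 - 2 * Y ^ 2) := by
        apply mul_pos hq0; nlinarith
      nlinarith
    nlinarith [mul_nonneg hυ hX.le]
  have h3 : 0 ≤ ξ + q * Y := by positivity
  have h4 : 0 ≤ υ + q * X := by positivity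
  refine ⟨⟨h3, ?_⟩, ⟨h4, ?_⟩, h1⟩
  · by_contra! hcon
    nlinarith [mul_nonneg h4 hX.le]
  · by_contra! hcon
    nlinarith [mul_nonneg h3 hY.le]

namespace FoldLine

/-- The comparison triangle of a corner crease. -/
structure Comparison (X Y A B : ℝ) : Prop where
  X_pos : 0 < X
  Y_pos : 0 < Y
  X_le : X ≤ 1
  Y_le : Y ≤ 1
  cases : (A = X ∧ B = 4 * Y ∧ 4 * Y ≤ X ∧ 4 * Y ≤ 1 / 4) ∨
    (A = 4 * X ∧ B = Y ∧ 4 * X ≤ Y ∧ 4 * X ≤ 1 / 4)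

variable {X Y A B : ℝ} {c : Bool × Bool}

theorem Comparison.A_pos (h : Comparison X Y A B) : 0 < A := by
  rcases h with ⟨h1, h2, _, _, ⟨rfl, rfl, _⟩ | ⟨rfl, rfl, _⟩⟩ <;> linarith

theorem Comparison.B_pos (h : Comparison X Y A B) : 0 < B := by
  rcases h with ⟨h1, h2, _, _, ⟨rfl, rfl, _⟩ | ⟨rfl, rfl, _⟩⟩ <;> linarith

theorem Comparison.exists_nonpos (h : Comparison X Y A B) :
    ∃ z ∈ unitSq, (corner c A B h.A_pos).ev z ≤ 0 := by
  refine ⟨⟨1 / 2, 1 / 2⟩, by norm_num [unitSq], ?_⟩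
  have e : ∀ r, loc r (1 / 2) = 1 / 2 := fun r => by cases r <;> norm_num [loc]
  simp only [ev_corner, e]
  rcases h with ⟨h1, h2, h3, h4, ⟨rfl, rfl, h5, h6⟩ | ⟨rfl, rfl, h5, h6⟩⟩ <;> nlinarith

theorem Comparison.refl_mem (h : Comparison X Y A B) {z : ℂ} (hz : z ∈ unitSq)
    (hc : 0 < (corner c X Y h.X_pos).ev z) :
    (corner c X Y h.X_pos).refl z ∈ unitSq ∧
      0 < (corner c A B h.A_pos).ev ((corner c X Y h.X_pos).refl z) := by
  have hx := loc_mem_Icc (r := c.1).2 hz.1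
  have hy := loc_mem_Icc (r := c.2).2 hz.2
  set R := (corner c X Y h.X_pos).refl z with hR
  have e1 := loc_re_refl_corner c X Y h.X_pos z
  have e2 := loc_im_refl_corner c X Y h.X_pos z
  have e3 := ev_corner c X Y h.X_pos z
  have key : loc c.1 R.re ∈ Icc (0 : ℝ) 1 ∧ loc c.2 R.im ∈ Icc (0 : ℝ) 1 ∧
      0 < A * B - loc c.1 R.re * B - loc c.2 R.im * A := by
    rw [e1, e2]
    rcases h.cases with ⟨rfl, rfl, h5, h6⟩ | ⟨rfl, rfl, h5, h6⟩
    · exact reflect_triangle h.X_le h.Y_pos h5 hx.1 hy.1 e3 hc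
    · have := reflect_triangle h.Y_le h.X_pos h5 hy.1 hx.1 (by rw [e3]; ring) hc
      rw [add_comm (B ^ 2)] at this
      exact ⟨this.2.1, this.1, by linarith [this.2.2]⟩
  exact ⟨⟨loc_mem_Icc.1 key.1, loc_mem_Icc.1 key.2.1⟩, by rw [ev_corner]; exact key.2.2⟩

theorem Comparison.pos_of_pos (h : Comparison X Y A B) {z : ℂ} (hz : z ∈ unitSq)
    (hc : 0 < (corner c X Y h.X_pos).ev z) : 0 < (corner c A B h.A_pos).ev z := by
  have hx := loc_mem_Icc (r := c.1).2 hz.1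
  have hy := loc_mem_Icc (r := c.2).2 hz.2
  have h1 := h.X_pos
  have h2 := h.Y_pos
  rw [ev_corner] at hc ⊢
  rcases h.cases with ⟨rfl, rfl, h5, h6⟩ | ⟨rfl, rfl, h5, h6⟩
  · nlinarith [mul_nonneg hy.1 h1.le]
  · nlinarith [mul_nonneg hx.1 h2.le]

theorem Comparison.nonpos_of_nonpos (h : Comparison X Y A B) {z : ℂ} (hz : z ∈ unitSq)
    (hc : (corner c A B h.A_pos).ev z ≤ 0) : (corner c X Y h.X_pos).ev z ≤ 0 := by
  by_contra! hcon
  exact absurd (h.pos_of_pos hz hcon) (not_lt.2 hc)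

theorem Comparison.neg_of_nonpos (h : Comparison X Y A B) {z : ℂ} (hz : z ∈ interior unitSq)
    (hc : (corner c A B h.A_pos).ev z ≤ 0) : (corner c X Y h.X_pos).ev z < 0 := by
  rw [interior_unitSq] at hz
  have hx := loc_mem_Ioo (r := c.1).2 hz.1
  have hy := loc_mem_Ioo (r := c.2).2 hz.2
  have h1 := h.X_pos
  have h2 := h.Y_pos
  rw [ev_corner] at hc ⊢
  rcases h.cases with ⟨rfl, rfl, h5, h6⟩ | ⟨rfl, rfl, h5, h6⟩
  · nlinarith [mul_pos hy.1 h1]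
  · nlinarith [mul_pos hx.1 h2]

/-- `i` has constant nonzero sign on the positive side of `P` in the unit square. -/
def ConstSign (i P : FoldLine) : Prop :=
  (∀ z ∈ unitSq, 0 < P.ev z → 0 < i.ev z) ∨ (∀ z ∈ unitSq, 0 < P.ev z → i.ev z < 0)

theorem Comparison.safeCrossing (h : Comparison X Y A B) {l : List FoldLine}
    (hl : ∀ i ∈ l, ConstSign i (corner c A B h.A_pos)) :
    Safe unitSq l (corner c X Y h.X_pos) := by
  refine ⟨(corner c A B h.A_pos).ev, continuous_ev _, h.exists_nonpos, fun z hz hc =>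
    ⟨h.pos_of_pos hz hc, h.refl_mem hz hc⟩, fun i hi z hz w hw h1 h2 => ?_⟩
  rcases hl i hi with h' | h'
  · exact ⟨fun _ => h' w hw h2, fun _ => h' z hz h1⟩
  · exact ⟨fun h3 => absurd h3 (h' z hz h1).not_gt, fun h3 => absurd h3 (h' w hw h2).not_gt⟩

theorem Comparison.nested (h : Comparison X Y A B) {i : FoldLine}
    (hi : ConstSign i (corner c A B h.A_pos)) :
    (∀ z ∈ unitSq, i.ev z = 0 → (corner c X Y h.X_pos).ev z ≤ 0) ∧
      ∀ z ∈ interior unitSq, i.ev z = 0 → (corner c X Y h.X_pos).ev z < 0 := by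
  have key : ∀ z ∈ unitSq, i.ev z = 0 → (corner c A B h.A_pos).ev z ≤ 0 := by
    intro z hz h0
    by_contra! hcon
    rcases hi with h' | h'
    · exact (h' z hz hcon).ne' h0
    · exact (h' z hz hcon).ne h0
  exact ⟨fun z hz h0 => h.nonpos_of_nonpos hz (key z hz h0),
    fun z hz h0 => h.neg_of_nonpos hz (key z (interior_subset hz) h0)⟩

theorem ev_corner_pos {c : Bool × Bool} {A B : ℝ} (hA : 0 < A) (hB : 0 < B) {z : ℂ}
    (hz : z ∈ unitSq) (h : 0 < (corner c A B hA).ev z) :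
    0 ≤ loc c.1 z.re ∧ loc c.1 z.re < A ∧ 0 ≤ loc c.2 z.im ∧ loc c.2 z.im < B := by
  have hx := (loc_mem_Icc (r := c.1).2 hz.1).1
  have hy := (loc_mem_Icc (r := c.2).2 hz.2).1
  rw [ev_corner] at h
  refine ⟨hx, ?_, hy, ?_⟩
  · by_contra! hcon
    nlinarith [mul_nonneg hy hA.le]
  · by_contra! hcon
    nlinarith [mul_nonneg hx hB.le]

theorem constSign_corner_self {c : Bool × Bool} {X Y A B : ℝ} (hX : 0 < X) (hA : 0 < A)
    (hB : 0 < B) (hAX : A ≤ X) (hBY : B ≤ Y) : ConstSign (corner c X Y hX) (corner c A B hA) := by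
  refine Or.inl fun z hz h => ?_
  obtain ⟨h1, h2, h3, h4⟩ := ev_corner_pos hA hB hz h
  rw [ev_corner] at h ⊢
  set ξ := loc c.1 z.re
  set υ := loc c.2 z.im
  have e1 : 0 < X * B - ξ * B - υ * X := by
    have : 0 < A * (X * B - ξ * B - υ * X) := by
      nlinarith [mul_nonneg (mul_nonneg h1 hB.le) (sub_nonneg.2 hAX)]
    exact (mul_pos_iff_of_pos_left hA).1 this
  have : 0 < B * (X * Y - ξ * Y - υ * X) := by
    nlinarith [mul_nonneg (mul_nonneg h3 hX.le) (sub_nonneg.2 hBY)]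
  exact (mul_pos_iff_of_pos_left hB).1 this

theorem constSign_corner_re {c d : Bool × Bool} {X Y A B : ℝ} (hX : 0 < X) (hY : 0 < Y)
    (hA : 0 < A) (hB : 0 < B) (hd : d.1 = !c.1) (h : X + A ≤ 1) :
    ConstSign (corner d X Y hX) (corner c A B hA) := by
  refine Or.inr fun z hz h' => ?_
  obtain ⟨h1, h2, h3, h4⟩ := ev_corner_pos hA hB hz h'
  have e := loc_add_loc_not c.1 z.re
  have hy := (loc_mem_Icc (r := d.2).2 hz.2).1
  rw [ev_corner, hd]
  nlinarith [mul_nonneg hy hX.le]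

theorem constSign_corner_im {c d : Bool × Bool} {X Y A B : ℝ} (hX : 0 < X)
    (hA : 0 < A) (hB : 0 < B) (hd : d.2 = !c.2) (h : Y + B ≤ 1) (hY : 0 < Y) :
    ConstSign (corner d X Y hX) (corner c A B hA) := by
  refine Or.inr fun z hz h' => ?_
  obtain ⟨h1, h2, h3, h4⟩ := ev_corner_pos hA hB hz h'
  have e := loc_add_loc_not c.2 z.im
  have hx := (loc_mem_Icc (r := d.1).2 hz.1).1
  rw [ev_corner, hd]
  nlinarith [mul_nonneg hx hY.le]

/-- The end of the rail line on the horizontal side `τ`. -/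
theorem constSign_rail {c : Bool × Bool} {t b A B : ℝ} (hA : 0 < A) (hB : 0 < B) (hB1 : B ≤ 1)
    (h : A ≤ loc c.1 (if c.2 then t else b))
    (h' : 0 ≤ loc c.1 (if c.2 then b else t)) :
    ConstSign (rail t b) (corner c A B hA) := by
  have key : ∀ z ∈ unitSq, 0 < (corner c A B hA).ev z →
      loc c.1 z.re < loc c.1 (b * (1 - z.im) + t * z.im) := by
    intro z hz h0
    obtain ⟨h1, h2, h3, h4⟩ := ev_corner_pos hA hB hz h0
    rw [add_comm, mul_comm, mul_comm b, loc_combo _ _ _ _ _ (by ring)]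
    rw [ev_corner] at h0
    set ξ := loc c.1 z.re
    have h5 : ξ < A * (1 - loc c.2 z.im) := by
      have : 0 < B * (A * (1 - loc c.2 z.im) - ξ) := by
        nlinarith [mul_nonneg (mul_nonneg h3 hA.le) (sub_nonneg.2 hB1)]
      linarith [(mul_pos_iff_of_pos_left hB).1 this]
    have hz0 := hz.2.1
    have hz1 := hz.2.2
    obtain ⟨c₁, c₂⟩ := c
    cases c₂ <;> simp only [loc, Bool.false_eq_true, if_false, if_true] at h h' h5 ⊢ <;>
      nlinarith
  obtain ⟨c₁, c₂⟩ := c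
  cases c₁
  · exact Or.inr fun z hz h0 => by
      have := key z hz h0
      simp only [loc, Bool.false_eq_true, if_false] at this
      rw [ev_rail]; linarith
  · exact Or.inl fun z hz h0 => by
      have := key z hz h0
      simp only [loc, if_true] at this
      rw [ev_rail]; linarith

theorem isChord_corner {c : Bool × Bool} {X Y : ℝ} (hX : 0 < X) (hX1 : X < 1) (hY : 0 < Y)
    (hY1 : Y < 1) : IsChord unitSq (corner c X Y hX) (cornerPt c X 0) (cornerPt c 0 Y) where
  left_mem := by
    refine mem_frontier_unitSq.2 ⟨⟨loc_mem_Icc.2 ⟨hX.le, hX1.le⟩, loc_mem_Icc.2 (by simp)⟩, ?_⟩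
    cases h : c.2 <;> simp [cornerPt, loc, h]
  right_mem := by
    refine mem_frontier_unitSq.2 ⟨⟨loc_mem_Icc.2 (by simp), loc_mem_Icc.2 ⟨hY.le, hY1.le⟩⟩, ?_⟩
    cases h : c.1 <;> simp [cornerPt, loc, h]
  ne h := hX.ne' (loc_inj (congrArg Complex.re h))
  subset := by
    rintro _ ⟨a, b, ha, hb, hab, rfl⟩
    rw [interior_unitSq]
    constructor
    · simp only [cornerPt, mem_preimage, Complex.add_re, Complex.real_smul, Complex.re_ofReal_mul]
      rw [← loc_combo _ _ _ _ _ hab, loc_mem_Ioo]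
      constructor <;> nlinarith
    · simp only [cornerPt, mem_preimage, Complex.add_im, Complex.real_smul, Complex.im_ofReal_mul]
      rw [← loc_combo _ _ _ _ _ hab, loc_mem_Ioo]
      constructor <;> nlinarith
  ev_left := by rw [ev_corner]; simp [cornerPt]
  ev_right := by rw [ev_corner]; simp [cornerPt]; ring

theorem isChord_rail {t b : ℝ} (ht : t ∈ Ioo (0 : ℝ) 1) (hb : b ∈ Ioo (0 : ℝ) 1) :
    IsChord unitSq (rail t b) ⟨t, 1⟩ ⟨b, 0⟩ where
  left_mem := mem_frontier_unitSq.2 ⟨⟨Ioo_subset_Icc_self ht, by simp⟩, by simp⟩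
  right_mem := mem_frontier_unitSq.2 ⟨⟨Ioo_subset_Icc_self hb, by simp⟩, by simp⟩
  ne h := by simpa using congrArg Complex.im h
  subset := by
    rintro _ ⟨a, d, ha, hd, hab, rfl⟩
    rw [interior_unitSq]
    constructor
    · have := convex_Ioo (0 : ℝ) 1 ht hb ha.le hd.le hab
      simpa using this
    · simp; constructor <;> linarith
  ev_left := by rw [ev_rail]; simp
  ev_right := by rw [ev_rail]; simp

theorem isChord_symm {K : Set ℂ} {c : FoldLine} {p q : ℂ} (h : IsChord K c p q) :
    IsChord K c q p :=
  ⟨h.right_mem, h.left_mem, h.ne.symm, openSegment_symm ℝ p q ▸ h.subset, h.ev_right, h.ev_left⟩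

end FoldLine

/-- A rooted bipartite presentation of a tree from which a folding of the square can be read off.
Vertices labelled `none` lie on the horizontal sides (`s` tells which one), ordered by `key`;
vertices labelled `some c` converge to the corner `c` as `key` grows. -/
structure Layout {V : Type} (T : SimpleGraph V) where
  a : V
  par : V → V
  s : V → Bool
  key : V → ℕ
  lab : V → Option (Bool × Bool)
  key_par : ∀ v, v ≠ a → key (par v) < key v
  s_par : ∀ v, v ≠ a → s (par v) = !s v
  lab_a : lab a = none
  lab_par : ∀ v, v ≠ a → lab v = none → lab (par v) = none
  lab_par_some : ∀ v c, lab v = some c → lab (par v) = some c ∨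
    (lab (par v) = none ∧ s (par v) = c.2 ∧
      ∀ u, lab u = none → s u = c.2 → if c.1 then key u ≤ key (par v) else key (par v) ≤ key u)
  key_le_par : ∀ v w, v ≠ a → w ≠ a → lab v = lab w → key v < key w → s v = s (par w) →
    key v ≤ key (par w)
  par_le_par : ∀ v w, v ≠ a → w ≠ a → lab v = lab w → key v < key w → s v = s w →
    key (par v) ≤ key (par w)
  key_inj : ∀ v w, lab v = lab w → key v = key w → v = w
  adj_iff : ∀ v w, T.Adj v w ↔ (v ≠ a ∧ w = par v) ∨ (w ≠ a ∧ v = par w)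

namespace Layout

variable {V : Type} {T : SimpleGraph V} (L : Layout T)

/-- The extreme vertices of a horizontal side, to which the corner `c` can be attached. -/
def IsRoot (c : Bool × Bool) (u : V) : Prop :=
  L.lab u = none ∧ L.s u = c.2 ∧
    ∀ w, L.lab w = none → L.s w = c.2 → if c.1 then L.key w ≤ L.key u else L.key u ≤ L.key w

/-- Endpoints of the creases around the corner `c`. -/
def Mem (c : Bool × Bool) (u : V) : Prop :=
  L.lab u = some c ∨ ((∃ v, L.lab v = some c) ∧ L.IsRoot c u)

variable {L}

theorem ne_a_of_lab {v : V} {c : Bool × Bool} (h : L.lab v = some c) : v ≠ L.a := by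
  rintro rfl
  rw [L.lab_a] at h
  cases h

theorem mem_par {v : V} {c : Bool × Bool} (h : L.lab v = some c) : L.Mem c (L.par v) :=
  (L.lab_par_some v c h).imp id fun h' => ⟨⟨v, h⟩, h'⟩

theorem IsRoot.key_eq {c : Bool × Bool} {u w : V} (hu : L.IsRoot c u) (hw : L.IsRoot c w) :
    L.key u = L.key w := by
  have h1 := hu.2.2 w hw.1 hw.2.1
  have h2 := hw.2.2 u hu.1 hu.2.1
  split_ifs at h1 h2
  · exact le_antisymm h2 h1
  · exact le_antisymm h1 h2

theorem IsRoot.key_lt {c : Bool × Bool} {u v : V} (hu : L.IsRoot c u) (hv : L.lab v = some c) :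
    L.key u < L.key v := by
  have h1 := L.key_par v (ne_a_of_lab hv)
  rcases L.lab_par_some v c hv with h | h
  · exact (hu.key_lt h).trans h1
  · exact (hu.key_eq h).trans_lt h1
termination_by L.key v

theorem exists_isRoot {c : Bool × Bool} {v : V} (hv : L.lab v = some c) : ∃ u, L.IsRoot c u := by
  rcases L.lab_par_some v c hv with h | h
  · have := L.key_par v (ne_a_of_lab hv)
    exact exists_isRoot h
  · exact ⟨_, h⟩
termination_by L.key v

variable [Fintype V]

variable (V) in
/-- The width of the strip containing the central creases. -/
def width : ℝ := 1 / (8 * (Fintype.card V + 1))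

theorem width_pos : 0 < width V := by unfold width; positivity

theorem width_le : width V ≤ 1 / 8 := by
  unfold width
  rw [div_le_div_iff_of_pos_left one_pos (by positivity) (by norm_num)]
  have : (0 : ℝ) ≤ Fintype.card V := by positivity
  linarith

variable (L) in
/-- The horizontal position of the central vertices. -/
def xpos (v : V) : ℝ := 1 / 2 + width V * (1 - (1 / 2) ^ L.key v)

theorem xpos_mem (v : V) : 1 / 2 ≤ L.xpos v ∧ L.xpos v < 1 / 2 + width V := by
  have h := width_pos (V := V)
  have h1 : (0 : ℝ) < (1 / 2) ^ L.key v := by positivity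
  have h2 : ((1 : ℝ) / 2) ^ L.key v ≤ 1 := pow_le_one₀ (by norm_num) (by norm_num)
  unfold xpos
  constructor <;> nlinarith

theorem xpos_lt {u v : V} (h : L.key u < L.key v) : L.xpos u < L.xpos v := by
  have h1 := width_pos (V := V)
  have h2 : ((1 : ℝ) / 2) ^ L.key v < (1 / 2) ^ L.key u :=
    pow_lt_pow_right_of_lt_one₀ (by norm_num) (by norm_num) h
  unfold xpos
  nlinarith

theorem xpos_le {u v : V} (h : L.key u ≤ L.key v) : L.xpos u ≤ L.xpos v := by
  rcases h.eq_or_lt with h | h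
  · rw [xpos, xpos, h]
  · exact (xpos_lt h).le

variable (L) in
open Classical in
/-- The distance to the corner `c` of a vertex attached to it. -/
def cdist (c : Bool × Bool) (u : V) : ℝ :=
  if L.lab u = some c then (1 / 4) ^ (L.key u + 2) else loc c.1 (L.xpos u)

theorem cdist_of_lab {c : Bool × Bool} {u : V} (h : L.lab u = some c) :
    L.cdist c u = (1 / 4) ^ (L.key u + 2) := if_pos h

theorem cdist_of_none {c : Bool × Bool} {u : V} (h : L.lab u = none) :
    L.cdist c u = loc c.1 (L.xpos u) := if_neg (by simp [h])

theorem cdist_le_of_lab {c : Bool × Bool} {u : V} (h : L.lab u = some c) :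
    L.cdist c u ≤ 1 / 16 := by
  rw [cdist_of_lab h, pow_add]
  have : ((1 : ℝ) / 4) ^ L.key u ≤ 1 := pow_le_one₀ (by norm_num) (by norm_num)
  linarith

theorem loc_xpos_mem (r : Bool) (v : V) : 3 / 8 ≤ loc r (L.xpos v) ∧ loc r (L.xpos v) ≤ 5 / 8 := by
  have h := xpos_mem (L := L) v
  have h1 := width_le (V := V)
  cases r <;> simp [loc] <;> constructor <;> linarith

theorem cdist_pos (c : Bool × Bool) (u : V) : 0 < L.cdist c u := by
  unfold cdist
  split_ifs
  · positivity
  · linarith [loc_xpos_mem (L := L) c.1 u]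

theorem cdist_le (c : Bool × Bool) (u : V) : L.cdist c u ≤ 5 / 8 := by
  by_cases h : L.lab u = some c
  · linarith [cdist_le_of_lab h]
  · rw [cdist, if_neg h]
    exact (loc_xpos_mem c.1 u).2

/-- The corner distances drop quickly with the key. -/
theorem four_mul_cdist_le {c : Bool × Bool} {u v : V} (hu : L.Mem c u) (hv : L.lab v = some c)
    (h : L.key u < L.key v) : 4 * L.cdist c v ≤ L.cdist c u := by
  rcases hu with hu | hu
  · rw [cdist_of_lab hu, cdist_of_lab hv]
    have : ((1 : ℝ) / 4) ^ (L.key v + 2) ≤ (1 / 4) ^ (L.key u + 3) :=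
      pow_le_pow_of_le_one (by norm_num) (by norm_num) (by omega)
    rw [pow_succ _ (L.key u + 2)] at this
    linarith
  · rw [cdist_of_none hu.2.1]
    linarith [cdist_le_of_lab hv, loc_xpos_mem (L := L) c.1 u]

theorem cdist_anti {c : Bool × Bool} {u v : V} (hu : L.Mem c u) (hv : L.Mem c v)
    (h : L.key u ≤ L.key v) : L.cdist c v ≤ L.cdist c u := by
  rcases hv with hv | ⟨-, hv⟩
  · rcases h.eq_or_lt with h | h
    · rcases hu with hu | ⟨-, hu⟩
      · rw [cdist_of_lab hu, cdist_of_lab hv, h]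
      · exact absurd h (hu.key_lt hv).ne
    · linarith [four_mul_cdist_le hu hv h, cdist_pos (L := L) c v]
  · rcases hu with hu | ⟨-, hu⟩
    · exact absurd (hv.key_lt hu) (not_lt.2 h)
    · rw [cdist_of_none hu.1, cdist_of_none hv.1, xpos, xpos, hu.key_eq hv]

/-- Vertices attached to a corner are closer to it than the central vertices of its side. -/
theorem cdist_le_loc {c : Bool × Bool} {u w : V} (hu : L.Mem c u) (hw : L.lab w = none)
    (hs : L.s w = c.2) : L.cdist c u ≤ loc c.1 (L.xpos w) := by
  rcases hu with hu | ⟨-, hu⟩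
  · linarith [cdist_le_of_lab hu, loc_xpos_mem (L := L) c.1 w]
  · rw [cdist_of_none hu.1]
    have := hu.2.2 w hw hs
    split_ifs at this with hc
    · simp only [loc, hc, if_true]
      linarith [xpos_le this]
    · simp only [loc, hc]
      exact xpos_le this

variable (L) in
/-- The position of a vertex on the boundary of the square. -/
def pos (v : V) : ℂ :=
  match L.lab v with
  | none => ⟨L.xpos v, if L.s v then 1 else 0⟩
  | some c => if L.s v = c.2 then cornerPt c (L.cdist c v) 0 else cornerPt c 0 (L.cdist c v)

theorem pos_of_none {v : V} (h : L.lab v = none) :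
    L.pos v = ⟨L.xpos v, if L.s v then 1 else 0⟩ := by rw [pos, h]

theorem pos_of_some {v : V} {c : Bool × Bool} (h : L.lab v = some c) :
    L.pos v = if L.s v = c.2 then cornerPt c (L.cdist c v) 0 else cornerPt c 0 (L.cdist c v) := by
  rw [pos, h]

theorem pos_of_mem {v : V} {c : Bool × Bool} (h : L.Mem c v) :
    L.pos v = if L.s v = c.2 then cornerPt c (L.cdist c v) 0 else cornerPt c 0 (L.cdist c v) := by
  rcases h with h | ⟨-, h⟩
  · exact pos_of_some h
  · rw [pos_of_none h.1, if_pos h.2.1, cdist_of_none h.1, cornerPt, loc_loc, h.2.1]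
    cases c.2 <;> simp [loc]

theorem loc_pos_mem {v : V} {c : Bool × Bool} (h : L.lab v = some c) :
    loc c.1 (L.pos v).re ≤ 1 / 16 ∧ loc c.2 (L.pos v).im ≤ 1 / 16 := by
  have h1 := cdist_le_of_lab h
  rw [pos_of_some h]
  split_ifs <;> simp [cornerPt] <;> linarith

theorem pos_injective : Function.Injective L.pos := by
  have hmix : ∀ v w c, L.lab v = none → L.lab w = some c → L.pos v ≠ L.pos w := by
    intro v w c hv hw h
    have h1 := (loc_pos_mem hw).1
    rw [← h, pos_of_none hv] at h1
    linarith [loc_xpos_mem (L := L) c.1 v]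
  intro v w h
  rcases hv : L.lab v with _ | c <;> rcases hw : L.lab w with _ | d
  · rw [pos_of_none hv, pos_of_none hw] at h
    have h1 : L.xpos v = L.xpos w := congrArg Complex.re h
    refine L.key_inj v w (hv.trans hw.symm) ?_
    rcases lt_trichotomy (L.key v) (L.key w) with h2 | h2 | h2
    · exact absurd h1 (xpos_lt h2).ne
    · exact h2
    · exact absurd h1 (xpos_lt h2).ne'
  · exact absurd h (hmix v w d hv hw)
  · exact absurd h.symm (hmix w v c hw hv)
  · have hcd : c = d := by
      have h1 := loc_pos_mem hv
      have h2 := loc_pos_mem hw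
      rw [h] at h1
      obtain ⟨c₁, c₂⟩ := c
      obtain ⟨d₁, d₂⟩ := d
      have e1 : c₁ = d₁ := by
        by_contra hcon
        rw [Bool.eq_not.2 (Ne.symm hcon)] at h2
        linarith [loc_add_loc_not c₁ (L.pos w).re, h1.1, h2.1]
      have e2 : c₂ = d₂ := by
        by_contra hcon
        rw [Bool.eq_not.2 (Ne.symm hcon)] at h2
        linarith [loc_add_loc_not c₂ (L.pos w).im, h1.2, h2.2]
      rw [e1, e2]
    subst hcd
    have key : L.cdist c v = L.cdist c w := by
      have h1 := cdist_pos (L := L) c v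
      have h2 := cdist_pos (L := L) c w
      rw [pos_of_some hv, pos_of_some hw] at h
      have e1 := congrArg Complex.re h
      have e2 := congrArg Complex.im h
      split_ifs at e1 e2
      · exact loc_inj e1
      · exact absurd (loc_inj e1) h1.ne'
      · exact absurd (loc_inj e1) h2.ne
      · exact loc_inj e2
    rw [cdist_of_lab hv, cdist_of_lab hw] at key
    refine L.key_inj v w (hv.trans hw.symm) ?_
    have := pow_right_injective₀ (a := (1 : ℝ) / 4) (by norm_num) (by norm_num) key
    omega

end Layout

namespace Layout

open FoldLine

variable {V : Type} {T : SimpleGraph V} {L : Layout T}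

variable (L) in
/-- The endpoint on the side `τ` of the edge joining a vertex to its parent. -/
def side (τ : Bool) (v : V) : V := if L.s v = τ then v else L.par v

theorem s_side {v : V} (hv : v ≠ L.a) (τ : Bool) : L.s (L.side τ v) = τ := by
  unfold side
  split_ifs with h
  · exact h
  · rw [L.s_par v hv]; cases hs : L.s v <;> cases τ <;> simp_all

theorem lab_side {v : V} (hv : v ≠ L.a) (h : L.lab v = none) (τ : Bool) :
    L.lab (L.side τ v) = none := by
  unfold side
  split_ifs
  · exact h
  · exact L.lab_par v hv h

theorem mem_side {v : V} {c : Bool × Bool} (h : L.lab v = some c) (τ : Bool) :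
    L.Mem c (L.side τ v) := by
  unfold side
  split_ifs
  · exact Or.inl h
  · exact mem_par h

theorem key_side_le {v w : V} (hv : v ≠ L.a) (hw : w ≠ L.a) (h : L.lab v = L.lab w)
    (hk : L.key v < L.key w) (τ : Bool) : L.key (L.side τ v) ≤ L.key (L.side τ w) := by
  unfold side
  split_ifs with h1 h2 h2
  · exact hk.le
  · refine L.key_le_par v w hv hw h hk ?_
    rw [L.s_par w hw, h1]
    exact (Bool.eq_not.2 (Ne.symm h2))
  · exact ((L.key_par v hv).trans hk).le
  · refine L.par_le_par v w hv hw h hk ?_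
    rw [Bool.eq_not.2 h1, Bool.eq_not.2 h2]

theorem key_side_lt {v w : V} (hv : v ≠ L.a) (hk : L.key v < L.key w) (τ : Bool) :
    L.key (L.side τ v) < L.key w := by
  unfold side
  split_ifs
  · exact hk
  · exact (L.key_par v hv).trans hk

variable [Fintype V]

variable (L) in
/-- The crease carrying the edge from a vertex to its parent. -/
def line (v : V) : FoldLine :=
  match L.lab v with
  | none => rail (L.xpos (L.side true v)) (L.xpos (L.side false v))
  | some c => corner c (L.cdist c (L.side c.2 v)) (L.cdist c (L.side (!c.2) v)) (cdist_pos _ _)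

theorem line_of_none {v : V} (h : L.lab v = none) :
    L.line v = rail (L.xpos (L.side true v)) (L.xpos (L.side false v)) := by rw [line, h]

theorem line_of_some {v : V} {c : Bool × Bool} (h : L.lab v = some c) : L.line v =
    corner c (L.cdist c (L.side c.2 v)) (L.cdist c (L.side (!c.2) v)) (cdist_pos _ _) := by
  rw [line, h]

theorem isChord_line {v : V} (hv : v ≠ L.a) :
    IsChord unitSq (L.line v) (L.pos v) (L.pos (L.par v)) := by
  rcases h : L.lab v with _ | c
  · have hx : ∀ u, L.xpos u ∈ Ioo (0 : ℝ) 1 := fun u => by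
      have := loc_xpos_mem (L := L) false u
      simp only [loc, Bool.false_eq_true, if_false] at this
      constructor <;> linarith
    have := isChord_rail (hx (L.side true v)) (hx (L.side false v))
    rw [line_of_none h, pos_of_none h, pos_of_none (L.lab_par v hv h), L.s_par v hv]
    cases hs : L.s v
    · simp only [side, hs] at this ⊢
      exact isChord_symm (by simpa using this)
    · simp only [side, hs] at this ⊢
      simpa using this
  · have hc : ∀ u, 0 < L.cdist c u ∧ L.cdist c u < 1 := fun u =>
      ⟨cdist_pos c u, (cdist_le c u).trans_lt (by norm_num)⟩
    have := isChord_corner (c := c) (hc (L.side c.2 v)).1 (hc (L.side c.2 v)).2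
      (hc (L.side (!c.2) v)).1 (hc (L.side (!c.2) v)).2
    rw [line_of_some h, pos_of_some h, pos_of_mem (mem_par h), L.s_par v hv]
    by_cases hs : L.s v = c.2
    · simp only [side, hs] at this ⊢
      simpa using this
    · have hs' := Bool.eq_not.2 hs
      simp only [side, hs'] at this ⊢
      exact isChord_symm (by simpa using this)

theorem rail_lt {v w : V} (hv : v ≠ L.a) (hw : w ≠ L.a) (hvl : L.lab v = none)
    (hwl : L.lab w = none) (hk : L.key v < L.key w) :
    (∀ z ∈ unitSq, (L.line w).ev z ≤ (L.line v).ev z) ∧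
      ∀ z ∈ interior unitSq, (L.line w).ev z < (L.line v).ev z := by
  have h := fun τ => xpos_le (key_side_le hv hw (hvl.trans hwl.symm) hk τ)
  have ht := h true
  have hb := h false
  rw [line_of_none hvl, line_of_none hwl]
  constructor
  · intro z hz
    rw [ev_rail, ev_rail]
    nlinarith [mul_le_mul_of_nonneg_left hb (sub_nonneg.2 hz.2.2),
      mul_le_mul_of_nonneg_left ht hz.2.1]
  · intro z hz
    rw [interior_unitSq] at hz
    have hz1 : 0 < z.im := hz.2.1
    have hz2 : 0 < 1 - z.im := sub_pos.2 hz.2.2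
    rw [ev_rail, ev_rail]
    have hlt : L.xpos (L.side (L.s w) v) < L.xpos (L.side (L.s w) w) := by
      refine xpos_lt ?_
      rw [show L.side (L.s w) w = w from if_pos rfl]
      exact key_side_lt hv hk _
    cases hs : L.s w <;> rw [hs] at hlt
    · nlinarith [mul_lt_mul_of_pos_left hlt hz2, mul_le_mul_of_nonneg_left ht hz1.le]
    · nlinarith [mul_lt_mul_of_pos_left hlt hz1, mul_le_mul_of_nonneg_left hb hz2.le]

theorem exists_comparison {w : V} {c : Bool × Bool} (hw : L.lab w = some c) :
    ∃ A B, Comparison (L.cdist c (L.side c.2 w)) (L.cdist c (L.side (!c.2) w)) A B ∧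
      (∀ u, L.lab u = none → L.s u = c.2 → A ≤ loc c.1 (L.xpos u)) ∧ B ≤ 1 / 4 ∧
      ∀ v, L.lab v = some c → L.key v < L.key w →
        A ≤ L.cdist c (L.side c.2 v) ∧ B ≤ L.cdist c (L.side (!c.2) v) := by
  have hwa := ne_a_of_lab hw
  have hp := fun u => cdist_pos (L := L) c u
  have hle := fun u => (cdist_le (L := L) c u).trans (show (5 : ℝ) / 8 ≤ 1 by norm_num)
  have h16 := cdist_le_of_lab hw
  have hpar := four_mul_cdist_le (mem_par hw) hw (L.key_par w hwa)
  have hmono : ∀ v, L.lab v = some c → L.key v < L.key w → ∀ τ,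
      L.cdist c (L.side τ w) ≤ L.cdist c (L.side τ v) := fun v hv hk τ =>
    cdist_anti (mem_side hv τ) (mem_side hw τ)
      (key_side_le (ne_a_of_lab hv) hwa (hv.trans hw.symm) hk τ)
  have hfour : ∀ v, L.lab v = some c → L.key v < L.key w → ∀ τ,
      4 * L.cdist c w ≤ L.cdist c (L.side τ v) := fun v hv hk τ =>
    four_mul_cdist_le (mem_side hv τ) hw (key_side_lt (ne_a_of_lab hv) hk τ)
  by_cases hs : L.s w = c.2
  · have e1 : L.side c.2 w = w := if_pos hs
    have e2 : L.side (!c.2) w = L.par w := if_neg (by simp [hs])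
    refine ⟨4 * L.cdist c w, L.cdist c (L.par w), ⟨hp _, hp _, hle _, hle _, Or.inr ?_⟩,
      fun u _ _ => ?_, ?_, fun v hv hk => ⟨hfour v hv hk _, ?_⟩⟩
    · rw [e1, e2]
      exact ⟨rfl, rfl, hpar, by linarith⟩
    · linarith [loc_xpos_mem (L := L) c.1 u]
    · rcases L.lab_par_some w c hw with h | h
      · linarith [cdist_le_of_lab h]
      · have := L.s_par w hwa
        rw [h.2.1, hs] at this
        simp at this
    · rw [← e2]; exact hmono v hv hk _
  · have e1 : L.side c.2 w = L.par w := if_neg hs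
    have e2 : L.side (!c.2) w = w := if_pos (Bool.eq_not.2 hs)
    refine ⟨L.cdist c (L.par w), 4 * L.cdist c w, ⟨hp _, hp _, hle _, hle _, Or.inl ?_⟩,
      fun u hu hu' => cdist_le_loc (mem_par hw) hu hu', by linarith,
      fun v hv hk => ⟨?_, hfour v hv hk _⟩⟩
    · rw [e1, e2]
      exact ⟨rfl, rfl, hpar, by linarith⟩
    · rw [← e1]; exact hmono v hv hk _

/-- Around each corner, creases that come before a given one are unaffected by folding it. -/
theorem exists_comparison_constSign {w : V} {c : Bool × Bool} (hw : L.lab w = some c) :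
    ∃ A B, ∃ h : Comparison (L.cdist c (L.side c.2 w)) (L.cdist c (L.side (!c.2) w)) A B,
      ∀ v, v ≠ L.a → (L.lab v = L.lab w → L.key v < L.key w) →
        ConstSign (L.line v) (corner c A B h.A_pos) := by
  obtain ⟨A, B, h, hA, hB, hAB⟩ := exists_comparison hw
  refine ⟨A, B, h, fun v hv hk => ?_⟩
  rcases hvl : L.lab v with _ | d
  · rw [line_of_none hvl]
    refine constSign_rail _ h.B_pos (by linarith) ?_ ?_
    · have := hA (L.side c.2 v) (lab_side hv hvl _) (s_side hv _)
      cases hc : c.2 <;> simpa [hc] using this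
    · cases c.2 <;> simp only [Bool.false_eq_true, if_false, if_true] <;>
        linarith [loc_xpos_mem (L := L) c.1 (L.side true v),
          loc_xpos_mem (L := L) c.1 (L.side false v)]
  · rw [line_of_some hvl]
    have hp := fun u => cdist_pos (L := L) d u
    by_cases h2 : d.2 = c.2
    · by_cases h1 : d.1 = c.1
      · obtain rfl : d = c := Prod.ext h1 h2
        have := hAB v hvl (hk (hvl.trans hw.symm))
        exact constSign_corner_self _ _ h.B_pos this.1 this.2
      · refine constSign_corner_re _ (hp _) _ h.B_pos (Bool.eq_not.2 h1) ?_
        obtain ⟨r, hr⟩ := exists_isRoot hw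
        have e1 := hA r hr.1 hr.2.1
        have e2 := cdist_le_loc (mem_side hvl d.2) hr.1 (hr.2.1.trans h2.symm)
        rw [Bool.eq_not.2 h1] at e2
        have e3 := loc_add_loc_not c.1 (L.xpos r)
        linarith
    · refine constSign_corner_im _ _ h.B_pos (Bool.eq_not.2 h2) ?_ (hp _)
      linarith [cdist_le (L := L) d (L.side (!d.2) v)]

theorem exists_sorted {α : Type*} [Fintype α] (f : α → ℕ) (p : α → Prop) :
    ∃ l : List α, l.Nodup ∧ (∀ x, x ∈ l ↔ p x) ∧ l.Pairwise fun x y => f x ≤ f y := by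
  classical
  refine ⟨((Finset.univ.filter p).toList).insertionSort (fun x y => f x ≤ f y), ?_, ?_, ?_⟩
  · exact (List.perm_insertionSort _ _).nodup_iff.2 (Finset.nodup_toList _)
  · intro x
    rw [(List.perm_insertionSort _ _).mem_iff]
    simp
  · have : Std.Total fun x y : α => f x ≤ f y := ⟨fun x y => le_total _ _⟩
    have : IsTrans α fun x y : α => f x ≤ f y := ⟨fun _ _ _ => le_trans⟩
    exact List.pairwise_insertionSort _ _

theorem exists_sorted_lab (p : V → Prop) :
    ∃ l : List V, l.Nodup ∧ (∀ x, x ∈ l ↔ p x) ∧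
      l.Pairwise fun x y => L.lab x = L.lab y → L.key x < L.key y := by
  obtain ⟨l, h1, h2, h3⟩ := exists_sorted L.key p
  refine ⟨l, h1, h2, ?_⟩
  refine (h3.and h1).imp ?_
  rintro x y ⟨hle, hne⟩ hl
  exact hle.lt_of_ne fun h => hne (L.key_inj x y hl h)

variable (L) in
theorem exists_foldLines : ∃ l : List FoldLine, (∀ c, c ∈ l ↔ ∃ v, v ≠ L.a ∧ L.line v = c) ∧
    Nested unitSq l ∧ HasLift unitSq (foldMap l) := by
  obtain ⟨l₀, hn₀, hm₀, hs₀⟩ := exists_sorted_lab (L := L) fun v => v ≠ L.a ∧ L.lab v = none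
  obtain ⟨l₁, hn₁, hm₁, hs₁⟩ := exists_sorted_lab (L := L) fun v => v ≠ L.a ∧ L.lab v ≠ none
  have hlt : l₀.Pairwise fun v w => (∀ z ∈ unitSq, (L.line w).ev z ≤ (L.line v).ev z) ∧
      ∀ z ∈ interior unitSq, (L.line w).ev z < (L.line v).ev z := by
    refine hs₀.imp_of_mem fun {v w} hv hw h => ?_
    rw [hm₀] at hv hw
    exact rail_lt hv.1 hw.1 hv.2 hw.2 (h (hv.2.trans hw.2.symm))
  have hN₀ : Nested unitSq (l₀.map L.line) := by
    refine List.pairwise_map.2 (hlt.imp fun {v w} h => ⟨fun z hz h0 => ?_, fun z hz h0 => ?_⟩)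
    · rw [← h0]; exact h.1 z hz
    · rw [← h0]; exact h.2 z hz
  have hnest : ∀ v w, v ≠ L.a → L.lab w ≠ none → (L.lab v = L.lab w → L.key v < L.key w) →
      (∀ z ∈ unitSq, (L.line v).ev z = 0 → (L.line w).ev z ≤ 0) ∧
        ∀ z ∈ interior unitSq, (L.line v).ev z = 0 → (L.line w).ev z < 0 := by
    intro v w hv hw hk
    obtain ⟨c, hc⟩ := Option.ne_none_iff_exists'.1 hw
    obtain ⟨A, B, h, hAB⟩ := exists_comparison_constSign hc
    rw [line_of_some hc]
    exact h.nested (hAB v hv hk)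
  have hN : Nested unitSq (l₀.map L.line ++ l₁.map L.line) := by
    refine List.pairwise_append.2 ⟨hN₀, List.pairwise_map.2 ?_, ?_⟩
    · refine hs₁.imp_of_mem fun {v w} hv hw h => ?_
      rw [hm₁] at hv hw
      exact hnest v w hv.1 hw.2 h
    · intro x hx y hy
      obtain ⟨v, hv, rfl⟩ := List.mem_map.1 hx
      obtain ⟨w, hw, rfl⟩ := List.mem_map.1 hy
      rw [hm₀] at hv
      rw [hm₁] at hw
      exact hnest v w hv.1 hw.2 fun h => absurd (h.symm.trans hv.2) hw.2
  refine ⟨l₀.map L.line ++ l₁.map L.line, fun c => ?_, hN, ?_⟩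
  · simp only [List.mem_append, List.mem_map, hm₀, hm₁]
    constructor
    · rintro (⟨v, h, rfl⟩ | ⟨v, h, rfl⟩)
      · exact ⟨v, h.1, rfl⟩
      · exact ⟨v, h.1, rfl⟩
    · rintro ⟨v, h, rfl⟩
      by_cases hv : L.lab v = none
      · exact Or.inl ⟨v, ⟨h, hv⟩, rfl⟩
      · exact Or.inr ⟨v, ⟨h, hv⟩, rfl⟩
  · refine hasLift_append isCompact_unitSq hN ?_ ?_
    · refine hasLift_strip convex_unitSq hN₀ (κ := width V) ?_ ?_ width_pos.le ?_
      · exact List.pairwise_map.2 (hlt.imp fun {v w} h z hz h0 => h0.trans (h.1 z hz))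
      · intro c hc
        obtain ⟨v, hv, rfl⟩ := List.mem_map.1 hc
        rw [line_of_none ((hm₀ v).1 hv).2]
        refine ⟨rfl, ?_⟩
        have h1 := xpos_mem (L := L) (L.side true v)
        have h2 := xpos_mem (L := L) (L.side false v)
        simp only [rail, abs_neg]
        exact abs_le.2 ⟨by linarith, by linarith⟩
      · rw [List.length_map]
        have : (l₀.length : ℝ) ≤ Fintype.card V := by exact_mod_cast hn₀.length_le_card
        have h0 : (0 : ℝ) ≤ Fintype.card V := by positivity
        rw [width, mul_one_div, div_mul_eq_mul_div, div_lt_one (by positivity)]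
        linarith
    · intro k₁ c k₂ hk
      obtain ⟨m₁, m', hm, rfl, hm'⟩ := List.map_eq_append_iff.1 hk
      obtain ⟨w, m₂, rfl, rfl, rfl⟩ := List.map_eq_cons_iff.1 hm'
      have hw := (hm₁ w).1 (by simp [hm])
      obtain ⟨c, hc⟩ := Option.ne_none_iff_exists'.1 hw.2
      obtain ⟨A, B, h, hAB⟩ := exists_comparison_constSign hc
      rw [line_of_some hc]
      refine h.safeCrossing fun i hi => ?_
      rcases List.mem_append.1 hi with hi | hi
      · obtain ⟨v, hv, rfl⟩ := List.mem_map.1 hi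
        rw [hm₀] at hv
        exact hAB v hv.1 fun h => absurd (h.symm.trans hv.2) hw.2
      · obtain ⟨v, hv, rfl⟩ := List.mem_map.1 hi
        refine hAB v ((hm₁ v).1 (by simp [hm, hv])).1 ?_
        rw [hm] at hs₁
        exact (List.pairwise_append.1 hs₁).2.2 v hv w (by simp)

/-- A tree with a layout is the graph of an outer global flat folding of the unit square. -/
theorem exists_folding (L : Layout T) (hT : ∀ v, ∃ w, T.Adj v w) : ∃ (K : Set ℂ) (φ : ℂ → ℂ),
    IsSquareRegion K ∧ IsOuterGlobalFlatFolding K φ ∧ Nonempty (T ≃g outerGraph K φ) := by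
  obtain ⟨l, hl, hN, hlift⟩ := L.exists_foldLines
  have hunit : (interior unitSq).Nonempty :=
    ⟨⟨1 / 2, 1 / 2⟩, by rw [interior_unitSq]; norm_num [Complex.mem_reProdIm]⟩
  have hloc := hN.isOuterLocalFlatFolding convex_unitSq isCompact_unitSq hunit
    fun p hp => supporting_unitSq hp
  obtain ⟨ψ, hψ, hψ'⟩ := hlift.exists_embedding isCompact_unitSq hloc.continuousOn
  have hcr : ∀ p q, IsCreaseOf unitSq (foldMap l) p q ↔
      ∃ v w, T.Adj v w ∧ p = L.pos v ∧ q = L.pos w := by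
    have : Nonempty V := ⟨L.a⟩
    choose! g hg hg' using fun c hc => (hl c).1 hc
    intro p q
    rw [hN.isCreaseOf_iff convex_unitSq isCompact_unitSq.isClosed (fun c => L.pos (g c))
      (fun c => L.pos (L.par (g c))) fun c hc => by
        have := isChord_line (hg c hc)
        rwa [hg' c hc] at this]
    constructor
    · rintro ⟨c, hc, ⟨rfl, rfl⟩ | ⟨rfl, rfl⟩⟩
      · exact ⟨_, _, (L.adj_iff _ _).2 (Or.inl ⟨hg c hc, rfl⟩), rfl, rfl⟩
      · exact ⟨_, _, (L.adj_iff _ _).2 (Or.inr ⟨hg c hc, rfl⟩), rfl, rfl⟩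
    · have key : ∀ v, v ≠ L.a → ∃ c ∈ l,
          (L.pos v = L.pos (g c) ∧ L.pos (L.par v) = L.pos (L.par (g c))) ∨
          (L.pos v = L.pos (L.par (g c)) ∧ L.pos (L.par v) = L.pos (g c)) := by
        intro v hv
        have hc : L.line v ∈ l := (hl _).2 ⟨v, hv, rfl⟩
        have h1 := isChord_line hv
        have h2 := isChord_line (hg _ hc)
        rw [hg' _ hc] at h2
        refine ⟨_, hc, ?_⟩
        rcases h2.eq_or_eq convex_unitSq isCompact_unitSq.isClosed h1.left_mem h1.ev_left with
          h3 | h3 <;>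
        rcases h2.eq_or_eq convex_unitSq isCompact_unitSq.isClosed h1.right_mem h1.ev_right with
          h4 | h4
        · exact absurd (h3.trans h4.symm) h1.ne
        · exact Or.inl ⟨h3, h4⟩
        · exact Or.inr ⟨h3, h4⟩
        · exact absurd (h3.trans h4.symm) h1.ne
      rintro ⟨v, w, h, rfl, rfl⟩
      rcases (L.adj_iff _ _).1 h with ⟨ha, rfl⟩ | ⟨ha, rfl⟩
      · exact key v ha
      · obtain ⟨c, hc, h'⟩ := key w ha
        exact ⟨c, hc, h'.symm.imp And.symm And.symm⟩
  refine ⟨unitSq, foldMap l, isSquareRegion_unitSq, ⟨hloc, fun ε hε => ⟨ψ, hψ, fun p hp => ?_⟩⟩, ?_⟩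
  · rw [hψ' p hp, dist_self]; exact hε.le
  · have hv : ∀ v, ∃ q, IsCreaseOf unitSq (foldMap l) (L.pos v) q := fun v => by
      obtain ⟨w, h⟩ := hT v
      exact ⟨_, (hcr _ _).2 ⟨v, w, h, rfl, rfl⟩⟩
    have hadj : ∀ v w, IsCreaseOf unitSq (foldMap l) (L.pos v) (L.pos w) ↔ T.Adj v w := by
      intro v w
      rw [hcr]
      constructor
      · rintro ⟨v', w', h, h1, h2⟩
        rwa [pos_injective h1, pos_injective h2]
      · exact fun h => ⟨v, w, h, rfl, rfl⟩
    let e : V → OuterVertex unitSq (foldMap l) := fun v => ⟨L.pos v, hv v⟩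
    have he : Function.Bijective e := by
      refine ⟨fun v w h => pos_injective (congrArg Subtype.val h), ?_⟩
      rintro ⟨p, q, hq⟩
      obtain ⟨v, w, -, rfl, -⟩ := (hcr _ _).1 hq
      exact ⟨v, rfl⟩
    refine ⟨⟨Equiv.ofBijective e he, ?_⟩⟩
    intro v w
    simp only [Equiv.ofBijective_apply, outerGraph, SimpleGraph.fromRel_adj]
    change e v ≠ e w ∧ (IsCreaseOf _ _ (L.pos v) (L.pos w) ∨ IsCreaseOf _ _ (L.pos w) (L.pos v)) ↔ _
    rw [hadj, hadj, T.adj_comm w v, or_self]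
    exact ⟨fun h => h.2, fun h => ⟨fun h' => h.ne (he.1 h'), h⟩⟩

end Layout

section Rooting

variable {V : Type} {T : SimpleGraph V}

theorem eq_of_adj_of_dist_eq (hT : T.IsTree) {a v w w' : V} (hw : T.Adj v w)
    (hw' : T.Adj v w') (h : T.dist a v = T.dist a w + 1) (h' : T.dist a v = T.dist a w' + 1) :
    w = w' := by
  have key : ∀ u, T.Adj v u → T.dist a v = T.dist a u + 1 →
      ∃ p : T.Walk a v, p.IsPath ∧ p.penultimate = u := by
    intro u hu hd
    obtain ⟨p, hp, hl⟩ := (hT.connected a u).exists_path_of_dist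
    have hv : v ∉ p.support := by
      classical
      intro hv
      have h1 := SimpleGraph.dist_le (p.takeUntil v hv)
      have h2 := p.length_takeUntil_le_length hv
      omega
    exact ⟨p.concat hu.symm, hp.concat hv hu.symm, p.penultimate_concat hu.symm⟩
  obtain ⟨p, hp, rfl⟩ := key w hw h
  obtain ⟨q, hq, rfl⟩ := key w' hw' h'
  rw [show p = q from congrArg Subtype.val
    ((hT.isAcyclic.subsingleton_path a v).elim ⟨p, hp⟩ ⟨q, hq⟩)]

variable (T) in
/-- A presentation of a graph as a tree of parents hanging from a root. -/
structure Rooting where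
  a : V
  par : V → V
  depth : V → ℕ
  par_a : par a = a
  depth_a : depth a = 0
  depth_par : ∀ v, v ≠ a → depth v = depth (par v) + 1
  adj_iff : ∀ v w, T.Adj v w ↔ (v ≠ a ∧ w = par v) ∨ (w ≠ a ∧ v = par w)

theorem exists_rooting (hT : T.IsTree) (a : V) : ∃ R : Rooting T, R.a = a := by
  have hex : ∀ v, ∃ u, (v = a → u = a) ∧
      (v ≠ a → T.Adj v u ∧ T.dist a v = T.dist a u + 1) := by
    intro v
    by_cases hv : v = a
    · exact ⟨a, fun _ => rfl, fun h => absurd hv h⟩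
    obtain ⟨p, hp, hl⟩ := (hT.connected a v).exists_path_of_dist
    have hnil : ¬ p.Nil := fun h => hv h.eq.symm
    have hadj := (p.adj_penultimate hnil).symm
    refine ⟨p.penultimate, fun h => absurd h hv, fun _ => ⟨hadj, ?_⟩⟩
    rcases hT.dist_eq_dist_add_one_of_adj a hadj with h | h
    · exact h
    · have h1 := SimpleGraph.dist_le p.dropLast
      have h2 : p.dropLast.length = p.length - 1 := by simp
      omega
  choose par hpa hp using hex
  refine ⟨⟨a, par, T.dist a, hpa a rfl, by simp, fun v hv => (hp v hv).2,
    fun v w => ⟨fun h => ?_, ?_⟩⟩, rfl⟩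
  · rcases hT.dist_eq_dist_add_one_of_adj a h with h1 | h1
    · have hv : v ≠ a := by rintro rfl; simp at h1
      exact .inl ⟨hv, eq_of_adj_of_dist_eq hT h (hp v hv).1 h1 (hp v hv).2⟩
    · have hw : w ≠ a := by rintro rfl; simp at h1
      exact .inr ⟨hw, eq_of_adj_of_dist_eq hT h.symm (hp w hw).1 h1 (hp w hw).2⟩
  · rintro (⟨hv, rfl⟩ | ⟨hw, rfl⟩)
    · exact (hp v hv).1
    · exact (hp w hw).1.symm

namespace Rooting

variable (R : Rooting T)

theorem ne_of_depth_pos {v : V} (h : 0 < R.depth v) : v ≠ R.a := by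
  rintro rfl
  exact absurd R.depth_a h.ne'

theorem depth_pos {v : V} (h : v ≠ R.a) : 0 < R.depth v := by
  rw [R.depth_par v h]; omega

theorem eq_of_depth_eq_zero {v : V} (h : R.depth v = 0) : v = R.a := by
  by_contra hv
  exact absurd h (R.depth_pos hv).ne'

theorem adj_par {v : V} (h : v ≠ R.a) : T.Adj v (R.par v) := (R.adj_iff _ _).2 (.inl ⟨h, rfl⟩)

theorem ncard_neighborSet_par {v : V} (h : v ≠ R.a) (h' : R.par v ≠ R.a) :
    (T.neighborSet (R.par v)).ncard ≠ 1 := by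
  intro h1
  obtain ⟨x, hx⟩ := ncard_eq_one.1 h1
  have h2 : v ∈ T.neighborSet (R.par v) := (R.adj_par h).symm
  have h3 : R.par (R.par v) ∈ T.neighborSet (R.par v) := R.adj_par h'
  rw [hx, mem_singleton_iff] at h2 h3
  have h4 := R.depth_par _ h
  have h5 := R.depth_par _ h'
  rw [h3, ← h2] at h5
  omega

end Rooting

/-- The vertices of the spine. -/
def spine (T : SimpleGraph V) : Set V := {v | (T.neighborSet v).ncard ≠ 1}

theorem spine_nonempty [Fintype V] (hT : T.IsTree) (h3 : 3 ≤ Fintype.card V) :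
    (spine T).Nonempty := by
  classical
  by_contra! h
  have hall : ∀ v, (T.neighborSet v).ncard = 1 := by
    intro v
    by_contra hv
    exact (h ▸ (show v ∈ spine T from hv) : v ∈ (∅ : Set V))
  obtain ⟨a⟩ := hT.connected.nonempty
  obtain ⟨R, rfl⟩ := exists_rooting hT a
  obtain ⟨x, hx⟩ := ncard_eq_one.1 (hall R.a)
  have hsub : (Finset.univ : Finset V) ⊆ {R.a, x} := by
    intro v _
    by_cases hv : v = R.a
    · simp [hv]
    · have h1 : R.par v = R.a := by
        by_contra h1
        exact R.ncard_neighborSet_par hv h1 (hall _)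
      have h2 : v ∈ T.neighborSet R.a := h1 ▸ (R.adj_par hv).symm
      rw [hx, mem_singleton_iff] at h2
      simp [h2]
  have := (Finset.card_le_card hsub).trans Finset.card_le_two
  rw [Finset.card_univ] at this
  omega

namespace Rooting

theorem par_mem_spine {R : Rooting T} (ha : R.a ∈ spine T) {v : V} (hv : v ≠ R.a) : R.par v ∈ spine T := by
  by_cases h : R.par v = R.a
  · exact h ▸ ha
  · exact R.ncard_neighborSet_par hv h

open Classical in
/-- The children of a vertex within the spine. -/
def kids [Fintype V] (R : Rooting T) (v : V) : Finset V :=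
  Finset.univ.filter fun w => w ≠ R.a ∧ w ∈ spine T ∧ R.par w = v

variable [Fintype V] {R : Rooting T}

theorem mem_kids {v w : V} : w ∈ R.kids v ↔ w ≠ R.a ∧ w ∈ spine T ∧ R.par w = v := by
  simp [kids]

theorem ncard_inter_root : (T.neighborSet R.a ∩ spine T).ncard = (R.kids R.a).card := by
  rw [← ncard_coe_finset]
  congr 1
  ext w
  simp only [mem_inter_iff, SimpleGraph.mem_neighborSet, R.adj_iff, Finset.mem_coe, mem_kids,
    ne_eq, not_true_eq_false, false_and, false_or]
  constructor
  · rintro ⟨⟨h1, h2⟩, h3⟩; exact ⟨h1, h3, h2.symm⟩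
  · rintro ⟨h1, h3, h2⟩; exact ⟨⟨h1, h2.symm⟩, h3⟩

theorem ncard_inter_of_ne (ha : R.a ∈ spine T) {v : V} (hv : v ≠ R.a) :
    (T.neighborSet v ∩ spine T).ncard = (R.kids v).card + 1 := by
  classical
  have hn : R.par v ∉ R.kids v := by
    intro h
    have h1 := mem_kids.1 h
    have h2 := R.depth_par _ hv
    have h3 := R.depth_par _ h1.1
    rw [h1.2.2] at h3
    omega
  rw [← Finset.card_insert_of_notMem hn, ← ncard_coe_finset]
  congr 1
  ext w
  simp only [mem_inter_iff, SimpleGraph.mem_neighborSet, R.adj_iff, Finset.mem_coe, mem_kids,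
    Finset.mem_insert]
  constructor
  · rintro ⟨⟨_, h⟩ | ⟨h1, h2⟩, h3⟩
    · exact .inl h
    · exact .inr ⟨h1, h3, h2.symm⟩
  · rintro (rfl | ⟨h1, h3, h2⟩)
    · exact ⟨.inl ⟨hv, rfl⟩, par_mem_spine ha hv⟩
    · exact ⟨.inr ⟨h1, h2.symm⟩, h3⟩

theorem card_kids_add_sum_le (ha : R.a ∈ spine T) (s : Finset V)
    (hs : ∀ v, v ∈ s ↔ v ≠ R.a ∧ v ∈ spine T) :
    (R.kids R.a).card + ∑ v ∈ s, ((R.kids v).card - 1) ≤ (spineLeaves T).ncard := by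
  classical
  have h1 : s.card = ∑ v ∈ insert R.a s, (R.kids v).card := by
    rw [Finset.card_eq_sum_card_fiberwise (f := R.par) (t := insert R.a s)]
    · refine Finset.sum_congr rfl fun v _ => congrArg _ ?_
      ext w
      simp [mem_kids, hs, and_assoc]
    · intro v hv
      have hv := (hs v).1 hv
      by_cases h : R.par v = R.a
      · simp [h]
      · simpa [h, hs] using par_mem_spine ha hv.1
  rw [Finset.sum_insert (fun h => ((hs _).1 h).1 rfl)] at h1
  have h2 : ∑ v ∈ s, (R.kids v).card + (s.filter fun v => (R.kids v).card = 0).card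
      = s.card + ∑ v ∈ s, ((R.kids v).card - 1) := by
    rw [Finset.card_filter, Finset.card_eq_sum_ones, ← Finset.sum_add_distrib,
      ← Finset.sum_add_distrib]
    refine Finset.sum_congr rfl fun v _ => ?_
    split_ifs <;> omega
  have h3 : (s.filter fun v => (R.kids v).card = 0).card ≤ (spineLeaves T).ncard := by
    rw [← ncard_coe_finset]
    refine ncard_le_ncard (fun v hv => ?_) (toFinite _)
    have hv := Finset.mem_filter.1 (Finset.mem_coe.1 hv)
    have hv1 := (hs v).1 hv.1
    refine ⟨hv1.2, ?_⟩
    have h4 := ncard_inter_of_ne ha hv1.1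
    rw [hv.2] at h4
    exact h4
  omega

end Rooting

/-- A tree whose spine has at most four leaves can be rooted so that, in the spine, all branching
happens at the root and at one further vertex. -/
theorem exists_rooting_branching [Fintype V] (hT : T.IsTree) (h3 : 3 ≤ Fintype.card V)
    (h : (spineLeaves T).ncard ≤ 4) : ∃ (R : Rooting T) (b : V), R.a ∈ spine T ∧ b ∈ spine T ∧
      (∀ v, v ≠ R.a → v ≠ b → (R.kids v).card ≤ 1) ∧ (b = R.a → (R.kids b).card ≤ 4) ∧
      (b ≠ R.a → (R.kids R.a).card ≤ 3 ∧ (R.kids b).card ≤ 2) := by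
  classical
  obtain ⟨a, ha, hmax⟩ := exists_max_image (spine T) (fun v => (T.neighborSet v ∩ spine T).ncard)
    (toFinite _) (spine_nonempty hT h3)
  obtain ⟨R, rfl⟩ := exists_rooting hT a
  set s := Finset.univ.filter fun v => v ≠ R.a ∧ v ∈ spine T with hs
  have hs' : ∀ v, v ∈ s ↔ v ≠ R.a ∧ v ∈ spine T := by simp [hs]
  have hsum := (R.card_kids_add_sum_le ha s hs').trans h
  have hz : ∀ v, v ∉ spine T → R.kids v = ∅ := by
    intro v hv
    by_contra hne
    obtain ⟨w, hw⟩ := Finset.nonempty_iff_ne_empty.2 hne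
    have hw := Rooting.mem_kids.1 hw
    exact hv (hw.2.2 ▸ Rooting.par_mem_spine ha hw.1)
  have hle : ∀ v ∈ s, (R.kids v).card + 1 ≤ (R.kids R.a).card := by
    intro v hv
    have := hmax v ((hs' v).1 hv).2
    simpa only [Rooting.ncard_inter_root, Rooting.ncard_inter_of_ne ha ((hs' v).1 hv).1] using this
  by_cases hb : ∃ b ∈ s, 2 ≤ (R.kids b).card
  · obtain ⟨b, hbs, hb⟩ := hb
    have h1 := hle b hbs
    have h2 := Finset.add_sum_erase s (fun v => (R.kids v).card - 1) hbs
    refine ⟨R, b, ha, ((hs' b).1 hbs).2, fun v hva hvb => ?_,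
      fun hba => absurd hba ((hs' b).1 hbs).1, fun _ => ?_⟩
    · by_cases hv : v ∈ spine T
      · have h4 := Finset.single_le_sum (f := fun v => (R.kids v).card - 1)
          (fun _ _ => Nat.zero_le _) (Finset.mem_erase.2 ⟨hvb, (hs' v).2 ⟨hva, hv⟩⟩)
        omega
      · simp [hz v hv]
    · omega
  · push Not at hb
    refine ⟨R, R.a, ha, ha, fun v hva _ => ?_, fun _ => by omega, fun h => absurd rfl h⟩
    by_cases hv : v ∈ spine T
    · have := hb v ((hs' v).2 ⟨hva, hv⟩)
      omega
    · simp [hz v hv]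

end Rooting

section Skeleton

variable {V : Type} {T : SimpleGraph V}

/-- A rooted tree with a set `S` of inner vertices and a path `P` from the root to `b`, off which
`S` does not branch, together with a numbering of the at most four branches of `S` leaving `P`:
those with numbers `0` and `1` leave at the root, those with numbers `2` and `3` at `b`. -/
structure Skeleton (R : Rooting T) where
  S : Set V
  P : Set V
  b : V
  code : V → ℕ
  par_mem : ∀ v, v ≠ R.a → R.par v ∈ S
  a_mem : R.a ∈ P
  P_par : ∀ v ∈ P, R.par v ∈ P
  P_depth : ∀ v ∈ P, R.depth v ≤ R.depth b
  P_inj : ∀ v ∈ P, ∀ w ∈ P, R.depth v = R.depth w → v = w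
  eq_of_par_eq : ∀ v w, v ≠ R.a → w ≠ R.a → v ∈ S → w ∈ S → R.par v = R.par w → R.par v ∉ P → v = w
  code_inj : ∀ v w, v ∈ S → v ∉ P → R.par v ∈ P → w ∈ S → w ∉ P → R.par w ∈ P →
    code v = code w → v = w
  code_spec : ∀ v, v ∈ S → v ∉ P → R.par v ∈ P →
    (R.par v = R.a ∧ code v < 2) ∨ (R.par v = b ∧ 2 ≤ code v ∧ code v < 4)

namespace Skeleton

variable {R : Rooting T} (K : Skeleton R)

/-- The first vertices of the branches of `S` leaving `P`. -/
def Q (v : V) : Prop := v ∈ K.S ∧ v ∉ K.P ∧ R.par v ∈ K.P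

variable (R) in
/-- The side of the fold line on which a vertex lies. -/
def rail (v : V) : Bool := decide (R.depth v % 2 = 0)

/-- The corner to which a branch is assigned. -/
def corner (k : ℕ) : Bool × Bool :=
  (decide (2 ≤ k), (if 2 ≤ k then rail R K.b else true) == decide (k % 2 = 1))

/-- The depth of the last unlabelled vertex on the way to a branch. -/
def base (k : ℕ) : ℕ := (if 2 ≤ k then R.depth K.b else 0) + (if k % 2 = 0 then 1 else 0)

open Classical in
/-- The label of a vertex, determined by the label of its parent. -/
def stepLabel (v : V) : Option (Bool × Bool) → Option (Bool × Bool)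
  | some c => some c
  | none => if K.Q v then (if K.code v % 2 = 1 then some (K.corner (K.code v)) else none)
      else if K.Q (R.par v) then some (K.corner (K.code (R.par v))) else none

/-- The label of a vertex at a given depth. -/
def labelAux : ℕ → V → Option (Bool × Bool)
  | 0, _ => none
  | n + 1, v => K.stepLabel v (labelAux n (R.par v))

/-- The label of a vertex. -/
def label (v : V) : Option (Bool × Bool) := K.labelAux (R.depth v) v

theorem label_a : K.label R.a = none := by simp [label, R.depth_a, labelAux]

theorem label_of_ne {v : V} (hv : v ≠ R.a) : K.label v = K.stepLabel v (K.label (R.par v)) := by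
  rw [label, R.depth_par v hv, labelAux, label]

theorem corner_inj {k l : ℕ} (hk : k < 4) (hl : l < 4) (h : K.corner k = K.corner l) : k = l := by
  unfold corner at h
  cases hb : rail R K.b <;> rw [hb] at h <;> interval_cases k <;> interval_cases l <;> simp_all

theorem rail_eq {v w : V} (h : rail R v = rail R w) : R.depth v % 2 = R.depth w % 2 := by
  have := decide_eq_decide.1 h
  omega

theorem rail_par {v : V} (hv : v ≠ R.a) : rail R (R.par v) = !rail R v := by
  have := R.depth_par v hv
  unfold rail
  rw [← decide_not, decide_eq_decide]
  omega

theorem corner_snd (k : ℕ) : (K.corner k).2 = decide (K.base k % 2 = 0) := by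
  unfold corner base rail
  rcases Nat.mod_two_eq_zero_or_one k with h | h <;> by_cases h2 : 2 ≤ k <;>
    rcases Nat.mod_two_eq_zero_or_one (R.depth K.b) with h3 | h3 <;> simp [h, h2, h3] <;> omega

variable {K}

theorem Q.ne {v : V} (h : K.Q v) : v ≠ R.a := by
  rintro rfl
  exact h.2.1 K.a_mem

theorem Q.depth {v : V} (h : K.Q v) :
    R.depth v = (if 2 ≤ K.code v then R.depth K.b else 0) + 1 := by
  rw [R.depth_par v h.ne]
  rcases K.code_spec v h.1 h.2.1 h.2.2 with ⟨h1, h2⟩ | ⟨h1, h2, -⟩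
  · rw [h1, R.depth_a, if_neg (by omega)]
  · rw [h1, if_pos h2]

theorem Q.lt {v : V} (h : K.Q v) : K.code v < 4 := by
  rcases K.code_spec v h.1 h.2.1 h.2.2 with ⟨-, h2⟩ | ⟨-, -, h2⟩ <;> omega

theorem Q.eq {v w : V} (h : K.Q v) (h' : K.Q w) (hc : K.code v = K.code w) : v = w :=
  K.code_inj v w h.1 h.2.1 h.2.2 h'.1 h'.2.1 h'.2.2 hc

theorem label_of_mem_P {v : V} (h : v ∈ K.P) : K.label v = none := by
  induction hn : R.depth v generalizing v with
  | zero => rw [R.eq_of_depth_eq_zero hn, label_a]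
  | succ n ih =>
    have hv := R.ne_of_depth_pos (v := v) (by omega)
    have h1 := R.depth_par v hv
    rw [label_of_ne _ hv, ih (K.P_par v h) (by omega), stepLabel, if_neg (fun hq => hq.2.1 h),
      if_neg (fun hq => hq.2.1 (K.P_par v h))]

theorem Q.label {v : V} (h : K.Q v) :
    K.label v = if K.code v % 2 = 1 then some (K.corner (K.code v)) else none := by
  rw [label_of_ne _ h.ne, label_of_mem_P h.2.2, stepLabel, if_pos h]

theorem of_label_eq_none {v : V} (h : K.label v = none) :
    v ∈ K.P ∨ (v ∉ K.S ∧ R.par v ∈ K.P) ∨ (K.Q v ∧ K.code v % 2 = 0) := by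
  induction hn : R.depth v generalizing v with
  | zero => exact .inl (R.eq_of_depth_eq_zero hn ▸ K.a_mem)
  | succ n ih =>
    have hv := R.ne_of_depth_pos (v := v) (by omega)
    have h1 := R.depth_par v hv
    by_cases hq : K.Q v
    · refine .inr (.inr ⟨hq, ?_⟩)
      rw [hq.label] at h
      split_ifs at h
      omega
    by_cases hp : R.par v ∈ K.P
    · by_cases hvP : v ∈ K.P
      · exact .inl hvP
      · exact .inr (.inl ⟨fun hS => hq ⟨hS, hvP, hp⟩, hp⟩)
    rw [label_of_ne _ hv] at h
    cases hl : K.label (R.par v) with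
    | some c => rw [hl] at h; simp [stepLabel] at h
    | none =>
      rcases ih hl (by omega) with h2 | h2 | h2
      · exact absurd h2 hp
      · exact absurd (K.par_mem v hv) h2.1
      · rw [hl, stepLabel, if_neg hq, if_pos h2.1] at h
        simp at h

theorem depth_le_of_label_eq_none {v : V} (h : K.label v = none) :
    R.depth v ≤ R.depth K.b + 1 := by
  have key : R.par v ∈ K.P → R.depth v ≤ R.depth K.b + 1 := by
    intro hp
    by_cases hv : v = R.a
    · rw [hv, R.depth_a]; omega
    · have := K.P_depth _ hp
      rw [R.depth_par v hv]; omega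
  rcases of_label_eq_none h with h | h | h
  · exact (K.P_depth v h).trans (Nat.le_succ _)
  · exact key h.2
  · exact key h.1.2.2

theorem of_label_eq_some {v : V} {c : Bool × Bool} (h : K.label v = some c) :
    v ≠ R.a ∧ ∃ k < 4, c = K.corner k ∧
      ((K.label (R.par v) = some c ∧ K.base k + 1 < R.depth v) ∨
        (K.label (R.par v) = none ∧ R.depth v = K.base k + 1 ∧
          ((K.Q v ∧ K.code v = k ∧ k % 2 = 1) ∨
            (K.Q (R.par v) ∧ K.code (R.par v) = k ∧ k % 2 = 0)))) := by
  induction hn : R.depth v generalizing v with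
  | zero => rw [R.eq_of_depth_eq_zero hn, label_a] at h; simp at h
  | succ n ih =>
    have hv := R.ne_of_depth_pos (v := v) (by omega)
    have h1 := R.depth_par v hv
    refine ⟨hv, ?_⟩
    rw [label_of_ne _ hv] at h
    cases hl : K.label (R.par v) with
    | some d =>
      rw [hl] at h
      obtain rfl : d = c := by simpa [stepLabel] using h
      obtain ⟨-, k, hk, hc, h2⟩ := ih hl (by omega)
      refine ⟨k, hk, hc, .inl ⟨rfl, ?_⟩⟩
      rcases h2 with h2 | h2
      · omega
      · omega
    | none =>
      rw [hl, stepLabel] at h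
      split_ifs at h with h2 h3 h4
      · refine ⟨_, h2.lt, (Option.some.inj h).symm, .inr ⟨rfl, ?_, .inl ⟨h2, rfl, h3⟩⟩⟩
        rw [← hn, h2.depth, base, if_neg (by omega : ¬ K.code v % 2 = 0)]
      · have h5 : K.code (R.par v) % 2 = 0 := by
          rw [h4.label] at hl
          split_ifs at hl
          omega
        refine ⟨_, h4.lt, (Option.some.inj h).symm, .inr ⟨rfl, ?_, .inr ⟨h4, rfl, h5⟩⟩⟩
        rw [← hn, h1, h4.depth, base, if_pos h5]

/-- The first vertex of the branch numbered `0`. -/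
def QZero (K : Skeleton R) (v : V) : Prop := K.Q v ∧ K.code v = 0

theorem QZero.depth {v : V} (h : K.QZero v) : R.depth v = 1 := by
  rw [h.1.depth, h.2]; rfl

theorem QZero.label {v : V} (h : K.QZero v) : K.label v = none := by
  rw [h.1.label, h.2]; rfl

theorem label_of_QZero_par {w : V} (hw : w ≠ R.a) (h : K.QZero (R.par w)) :
    K.label w = some (K.corner 0) := by
  rw [label_of_ne _ hw, h.label, stepLabel, if_neg (fun hq => h.1.2.1 hq.2.2), if_pos h.1, h.2]

theorem eq_of_label_eq {v w : V} (hv : v ∈ K.S) (hw : w ∈ K.S) (hv0 : ¬ K.QZero v)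
    (hw0 : ¬ K.QZero w) (hl : K.label v = K.label w) (hd : R.depth v = R.depth w) : v = w := by
  induction hn : R.depth v generalizing v w with
  | zero => exact (R.eq_of_depth_eq_zero hn).trans (R.eq_of_depth_eq_zero (hd ▸ hn)).symm
  | succ n ih =>
    have hva := R.ne_of_depth_pos (v := v) (by omega)
    have hwa := R.ne_of_depth_pos (v := w) (by omega)
    have h1 := R.depth_par v hva
    have h1' := R.depth_par w hwa
    cases hc : K.label v with
    | none =>
      have key : ∀ u, u ∈ K.S → ¬ K.QZero u → K.label u = none →
          u ∈ K.P ∨ K.Q u ∧ K.code u = 2 := by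
        intro u hu hu0 hl
        rcases of_label_eq_none hl with h | h | h
        · exact .inl h
        · exact absurd hu h.1
        · have h2 := h.1.lt
          have h3 : K.code u ≠ 0 := fun h3 => hu0 ⟨h.1, h3⟩
          exact .inr ⟨h.1, by omega⟩
      have hdep : ∀ u, K.Q u → K.code u = 2 → R.depth u = R.depth K.b + 1 := by
        intro u h h'
        rw [h.depth, h', if_pos le_rfl]
      rcases key v hv hv0 hc with h2 | h2 <;> rcases key w hw hw0 (hl ▸ hc) with h3 | h3
      · exact K.P_inj v h2 w h3 hd
      · have := K.P_depth v h2
        have := hdep w h3.1 h3.2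
        omega
      · have := K.P_depth w h3
        have := hdep v h2.1 h2.2
        omega
      · exact h2.1.eq h3.1 (h2.2.trans h3.2.symm)
    | some c =>
      obtain ⟨-, k, hk, hck, h2⟩ := of_label_eq_some hc
      obtain ⟨-, l, hl4, hcl, h3⟩ := of_label_eq_some (hl ▸ hc)
      obtain rfl : k = l := K.corner_inj hk hl4 (hck ▸ hcl)
      rcases h2 with ⟨h2, h2'⟩ | ⟨h2, h2', h4⟩ <;> rcases h3 with ⟨h3, h3'⟩ | ⟨h3, h3', h5⟩
      · refine K.eq_of_par_eq v w hva hwa hv hw ?_ fun hP => ?_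
        · refine ih (K.par_mem v hva) (K.par_mem w hwa) (fun h => ?_) (fun h => ?_)
            (h2.trans h3.symm) (by omega) (by omega)
          · rw [h.label] at h2; simp at h2
          · rw [h.label] at h3; simp at h3
        · rw [label_of_mem_P hP] at h2; simp at h2
      · omega
      · omega
      · rcases h4 with ⟨h4, h6, h7⟩ | ⟨h4, h6, h7⟩ <;> rcases h5 with ⟨h5, h8, h9⟩ | ⟨h5, h8, h9⟩
        · exact h4.eq h5 (h6.trans h8.symm)
        · omega
        · omega
        · exact K.eq_of_par_eq v w hva hwa hv hw (h4.eq h5 (h6.trans h8.symm)) h4.2.1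

variable [Fintype V]

open Classical in
variable (K) in
/-- The rank of a vertex among those of its depth. -/
def prio (v : V) : ℕ :=
  if K.QZero v then 0 else if v ∈ K.S then Fintype.card V + 1 else Fintype.equivFin V v + 1

variable (K) in
/-- The position of a vertex along its rail. -/
def rank (v : V) : ℕ := (Fintype.card V + 2) * R.depth v + K.prio v

theorem prio_le (v : V) : K.prio v ≤ Fintype.card V + 1 := by
  unfold prio
  split_ifs <;> omega

theorem prio_par {v : V} (hv : v ≠ R.a) (h : ¬ K.QZero (R.par v)) :
    K.prio (R.par v) = Fintype.card V + 1 := by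
  rw [prio, if_neg h, if_pos (K.par_mem v hv)]

theorem rank_lt {v w : V} (h : R.depth v < R.depth w) : K.rank v < K.rank w := by
  have h1 := K.prio_le v
  have h2 := Nat.mul_le_mul_left (Fintype.card V + 2) h
  rw [Nat.succ_eq_add_one, Nat.mul_add] at h2
  unfold rank
  omega

theorem depth_le_of_rank_le {v w : V} (h : K.rank v ≤ K.rank w) : R.depth v ≤ R.depth w := by
  by_contra! h1
  exact absurd (K.rank_lt h1) (by omega)

theorem rank_le_par {v w : V} (hw : w ≠ R.a) (h : R.depth v ≤ R.depth (R.par w))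
    (h0 : ¬ K.QZero (R.par w)) : K.rank v ≤ K.rank (R.par w) := by
  have h1 := K.prio_le v
  have h2 := Nat.mul_le_mul_left (Fintype.card V + 2) h
  rw [rank, rank, prio_par hw h0]
  omega

theorem rank_inj {v w : V} (hl : K.label v = K.label w) (hk : K.rank v = K.rank w) : v = w := by
  have hd : R.depth v = R.depth w :=
    le_antisymm (depth_le_of_rank_le hk.le) (depth_le_of_rank_le hk.ge)
  have hp : K.prio v = K.prio w := by
    rw [rank, rank, hd] at hk; omega
  have h1 := (Fintype.equivFin V v).2
  have h2 := (Fintype.equivFin V w).2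
  unfold prio at hp
  split_ifs at hp with h3 h4 h5 h6 h7 h8 h9 <;> try omega
  · exact h3.1.eq h4.1 (h3.2.trans h4.2.symm)
  · exact eq_of_label_eq ‹_› ‹_› ‹_› ‹_› hl hd
  · exact (Fintype.equivFin V).injective (Fin.ext (by omega))

theorem rank_extremal {v u : V} {k : ℕ} (hv : v ≠ R.a) (hk : k < 4)
    (hd : R.depth v = K.base k + 1)
    (h : (K.Q v ∧ K.code v = k ∧ k % 2 = 1) ∨
      (K.Q (R.par v) ∧ K.code (R.par v) = k ∧ k % 2 = 0))
    (hu : K.label u = none) (hs : R.depth u % 2 = K.base k % 2) :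
    if (K.corner k).1 then K.rank u ≤ K.rank (R.par v) else K.rank (R.par v) ≤ K.rank u := by
  have h1 := R.depth_par v hv
  have h2 := depth_le_of_label_eq_none hu
  by_cases h2k : 2 ≤ k
  · have h0 : ¬ K.QZero (R.par v) := by
      rintro ⟨h3, h4⟩
      rcases h with h | h
      · exact h3.2.1 h.1.2.2
      · omega
    rw [if_pos (by simpa [corner] using h2k)]
    refine rank_le_par hv ?_ h0
    rw [base, if_pos h2k] at hs hd
    split_ifs at hs hd <;> omega
  · rw [if_neg (by simpa [corner] using h2k)]
    rw [base, if_neg h2k] at hs hd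
    rcases h with ⟨h3, h4, h5⟩ | ⟨h3, h4, h5⟩
    · rw [if_neg (by omega)] at hs hd
      have h6 : R.par v = R.a := R.eq_of_depth_eq_zero (by omega)
      by_cases h7 : R.depth u = 0
      · rw [h6, R.eq_of_depth_eq_zero h7]
      · exact (rank_lt (by omega)).le
    · rw [if_pos h5] at hs hd
      have h6 : K.QZero (R.par v) := ⟨h3, by omega⟩
      have h7 := Nat.mul_le_mul_left (Fintype.card V + 2) (show R.depth (R.par v) ≤ R.depth u by omega)
      rw [rank, rank, prio, if_pos h6]
      omega

variable (K) in
/-- The layout determined by a skeleton. -/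
def layout : Layout T where
  a := R.a
  par := R.par
  s := rail R
  key := K.rank
  lab := K.label
  key_par v hv := rank_lt (by rw [R.depth_par v hv]; omega)
  s_par v hv := rail_par hv
  lab_a := K.label_a
  lab_par v hv h := by
    cases hl : K.label (R.par v) with
    | none => rfl
    | some c => rw [label_of_ne _ hv, hl] at h; simp [stepLabel] at h
  lab_par_some v c h := by
    obtain ⟨hv, k, hk, rfl, h1 | ⟨h1, h2, h3⟩⟩ := of_label_eq_some h
    · exact .inl h1.1
    · have h4 := R.depth_par v hv
      refine .inr ⟨h1, ?_, fun u hu hs => rank_extremal hv hk h2 h3 hu ?_⟩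
      · rw [corner_snd, rail, show R.depth (R.par v) = K.base k by omega]
      · rw [corner_snd, rail, decide_eq_decide] at hs
        omega
  key_le_par v w hv hw hl hk hs := by
    have h1 := depth_le_of_rank_le hk.le
    have h2 := rail_eq hs
    have h3 := R.depth_par w hw
    have h4 : R.depth v ≤ R.depth (R.par w) := by omega
    by_cases h0 : K.QZero (R.par w)
    · rcases h4.lt_or_eq with h5 | h5
      · exact (rank_lt h5).le
      · rw [label_of_QZero_par hw h0] at hl
        obtain ⟨-, k, hk4, hc, h6⟩ := of_label_eq_some hl
        obtain rfl := K.corner_inj (by omega) hk4 hc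
        have h7 : K.base 0 = 1 := rfl
        have h8 := h0.depth
        omega
    · exact rank_le_par hw h4 h0
  par_le_par v w hv hw hl hk hs := by
    have h1 := depth_le_of_rank_le hk.le
    have h2 := R.depth_par v hv
    have h3 := R.depth_par w hw
    have h4 : R.depth (R.par v) ≤ R.depth (R.par w) := by omega
    by_cases h0 : K.QZero (R.par w)
    · rcases h4.lt_or_eq with h5 | h5
      · exact (rank_lt h5).le
      · rw [label_of_QZero_par hw h0] at hl
        obtain ⟨-, k, hk4, hc, h6⟩ := of_label_eq_some hl
        obtain rfl := K.corner_inj (by omega) hk4 hc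
        have h7 : K.base 0 = 1 := rfl
        have h8 := h0.depth
        rcases h6 with h6 | ⟨-, -, h6 | h6⟩
        · omega
        · omega
        · rw [h6.1.eq h0.1 (h6.2.1.trans h0.2.symm)]
    · exact rank_le_par hw h4 h0
  key_inj v w hl hk := rank_inj hl hk
  adj_iff := R.adj_iff

end Skeleton

theorem Finset.exists_injOn_lt {α : Type*} (s : Finset α) :
    ∃ f : α → ℕ, InjOn f s ∧ ∀ v ∈ s, f v < s.card := by
  classical
  refine ⟨fun v => if h : v ∈ s then s.equivFin ⟨v, h⟩ else 0, fun v hv w hw h => ?_,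
    fun v hv => ?_⟩
  · rw [Finset.mem_coe] at hv hw
    simp only [dif_pos hv, dif_pos hw] at h
    simpa using s.equivFin.injective (Fin.ext h)
  · simp only [dif_pos hv, Fin.is_lt]

namespace Rooting

variable (R : Rooting T)

/-- The path from a vertex to the root. -/
def ancestors (b : V) : Set V := {v | ∃ n, R.par^[n] b = v}

variable {R}

theorem depth_iterate (b : V) (n : ℕ) : R.depth (R.par^[n] b) = R.depth b - n := by
  induction n with
  | zero => rfl
  | succ n ih =>
    rw [Function.iterate_succ_apply']
    by_cases h : R.par^[n] b = R.a
    · rw [h, R.depth_a] at ih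
      rw [h, R.par_a, R.depth_a]
      omega
    · have := R.depth_par _ h
      omega

theorem par_mem_ancestors {b v : V} (h : v ∈ R.ancestors b) : R.par v ∈ R.ancestors b := by
  obtain ⟨n, rfl⟩ := h
  exact ⟨n + 1, Function.iterate_succ_apply' _ _ _⟩

theorem root_mem_ancestors (b : V) : R.a ∈ R.ancestors b :=
  ⟨R.depth b, R.eq_of_depth_eq_zero (by rw [depth_iterate, Nat.sub_self])⟩

theorem depth_le_of_mem_ancestors {b v : V} (h : v ∈ R.ancestors b) : R.depth v ≤ R.depth b := by
  obtain ⟨n, rfl⟩ := h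
  rw [depth_iterate]
  exact Nat.sub_le _ _

theorem eq_of_mem_ancestors {b v w : V} (hv : v ∈ R.ancestors b) (hw : w ∈ R.ancestors b)
    (h : R.depth v = R.depth w) : v = w := by
  by_cases h0 : R.depth v = 0
  · exact (R.eq_of_depth_eq_zero h0).trans (R.eq_of_depth_eq_zero (h ▸ h0)).symm
  · obtain ⟨n, rfl⟩ := hv
    obtain ⟨m, rfl⟩ := hw
    rw [depth_iterate] at h h0
    rw [depth_iterate] at h
    rw [show n = m by omega]

theorem ancestors_subset (ha : R.a ∈ spine T) {b : V} (hb : b ∈ spine T) :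
    R.ancestors b ⊆ spine T := by
  rintro _ ⟨n, rfl⟩
  induction n with
  | zero => exact hb
  | succ n ih =>
    rw [Function.iterate_succ_apply']
    by_cases h : R.par^[n] b = R.a
    · rw [h, R.par_a]; exact ha
    · exact par_mem_spine ha h

theorem exists_kid_mem_ancestors [Fintype V] (ha : R.a ∈ spine T) {b : V} (hb : b ∈ spine T)
    {v : V} (hv : v ∈ R.ancestors b) (hvb : v ≠ b) : ∃ u ∈ R.ancestors b, u ∈ R.kids v := by
  obtain ⟨n, rfl⟩ := hv
  induction n with
  | zero => exact absurd rfl hvb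
  | succ n ih =>
    rw [Function.iterate_succ_apply'] at hvb ⊢
    by_cases h : R.par^[n] b = R.a
    · rw [h, R.par_a] at hvb ⊢
      rw [h] at ih
      exact ih hvb
    · exact ⟨_, ⟨n, rfl⟩, mem_kids.2 ⟨h, ancestors_subset ha hb ⟨n, rfl⟩, rfl⟩⟩

end Rooting

open Rooting in
theorem exists_layout [Fintype V] (hT : T.IsTree) (h3 : 3 ≤ Fintype.card V)
    (h : (spineLeaves T).ncard ≤ 4) : Nonempty (Layout T) := by
  classical
  obtain ⟨R, b, ha, hb, hone, heq, hne⟩ := exists_rooting_branching hT h3 h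
  have heqpar : ∀ v w, v ≠ R.a → w ≠ R.a → v ∈ spine T → w ∈ spine T → R.par v = R.par w →
      R.par v ≠ R.a → R.par v ≠ b → v = w := by
    intro v w hv hw hvS hwS hp h1 h2
    exact Finset.card_le_one.1 (hone _ h1 h2) v (mem_kids.2 ⟨hv, hvS, rfl⟩) w
      (mem_kids.2 ⟨hw, hwS, hp.symm⟩)
  have hpar : ∀ v, v ∈ spine T → v ∉ R.ancestors b → R.par v ∈ R.ancestors b →
      v ≠ R.a ∧ (R.par v = R.a ∨ R.par v = b) := by
    intro v hvS hvP hp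
    have hva : v ≠ R.a := fun h => hvP (h ▸ root_mem_ancestors b)
    refine ⟨hva, ?_⟩
    by_contra! hc
    obtain ⟨u, hu, hk⟩ := exists_kid_mem_ancestors ha hb hp hc.2
    have hk := mem_kids.1 hk
    exact hvP (heqpar u v hk.1 hva hk.2.1 hvS hk.2.2 (hk.2.2 ▸ hc.1) (hk.2.2 ▸ hc.2) ▸ hu)
  obtain ⟨code, hinj, hspec⟩ : ∃ code : V → ℕ,
      (∀ v w, v ∈ spine T → v ∉ R.ancestors b → R.par v ∈ R.ancestors b → w ∈ spine T →
        w ∉ R.ancestors b → R.par w ∈ R.ancestors b → code v = code w → v = w) ∧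
      ∀ v, v ∈ spine T → v ∉ R.ancestors b → R.par v ∈ R.ancestors b →
        (R.par v = R.a ∧ code v < 2) ∨ (R.par v = b ∧ 2 ≤ code v ∧ code v < 4) := by
    obtain ⟨f, hf, hf'⟩ := (R.kids b).exists_injOn_lt
    by_cases hba : b = R.a
    · have hmem : ∀ v, v ∈ spine T → v ∉ R.ancestors b → R.par v ∈ R.ancestors b →
          v ∈ R.kids b := by
        intro v h1 h2 h3
        obtain ⟨h4, h5⟩ := hpar v h1 h2 h3
        rw [← hba, or_self] at h5
        exact mem_kids.2 ⟨h4, h1, h5⟩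
      refine ⟨f, fun v w h1 h2 h3 h4 h5 h6 h7 => hf (hmem v h1 h2 h3) (hmem w h4 h5 h6) h7,
        fun v h1 h2 h3 => ?_⟩
      have h4 := (mem_kids.1 (hmem v h1 h2 h3)).2.2
      have h5 := hf' v (hmem v h1 h2 h3)
      have h6 := heq hba
      rw [← hba, h4]
      have : f v < 2 ∨ 2 ≤ f v := by omega
      rcases this with h7 | h7
      · exact .inl ⟨rfl, h7⟩
      · exact .inr ⟨rfl, h7, by omega⟩
    · obtain ⟨u, hu, huk⟩ := exists_kid_mem_ancestors ha hb (root_mem_ancestors b) (Ne.symm hba)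
      obtain ⟨g, hg, hg'⟩ := ((R.kids R.a).erase u).exists_injOn_lt
      rw [Finset.card_erase_of_mem huk] at hg'
      obtain ⟨hca, hcb⟩ := hne hba
      have hmem : ∀ v, v ∈ spine T → v ∉ R.ancestors b → R.par v ∈ R.ancestors b →
          (R.par v = R.a ∧ v ∈ (R.kids R.a).erase u) ∨ (R.par v ≠ R.a ∧ v ∈ R.kids b) := by
        intro v h1 h2 h3
        obtain ⟨h4, h5⟩ := hpar v h1 h2 h3
        rcases h5 with h5 | h5
        · refine .inl ⟨h5, Finset.mem_erase.2 ⟨?_, mem_kids.2 ⟨h4, h1, h5⟩⟩⟩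
          rintro rfl
          exact h2 hu
        · exact .inr ⟨h5 ▸ hba, mem_kids.2 ⟨h4, h1, h5⟩⟩
      refine ⟨fun v => if R.par v = R.a then g v else 2 + f v,
        fun v w h1 h2 h3 h4 h5 h6 h7 => ?_, fun v h1 h2 h3 => ?_⟩
      · rcases hmem v h1 h2 h3 with ⟨h8, h9⟩ | ⟨h8, h9⟩ <;>
          rcases hmem w h4 h5 h6 with ⟨h10, h11⟩ | ⟨h10, h11⟩ <;>
          simp only [h8, h10, if_true, if_false] at h7
        · exact hg h9 h11 h7
        · have := hg' v h9; omega
        · have := hg' w h11; omega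
        · exact hf h9 h11 (by omega)
      · rcases hmem v h1 h2 h3 with ⟨h8, h9⟩ | ⟨h8, h9⟩
        · have := hg' v h9
          exact .inl ⟨h8, by simp only [h8, if_true]; omega⟩
        · have := hf' v h9
          refine .inr ⟨(mem_kids.1 h9).2.2, ?_⟩
          simp only [h8, if_false]
          omega
  exact ⟨Skeleton.layout
    { S := spine T
      P := R.ancestors b
      b := b
      code := code
      par_mem := fun v hv => par_mem_spine ha hv
      a_mem := root_mem_ancestors b
      P_par := fun v hv => par_mem_ancestors hv
      P_depth := fun v hv => depth_le_of_mem_ancestors hv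
      P_inj := fun v hv w hw h => eq_of_mem_ancestors hv hw h
      eq_of_par_eq := fun v w hv hw hvS hwS hp hP => heqpar v w hv hw hvS hwS hp
        (fun h => hP (h ▸ root_mem_ancestors b)) (fun h => hP (h ▸ ⟨0, rfl⟩))
      code_inj := hinj
      code_spec := hspec }⟩

end Skeleton

theorem IsCreaseOf.symm {K : Set ℂ} {φ : ℂ → ℂ} {u v : ℂ} (h : IsCreaseOf K φ u v) :
    IsCreaseOf K φ v u :=
  ⟨h.2.1, h.1, h.2.2.1.symm, openSegment_symm ℝ u v ▸ h.2.2.2.1,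
    openSegment_symm ℝ u v ▸ h.2.2.2.2⟩

theorem stmt19_square_trees (V : Type) [Fintype V] (T : SimpleGraph V)
    (hT : T.IsTree) (h3 : 3 ≤ Fintype.card V) :
    (∃ (K : Set ℂ) (φ : ℂ → ℂ), IsSquareRegion K ∧ IsOuterGlobalFlatFolding K φ ∧
      Nonempty (T ≃g outerGraph K φ)) ↔ (spineLeaves T).ncard ≤ 4 := by
  constructor
  · rintro ⟨K, φ, hsq, hφ, ⟨e⟩⟩
    refine spineLeaves_ncard_le_four (f := fun v => (e v).1) hT h3 hsq hφ.1.convex (fun v => ?_)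
      (Subtype.val_injective.comp e.injective) (φ := φ) fun v w h => ?_
    · obtain ⟨q, hq⟩ := (e v).2
      exact hφ.1.compact.isClosed.frontier_subset hq.1
    · rcases (e.map_adj_iff.2 h).2 with h | h
      · exact h
      · exact h.symm
  · intro h
    have : Nontrivial V := Fintype.one_lt_card_iff_nontrivial.1 (by omega)
    obtain ⟨L⟩ := exists_layout hT h3 h
    exact L.exists_folding fun v => hT.connected.preconnected.exists_adj_of_nontrivial v
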